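/- Let D(R) be a relativizable first-order generalized dependency. Then the following are equivalent: (i) D is equivalent to a first-order sentence of the form ⋁_{k=1}^{l} ( ψ_k ∧ ⋀_{i=1}^{n_k} ∃ȳᵏᵢ ∀x̄ (R x̄ → θᵏᵢ(x̄, ȳᵏᵢ)) ∧ ⋀_{j=1}^{n'_k} ¬∃z̄ᵏⱼ ∀x̄ (R x̄ → ξᵏⱼ(x̄, z̄ᵏⱼ)) ), where all ψ_k are first-order sentences over the empty vocabulary and all θᵏᵢ, ξᵏⱼ are first-order formulas over the empty vocabulary; (ii) both D and ∼D are definable in FO(𝒟₀, ⊔, const, All); (iii) D is doubly strongly first order; (iv) both D and ∼D are strongly first order. -/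

import Mathlib

namespace DSFO

/-- A purely relational signature: for each arity, a type of relation symbols. -/
abbrev Signature := ℕ → Type

/-- The empty signature. -/
def Sig0 : Signature := fun _ => Empty

/-- The signature with a single `k`-ary relation symbol `R`. -/
def SigR (k : ℕ) : Signature := fun n => PLift (n = k)

/-- Syntax of team-semantics formulas (in negation normal form, with the two
additional connectives: global disjunction `gdisj` and contradictory negation
`cneg`) over a relational signature `S`, with generalized dependency atoms
indexed by `ι` with arities `ar`.  Variables are natural numbers. -/
inductive TS (S : Signature) (ι : Type) (ar : ι → ℕ) : Type
  | rel {k : ℕ} (r : S k) (v : Fin k → ℕ)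
  | nrel {k : ℕ} (r : S k) (v : Fin k → ℕ)
  | eq (x y : ℕ)
  | neq (x y : ℕ)
  | dep (i : ι) (v : Fin (ar i) → ℕ)
  | and (φ ψ : TS S ι ar)
  | or (φ ψ : TS S ι ar)
  | gdisj (φ ψ : TS S ι ar)
  | cneg (φ : TS S ι ar)
  | ex (v : ℕ) (φ : TS S ι ar)
  | al (v : ℕ) (φ : TS S ι ar)

/-- The always-true literal `⊤`. -/
def TS.top {S : Signature} {ι : Type} {ar : ι → ℕ} : TS S ι ar := .eq 0 0

/-- The arity function for "no dependency atoms". -/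
def noAtoms : Empty → ℕ := fun e => e.elim

/-- First-order formulas over `S` (no dependency atoms; here `cneg` plays the
role of ordinary classical negation and `gdisj` of ordinary disjunction, so
this is full first-order logic). -/
abbrev FOF (S : Signature) := TS S Empty noAtoms

/-- First-order formulas over the empty signature. -/
abbrev EF := FOF Sig0

/-- Free variables of a formula. -/
def fv {S : Signature} {ι : Type} {ar : ι → ℕ} : TS S ι ar → Set ℕ
  | .rel _ v => Set.range v
  | .nrel _ v => Set.range v
  | .eq x y => {x, y}
  | .neq x y => {x, y}
  | .dep _ v => Set.range v
  | .and φ ψ => fv φ ∪ fv ψ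
  | .or φ ψ => fv φ ∪ fv ψ
  | .gdisj φ ψ => fv φ ∪ fv ψ
  | .cneg φ => fv φ
  | .ex v φ => fv φ \ {v}
  | .al v φ => fv φ \ {v}

/-- A sentence is a formula with no free variables. -/
def IsSentence {S : Signature} {ι : Type} {ar : ι → ℕ} (φ : TS S ι ar) : Prop :=
  fv φ = ∅

/-- No global disjunctions occur. -/
def NoGdisj {S : Signature} {ι : Type} {ar : ι → ℕ} : TS S ι ar → Prop
  | .rel _ _ => True
  | .nrel _ _ => True
  | .eq _ _ => True
  | .neq _ _ => True
  | .dep _ _ => True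
  | .and φ ψ => NoGdisj φ ∧ NoGdisj ψ
  | .or φ ψ => NoGdisj φ ∧ NoGdisj ψ
  | .gdisj _ _ => False
  | .cneg φ => NoGdisj φ
  | .ex _ φ => NoGdisj φ
  | .al _ φ => NoGdisj φ

/-- No contradictory negations occur. -/
def NoCneg {S : Signature} {ι : Type} {ar : ι → ℕ} : TS S ι ar → Prop
  | .rel _ _ => True
  | .nrel _ _ => True
  | .eq _ _ => True
  | .neq _ _ => True
  | .dep _ _ => True
  | .and φ ψ => NoCneg φ ∧ NoCneg ψ
  | .or φ ψ => NoCneg φ ∧ NoCneg ψ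
  | .gdisj φ ψ => NoCneg φ ∧ NoCneg ψ
  | .cneg _ => False
  | .ex _ φ => NoCneg φ
  | .al _ φ => NoCneg φ

/-- Formulas of `FO(𝒟)` proper: no `gdisj` and no `cneg`. -/
def Plain {S : Signature} {ι : Type} {ar : ι → ℕ} (φ : TS S ι ar) : Prop :=
  NoCneg φ ∧ NoGdisj φ

/-- Atomic formulas: first-order literals and dependency atoms. -/
def Atomic {S : Signature} {ι : Type} {ar : ι → ℕ} : TS S ι ar → Prop
  | .rel _ _ => True
  | .nrel _ _ => True
  | .eq _ _ => True
  | .neq _ _ => True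
  | .dep _ _ => True
  | _ => False

/-- Formulas of `FO(∼₀, 𝒟)`: the contradictory negation may appear only in
front of first-order literals and dependency atoms (and there is no `gdisj`). -/
def Cneg0 {S : Signature} {ι : Type} {ar : ι → ℕ} : TS S ι ar → Prop
  | .rel _ _ => True
  | .nrel _ _ => True
  | .eq _ _ => True
  | .neq _ _ => True
  | .dep _ _ => True
  | .and φ ψ => Cneg0 φ ∧ Cneg0 ψ
  | .or φ ψ => Cneg0 φ ∧ Cneg0 ψ
  | .gdisj _ _ => False
  | .cneg φ => Atomic φ
  | .ex _ φ => Cneg0 φ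
  | .al _ φ => Cneg0 φ

/-- The negation normal form of the (dual) negation of a formula. -/
def TS.nneg {S : Signature} {ι : Type} {ar : ι → ℕ} : TS S ι ar → TS S ι ar
  | .rel r v => .nrel r v
  | .nrel r v => .rel r v
  | .eq x y => .neq x y
  | .neq x y => .eq x y
  | .dep i v => .cneg (.dep i v)
  | .and φ ψ => .or (TS.nneg φ) (TS.nneg ψ)
  | .or φ ψ => .and (TS.nneg φ) (TS.nneg ψ)
  | .gdisj φ ψ => .and (TS.nneg φ) (TS.nneg ψ)
  | .cneg φ => φ
  | .ex v φ => .al v (TS.nneg φ)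
  | .al v φ => .ex v (TS.nneg φ)

/-- Iterated existential quantification over a list of variables. -/
def exs {S : Signature} {ι : Type} {ar : ι → ℕ} (l : List ℕ) (φ : TS S ι ar) :
    TS S ι ar := l.foldr TS.ex φ

/-- An interpretation of a relational signature in a domain `M`. -/
abbrev Interp (S : Signature) (M : Type) := ∀ k, S k → Set (Fin k → M)

/-- The unique interpretation of the empty signature. -/
def eI (M : Type) : Interp Sig0 M := fun _ e => e.elim

/-- The interpretation of `SigR k` given by a `k`-ary relation `R`. -/
def interpR {k : ℕ} {M : Type} (R : Set (Fin k → M)) : Interp (SigR k) M :=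
  fun _ r => {s | (fun i => s (Fin.cast r.down.symm i)) ∈ R}

/-- Tarskian (single-assignment) satisfaction.  Dependency atoms are
(vacuously) interpreted as true; this is only used on first-order formulas. -/
def FSat {S : Signature} {ι : Type} {ar : ι → ℕ} (M : Type) (I : Interp S M) :
    (ℕ → M) → TS S ι ar → Prop
  | s, .rel r v => (fun i => s (v i)) ∈ I _ r
  | s, .nrel r v => (fun i => s (v i)) ∉ I _ r
  | s, .eq x y => s x = s y
  | s, .neq x y => s x ≠ s y
  | _, .dep _ _ => True
  | s, .and φ ψ => FSat M I s φ ∧ FSat M I s ψ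
  | s, .or φ ψ => FSat M I s φ ∨ FSat M I s ψ
  | s, .gdisj φ ψ => FSat M I s φ ∨ FSat M I s ψ
  | s, .cneg φ => ¬ FSat M I s φ
  | s, .ex v φ => ∃ m : M, FSat M I (Function.update s v m) φ
  | s, .al v φ => ∀ m : M, FSat M I (Function.update s v m) φ

/-- Truth of a first-order sentence (Tarskian semantics). -/
def FOTrue {S : Signature} {ι : Type} {ar : ι → ℕ} (M : Type) (I : Interp S M)
    (φ : TS S ι ar) : Prop :=
  ∀ s : ℕ → M, FSat M I s φ

/-- The relation `X(x̄)` determined by a team `X` and a tuple of variables `x̄`. -/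
def teamProj {M : Type} {k : ℕ} (v : Fin k → ℕ) (X : Set (ℕ → M)) :
    Set (Fin k → M) := {t | ∃ s ∈ X, t = fun j => s (v j)}

/-- (Lax) team semantics.  `A` gives the semantics of each dependency atom as a
function of the relation `X(x̄)`. -/
def TSat {S : Signature} {ι : Type} {ar : ι → ℕ} (M : Type) (I : Interp S M)
    (A : ∀ i, Set (Fin (ar i) → M) → Prop) :
    TS S ι ar → Set (ℕ → M) → Prop
  | .rel r v, X => ∀ s ∈ X, (fun i => s (v i)) ∈ I _ r
  | .nrel r v, X => ∀ s ∈ X, (fun i => s (v i)) ∉ I _ r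
  | .eq x y, X => ∀ s ∈ X, s x = s y
  | .neq x y, X => ∀ s ∈ X, s x ≠ s y
  | .dep i v, X => A i (teamProj v X)
  | .and φ ψ, X => TSat M I A φ X ∧ TSat M I A ψ X
  | .or φ ψ, X => ∃ Y Z : Set (ℕ → M), Y ∪ Z = X ∧ TSat M I A φ Y ∧ TSat M I A ψ Z
  | .gdisj φ ψ, X => TSat M I A φ X ∨ TSat M I A ψ X
  | .cneg φ, X => ¬ TSat M I A φ X
  | .ex v φ, X => ∃ H : (ℕ → M) → Set M, (∀ s ∈ X, (H s).Nonempty) ∧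
      TSat M I A φ {s' | ∃ s ∈ X, ∃ m ∈ H s, s' = Function.update s v m}
  | .al v φ, X => TSat M I A φ {s' | ∃ s ∈ X, ∃ m : M, s' = Function.update s v m}

/-- Truth of a sentence under team semantics: satisfaction by the team of all
assignments (by locality, equivalent to satisfaction by `{∅}`). -/
def TTrue {S : Signature} {ι : Type} {ar : ι → ℕ} (M : Type) (I : Interp S M)
    (A : ∀ i, Set (Fin (ar i) → M) → Prop) (φ : TS S ι ar) : Prop :=
  TSat M I A φ Set.univ

/-- A `k`-ary dependency predicate: a class of pairs `(M, R)`. -/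
abbrev DepPred (k : ℕ) := ∀ M : Type, Set (Fin k → M) → Prop

/-- Closure under isomorphisms (part of the definition of a generalized
dependency). -/
def IsoClosed {k : ℕ} (D : DepPred k) : Prop :=
  ∀ (M N : Type) (e : M ≃ N) (R : Set (Fin k → M)),
    D M R → D N ((fun f => e ∘ f) '' R)

/-- The complement `∼D` of a dependency. -/
def complD {k : ℕ} (D : DepPred k) : DepPred k := fun M R => ¬ D M R

def DownwardsClosed {k : ℕ} (D : DepPred k) : Prop :=
  ∀ (M : Type) (R R' : Set (Fin k → M)), D M R → R' ⊆ R → D M R'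

/-- The downwards closure `D↓`. -/
def dClosure {k : ℕ} (D : DepPred k) : DepPred k :=
  fun M R => ∃ R', R ⊆ R' ∧ D M R'

/-- `D_max`: the maximal models of `D`. -/
def DMax {k : ℕ} (D : DepPred k) : DepPred k :=
  fun M R => D M R ∧ ∀ R', R ⊂ R' → ¬ D M R'

/-- The empty team property. -/
def EmptyTeamProp {k : ℕ} (D : DepPred k) : Prop :=
  ∀ M : Type, Nontrivial M → D M (∅ : Set (Fin k → M))

/-- `D` is a first-order dependency: it is the class of models of a first-order
sentence over the signature `{R}`. -/
def FirstOrderDep {k : ℕ} (D : DepPred k) : Prop :=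
  ∃ ψ : FOF (SigR k), IsSentence ψ ∧
    ∀ (M : Type), Nontrivial M → ∀ R : Set (Fin k → M),
      (D M R ↔ FOTrue M (interpR R) ψ)

/-- The interpretation of a unary predicate symbol as a subset of the domain. -/
def PSet {S : Signature} {M : Type} (I : Interp S M) (P : S 1) : Set M :=
  {m | (fun _ => m) ∈ I 1 P}

/-- Semantics of the relativization `D^(P)` of `D` to the unary predicate `P`:
`𝔐 ⊨_X D^(P) x̄` iff `(P^𝔐, X(x̄)) ∈ D`. -/
def relSem {k : ℕ} (D : DepPred k) {S : Signature} (P : S 1)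
    (M : Type) (I : Interp S M) (R : Set (Fin k → M)) : Prop :=
  (∀ f ∈ R, ∀ j, f j ∈ PSet I P) ∧
    D (↥(PSet I P)) {g : Fin k → ↥(PSet I P) | (fun j => (g j : M)) ∈ R}

/-- A family `𝒟` of generalized dependencies is strongly first order: every
sentence of `FO(𝒟)` is equivalent to some first-order sentence. -/
def SFOFam {ι : Type} {ar : ι → ℕ} (D : ∀ i, DepPred (ar i)) : Prop :=
  ∀ (S : Signature) (φ : TS S ι ar), IsSentence φ → Plain φ →
    ∃ ψ : FOF S, IsSentence ψ ∧
      ∀ (M : Type), Nontrivial M → ∀ I : Interp S M,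
        (TTrue M I (fun i => D i M) φ ↔ FOTrue M I ψ)

/-- A single dependency is strongly first order iff `{D}` is. -/
def SFOd {k : ℕ} (D : DepPred k) : Prop :=
  SFOFam (ι := Unit) (ar := fun _ => k) (fun _ => D)

/-- A family `𝒟` is relativizable: every sentence of `FO(𝒟^(P))` is equivalent
to some sentence of `FO(𝒟)`. -/
def RelativizableFam {ι : Type} {ar : ι → ℕ} (D : ∀ i, DepPred (ar i)) : Prop :=
  ∀ (S : Signature) (P : S 1) (φ : TS S ι ar), IsSentence φ → Plain φ →
    ∃ ψ : TS S ι ar, IsSentence ψ ∧ Plain ψ ∧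
      ∀ (M : Type), Nontrivial M → ∀ I : Interp S M,
        (TTrue M I (fun i => relSem (D i) P M I) φ ↔ TTrue M I (fun i => D i M) ψ)

def Relativizable1 {k : ℕ} (D : DepPred k) : Prop :=
  RelativizableFam (ι := Unit) (ar := fun _ => k) (fun _ => D)

/-- The family `𝒟 ∪ ∼𝒟`. -/
def withComplFam {ι : Type} {ar : ι → ℕ} (D : ∀ i, DepPred (ar i)) :
    ∀ i : ι ⊕ ι, DepPred (Sum.elim ar ar i) :=
  fun i => match i with
    | .inl a => D a
    | .inr a => complD (D a)

/-- `D` is doubly strongly first order: `{D, ∼D}` is strongly first order. -/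
def DSFOd {k : ℕ} (D : DepPred k) : Prop :=
  SFOFam (ι := Bool) (ar := fun _ => k)
    (fun b => match b with | true => D | false => complD D)

/-- The constancy atom of arity `k`. -/
def constD (k : ℕ) : DepPred k := fun _ R => ∀ f ∈ R, ∀ g ∈ R, f = g

/-- The totality atom of arity `k`. -/
def allD (k : ℕ) : DepPred k := fun M R => R = (Set.univ : Set (Fin k → M))

/-- The family `𝒟 ∪ {const}` (constancy atoms of every arity). -/
def withConst {ι : Type} {ar : ι → ℕ} (D : ∀ i, DepPred (ar i)) :
    ∀ i : ι ⊕ ℕ, DepPred (Sum.elim ar id i) :=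
  fun i => match i with
    | .inl a => D a
    | .inr n => constD n

/-- The atoms of `𝒟^(P) ∪ {const}`. -/
def withConstRel {ι : Type} {ar : ι → ℕ} (D : ∀ i, DepPred (ar i))
    {S : Signature} (P : S 1) (M : Type) (I : Interp S M) :
    ∀ i : ι ⊕ ℕ, Set (Fin (Sum.elim ar id i) → M) → Prop :=
  fun i => match i with
    | .inl a => relSem (D a) P M I
    | .inr n => constD n M

/-- Atom indices of the logic `FO(𝒟₀, ⊔, const, All)`: the 0-ary first-order
dependencies `[ψ]`, the constancy atoms and the totality atoms. -/
inductive CIdx : Type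
  | d0 (ψ : EF) (hψ : IsSentence ψ)
  | const (k : ℕ)
  | total (k : ℕ)

def cAr : CIdx → ℕ
  | .d0 _ _ => 0
  | .const k => k
  | .total k => k

def cSem (M : Type) : ∀ i : CIdx, Set (Fin (cAr i) → M) → Prop
  | .d0 ψ _, _ => FOTrue M (eI M) ψ
  | .const _, R => ∀ f ∈ R, ∀ g ∈ R, f = g
  | .total _, R => R = Set.univ

/-- Embedding of first-order formulas over the empty signature into any
team logic. -/
def embedEF {S : Signature} {ι : Type} {ar : ι → ℕ} : EF → TS S ι ar
  | .rel r _ => Empty.elim r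
  | .nrel r _ => Empty.elim r
  | .eq x y => .eq x y
  | .neq x y => .neq x y
  | .dep i _ => Empty.elim i
  | .and φ ψ => .and (embedEF φ) (embedEF ψ)
  | .or φ ψ => .or (embedEF φ) (embedEF ψ)
  | .gdisj φ ψ => .gdisj (embedEF φ) (embedEF ψ)
  | .cneg φ => .cneg (embedEF φ)
  | .ex v φ => .ex v (embedEF φ)
  | .al v φ => .al v (embedEF φ)

/-- Override the values of the variables `0, …, k-1` by the tuple `f`. -/
def overrideFin {M : Type} (k : ℕ) (f : Fin k → M) (s : ℕ → M) : ℕ → M :=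
  fun v => if h : v < k then f ⟨v, h⟩ else s v

/-- `(M, R) ⊨ ∃ȳ ∀x̄ (R x̄ → θ(x̄, ȳ))`, where `x̄` is the tuple of variables
`0, …, k-1` and the remaining free variables `ȳ` of `θ` are witnessed by `s`. -/
def ExAllSem {k : ℕ} (M : Type) (R : Set (Fin k → M)) (θ : EF) : Prop :=
  ∃ s : ℕ → M, ∀ f ∈ R, FSat M (eI M) (overrideFin k f s) θ

/-- `(M, R) ⊨ ∃ȳ ∀x̄ (R x̄ ↔ θ(x̄, ȳ))`. -/
def ExAllIffSem {k : ℕ} (M : Type) (R : Set (Fin k → M)) (θ : EF) : Prop :=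
  ∃ s : ℕ → M, ∀ f : Fin k → M, (f ∈ R ↔ FSat M (eI M) (overrideFin k f s) θ)

/-- The assignment sending `x̄ = (0, …, k-1)` to `f`, `ȳ = (k, …, k+n-1)` to
`a`, and every other variable to its value under `s0`. -/
def tupAsg {M : Type} (k n : ℕ) (f : Fin k → M) (a : Fin n → M) (s0 : ℕ → M) :
    ℕ → M :=
  fun v => if h : v < k then f ⟨v, h⟩ else if h2 : v - k < n then a ⟨v - k, h2⟩ else s0 v

/-- `R` is defined by the formula `θ(x̄, ȳ)` (with `x̄ = (0, …, k-1)` and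
`ȳ = (k, …, k+n-1)`): there is a tuple `ā` of parameters such that
`R = {m̄ : 𝔐 ⊨ θ(m̄, ā)}`. -/
def DefinedBy {S : Signature} {M : Type} (I : Interp S M) (k n : ℕ)
    (θ : FOF S) (R : Set (Fin k → M)) : Prop :=
  ∃ a : Fin n → M, ∀ s0 : ℕ → M, R = {f | FSat M I (tupAsg k n f a s0) θ}

/-- `θ(x̄, ȳ)` fixes the identity type of `ȳ = (k, …, k+n-1)`. -/
def FixesIdType {S : Signature} (k n : ℕ) (θ : FOF S) : Prop :=
  ∀ i j : Fin n,
    (∀ (M : Type), Nontrivial M → ∀ (I : Interp S M) (s : ℕ → M),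
        FSat M I s θ → s (k + (i : ℕ)) = s (k + (j : ℕ))) ∨
    (∀ (M : Type), Nontrivial M → ∀ (I : Interp S M) (s : ℕ → M),
        FSat M I s θ → s (k + (i : ℕ)) ≠ s (k + (j : ℕ)))

/-- `(M, R := Xv) ⊨ ∃ȳ ∀x̄ (R x̄ → θ(x̄, ȳ))` where the `x̄`-slots of `θ` are the
variables `v̄` and the `ȳ`-slots are the variables `ȳ`. -/
def projExAll {M : Type} {k n : ℕ} (v : Fin k → ℕ) (y : Fin n → ℕ) (θ : EF)
    (Xv : Set (Fin k → M)) : Prop :=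
  ∃ b : Fin n → M, ∀ f ∈ Xv, ∀ s : ℕ → M,
    (∀ j, s (v j) = f j) → (∀ i, s (y i) = b i) → FSat M (eI M) s θ

section

open Function

variable {S : Signature} {ι : Type} {ar : ι → ℕ}

/-- The finite set of all variables occurring (free or bound) in a formula. -/
def avars : TS S ι ar → Finset ℕ
  | .rel _ v => Finset.univ.image v
  | .nrel _ v => Finset.univ.image v
  | .eq x y => {x, y}
  | .neq x y => {x, y}
  | .dep _ v => Finset.univ.image v
  | .and φ ψ => avars φ ∪ avars ψ
  | .or φ ψ => avars φ ∪ avars ψ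
  | .gdisj φ ψ => avars φ ∪ avars ψ
  | .cneg φ => avars φ
  | .ex v φ => insert v (avars φ)
  | .al v φ => insert v (avars φ)

lemma fv_subset_avars (φ : TS S ι ar) : fv φ ⊆ (avars φ : Set ℕ) := by
  induction φ with
  | rel r v => simp [fv, avars]
  | nrel r v => simp [fv, avars]
  | dep i v => simp [fv, avars]
  | eq x y => simp [fv, avars]
  | neq x y => simp [fv, avars]
  | and φ ψ h1 h2 => simpa [fv, avars] using Set.union_subset_union h1 h2
  | or φ ψ h1 h2 => simpa [fv, avars] using Set.union_subset_union h1 h2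
  | gdisj φ ψ h1 h2 => simpa [fv, avars] using Set.union_subset_union h1 h2
  | cneg φ h => simpa [fv, avars] using h
  | ex v φ h =>
    intro x hx
    simpa [avars] using Or.inr (h hx.1)
  | al v φ h =>
    intro x hx
    simpa [avars] using Or.inr (h hx.1)

lemma FSat_congr {M : Type} (I : Interp S M) (φ : TS S ι ar) :
    ∀ {s s' : ℕ → M}, (∀ v ∈ fv φ, s v = s' v) → (FSat M I s φ ↔ FSat M I s' φ) := by
  induction φ with
  | rel r v =>
    intro s s' h
    have : (fun i => s (v i)) = fun i => s' (v i) := funext fun i => h _ ⟨i, rfl⟩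
    simp only [FSat, this]
  | nrel r v =>
    intro s s' h
    have : (fun i => s (v i)) = fun i => s' (v i) := funext fun i => h _ ⟨i, rfl⟩
    simp only [FSat, this]
  | dep i v => intros; simp only [FSat]
  | eq x y => intro s s' h; simp only [FSat, h x (by simp [fv]), h y (by simp [fv])]
  | neq x y => intro s s' h; simp only [FSat, h x (by simp [fv]), h y (by simp [fv])]
  | and φ ψ h1 h2 =>
    intro s s' h
    simp only [FSat, h1 fun v hv => h v (Or.inl hv), h2 fun v hv => h v (Or.inr hv)]
  | or φ ψ h1 h2 =>
    intro s s' h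
    simp only [FSat, h1 fun v hv => h v (Or.inl hv), h2 fun v hv => h v (Or.inr hv)]
  | gdisj φ ψ h1 h2 =>
    intro s s' h
    simp only [FSat, h1 fun v hv => h v (Or.inl hv), h2 fun v hv => h v (Or.inr hv)]
  | cneg φ h1 => intro s s' h; simp only [FSat, h1 h]
  | ex v φ h1 =>
    intro s s' h
    refine exists_congr fun m => h1 fun x hx => ?_
    by_cases hxv : x = v
    · simp [hxv]
    · simp [hxv, h x ⟨hx, hxv⟩]
  | al v φ h1 =>
    intro s s' h
    refine forall_congr' fun m => h1 fun x hx => ?_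
    by_cases hxv : x = v
    · simp [hxv]
    · simp [hxv, h x ⟨hx, hxv⟩]

lemma FSat_sentence {M : Type} {I : Interp S M} {φ : TS S ι ar} (h : IsSentence φ)
    (s s' : ℕ → M) : FSat M I s φ ↔ FSat M I s' φ :=
  FSat_congr I φ fun v hv => by rw [IsSentence] at h; simp [h] at hv

lemma FOTrue_iff {M : Type} {I : Interp S M} {φ : TS S ι ar} (h : IsSentence φ)
    (s : ℕ → M) : FOTrue M I φ ↔ FSat M I s φ :=
  ⟨fun H => H s, fun H s' => (FSat_sentence h s s').1 H⟩

/-- The interpretation pulled back along a map of domains. -/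
def comap {M N : Type} (g : M → N) (I : Interp S N) : Interp S M :=
  fun n r => {t | g ∘ t ∈ I n r}

lemma FSat_equiv {M N : Type} (e : M ≃ N) (I : Interp S N) (φ : TS S ι ar) :
    ∀ s : ℕ → M, FSat M (comap e I) s φ ↔ FSat N I (e ∘ s) φ := by
  have upd : ∀ (s : ℕ → M) v m, e ∘ update s v m = update (e ∘ s) v (e m) :=
    fun s v m => comp_update _ _ _ _
  induction φ with
  | rel r v => intro s; rfl
  | nrel r v => intro s; rfl
  | dep i v => intros; simp only [FSat]
  | eq x y => intro s; simp [FSat]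
  | neq x y => intro s; simp [FSat]
  | and φ ψ h1 h2 => intro s; simp only [FSat, h1, h2]
  | or φ ψ h1 h2 => intro s; simp only [FSat, h1, h2]
  | gdisj φ ψ h1 h2 => intro s; simp only [FSat, h1, h2]
  | cneg φ h1 => intro s; simp only [FSat, h1]
  | ex v φ h1 =>
    intro s
    simp only [FSat, h1, upd]
    exact (e.surjective.exists (p := fun m => FSat N I (update (e ∘ s) v m) φ)).symm
  | al v φ h1 =>
    intro s
    simp only [FSat, h1, upd]
    exact (e.surjective.forall (p := fun m => FSat N I (update (e ∘ s) v m) φ)).symm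

lemma comap_eI {M N : Type} (g : M → N) : comap g (eI N) = eI M := by
  funext n r; exact r.elim

/-! ### First-order tools from Mathlib's model theory -/

section ModelTheory

open FirstOrder FirstOrder.Language

/-- The first-order language of a relational signature. -/
abbrev lang (S : Signature) : FirstOrder.Language.{0, 0} := ⟨fun _ => Empty, S⟩

/-- The structure of an interpretation. -/
@[reducible] def str {M : Type} (I : Interp S M) : (lang S).Structure M where
  funMap := fun f _ => Empty.elim f
  RelMap := fun {n} r t => t ∈ I n r

/-- Separate the variable `v` from the others. -/
def sepVar (v w : ℕ) : ℕ ⊕ Unit := if w = v then Sum.inr () else Sum.inl w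

/-- Translation into Mathlib's first-order formulas. -/
noncomputable def toF : FOF S → (lang S).Formula ℕ
  | .rel r v => Relations.formula (L := lang S) r fun i => Term.var (v i)
  | .nrel r v => ∼(Relations.formula (L := lang S) r fun i => Term.var (v i))
  | .eq x y => Term.equal (Term.var x) (Term.var y)
  | .neq x y => ∼(Term.equal (Term.var x) (Term.var y))
  | .dep _ _ => ⊤
  | .and φ ψ => toF φ ⊓ toF ψ
  | .or φ ψ => toF φ ⊔ toF ψ
  | .gdisj φ ψ => toF φ ⊔ toF ψ
  | .cneg φ => ∼(toF φ)
  | .ex v φ => Formula.iExs Unit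
      (Formula.relabel (sepVar v) (toF φ))
  | .al v φ => ∼(Formula.iExs Unit
      (Formula.relabel (sepVar v) (∼(toF φ))))

lemma elim_sepVar {M : Type} (s : ℕ → M) (v : ℕ) (i : Unit → M) :
    Sum.elim s i ∘ sepVar v = update s v (i ()) := by
  funext w
  by_cases h : w = v <;> simp [sepVar, h]

lemma realize_toF' {M : Type} [st : (lang S).Structure M] (I : Interp S M)
    (hI : ∀ n (r : S n) t, Structure.RelMap (L := lang S) r t ↔ t ∈ I n r) (φ : FOF S) :
    ∀ s : ℕ → M, (toF φ).Realize s ↔ FSat M I s φ := by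
  induction φ with
  | rel r v => intro s; exact hI _ r _
  | nrel r v => intro s; exact not_congr (hI _ r _)
  | dep i v => exact i.elim
  | eq x y => intro s; rw [toF, Formula.realize_equal]; rfl
  | neq x y => intro s; rw [toF, Formula.realize_not, Formula.realize_equal]; rfl
  | and φ ψ h1 h2 => intro s; rw [toF, Formula.realize_inf, h1, h2]; rfl
  | or φ ψ h1 h2 => intro s; rw [toF, Formula.realize_sup, h1, h2]; rfl
  | gdisj φ ψ h1 h2 => intro s; rw [toF, Formula.realize_sup, h1, h2]; rfl
  | cneg φ h1 => intro s; rw [toF, Formula.realize_not, h1]; rfl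
  | ex v φ h1 =>
    intro s
    rw [toF, Formula.realize_iExs]
    simp only [Formula.realize_relabel, elim_sepVar, h1, FSat]
    exact ⟨fun ⟨i, h⟩ => ⟨_, h⟩, fun ⟨m, h⟩ => ⟨fun _ => m, h⟩⟩
  | al v φ h1 =>
    intro s
    rw [toF, Formula.realize_not, Formula.realize_iExs]
    simp only [Formula.realize_relabel, elim_sepVar, h1, FSat, Formula.realize_not, not_exists,
      not_not]
    exact ⟨fun h m => h fun _ => m, fun h i => h _⟩

lemma realize_toF {M : Type} (I : Interp S M) (φ : FOF S) (s : ℕ → M) :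
    letI := str I
    (toF φ).Realize s ↔ FSat M I s φ :=
  letI := str I
  realize_toF' I (fun _ _ _ => Iff.rfl) φ s

lemma card_lang_le [h : Countable (Σ n, S n)] : (lang S).card ≤ Cardinal.aleph0 := by
  have : IsEmpty (Σ n, (lang S).Functions n) := ⟨fun x => Empty.elim x.2⟩
  have h2 : Countable (Σ n, (lang S).Relations n) := h
  rw [Language.card, Cardinal.mk_le_aleph0_iff]
  exact inferInstanceAs (Countable ((Σ n, (lang S).Functions n) ⊕ Σ n, (lang S).Relations n))

lemma ls_down [Countable (Σ n, S n)] {M : Type} [Infinite M] (I : Interp S M) (A : Set M)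
    (hA : A.Countable) : ∃ B : Set M, A ⊆ B ∧ B.Countable ∧ B.Infinite ∧
      ∀ (φ : FOF S) (s : ℕ → B),
        FSat B (comap Subtype.val I) s φ ↔ FSat M I (Subtype.val ∘ s) φ := by
  let _ := str I
  obtain ⟨B, hAB, hB⟩ :=
    exists_elementarySubstructure_card_eq (lang S) (M := M) A Cardinal.aleph0.{0}
    le_rfl (by simpa using hA) (by simpa using card_lang_le) (by simp)
  have hB' : Cardinal.mk B = Cardinal.aleph0 := by simpa using hB
  refine ⟨(B : Set M), hAB, ?_, ?_, fun φ s => ?_⟩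
  · exact Cardinal.le_aleph0_iff_set_countable.1 hB'.le
  · exact Set.infinite_coe_iff.1 (Cardinal.infinite_iff.2 hB'.ge)
  · rw [← realize_toF I φ (Subtype.val ∘ s)]
    refine (realize_toF' (M := B) _ (fun n r t => ?_) φ s).symm.trans ?_
    · exact Iff.rfl
    · exact (B.subtype.map_formula (toF φ) s).symm

lemma exists_large [Countable (Σ n, S n)] {M : Type} [Infinite M] (I : Interp S M) :
    ∃ (N : Type) (J : Interp S N), Cardinal.mk N = Cardinal.continuum ∧
      ∀ φ : FOF S, IsSentence φ → (FOTrue N J φ ↔ FOTrue M I φ) := by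
  obtain ⟨B, -, hBc, hBi, hB⟩ := ls_down I ∅ Set.countable_empty
  have : Infinite B := hBi.to_subtype
  let _ := str (comap (Subtype.val : B → M) I)
  obtain ⟨N, ⟨f⟩, hN⟩ := exists_elementaryEmbedding_card_eq_of_ge (lang S) B Cardinal.continuum
    (by simpa using card_lang_le.trans Cardinal.aleph0_le_continuum)
    (by simpa using (Cardinal.le_aleph0_iff_set_countable.2 hBc).trans Cardinal.aleph0_le_continuum)
  let b : B := Classical.arbitrary B
  refine ⟨N, fun n r => {t | Structure.RelMap (L := lang S) r t}, hN, fun φ hφ => ?_⟩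
  rw [FOTrue_iff hφ (f ∘ fun _ => b), FOTrue_iff hφ (Subtype.val ∘ fun _ => b), ← hB]
  refine (realize_toF' (M := N) _ (fun n r t => ?_) φ _).symm.trans ?_
  · exact Iff.rfl
  · rw [← realize_toF]
    exact f.map_formula _ _

lemma los {α : Type} (u : Ultrafilter α) (M : α → Type) [∀ a, Nonempty (M a)]
    (I : ∀ a, Interp S (M a)) : ∃ (N : Type) (J : Interp S N) (π : (∀ a, M a) → N),
      Surjective π ∧ ∀ (φ : FOF S) (x : ℕ → ∀ a, M a),
        FSat N J (fun i => π (x i)) φ ↔ ∀ᶠ a in u, FSat (M a) (I a) (fun i => x i a) φ := by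
  let _ := fun a => str (I a)
  refine ⟨(u : Filter α).Product M, fun n r => {t | Structure.RelMap (L := lang S) r t},
    fun x => (x : (u : Filter α).Product M), Quotient.mk_surjective, fun φ x => ?_⟩
  refine (realize_toF' (M := (u : Filter α).Product M) _ (fun n r t => Iff.rfl) φ _).symm.trans ?_
  refine (Ultraproduct.realize_formula_cast (L := lang S) (toF φ) x).trans ?_
  simp only [realize_toF]

end ModelTheory

/-! ### Equality patterns relative to a set of interchangeable elements -/

/-- `t` and `t'` have the same equality type and differ only inside `Q`. -/
def Pat {M : Type} {n : ℕ} (Q : Set M) (t t' : Fin n → M) : Prop :=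
  (∀ i, t i = t' i ∨ (t i ∈ Q ∧ t' i ∈ Q)) ∧ ∀ i j, t i = t j ↔ t' i = t' j

/-- Invariance of a relation under changes of pattern inside `Q`. -/
def Inv {M : Type} {n : ℕ} (Q : Set M) (Z : Set (Fin n → M)) : Prop :=
  ∀ t t', Pat Q t t' → t ∈ Z → t' ∈ Z

/-- The closure of `R` under changes of pattern inside `Q`. -/
def smear {M : Type} {n : ℕ} (Q : Set M) (R : Set (Fin n → M)) : Set (Fin n → M) :=
  {t' | ∃ t ∈ R, Pat Q t t'}

lemma Pat.refl {M : Type} {n : ℕ} (Q : Set M) (t : Fin n → M) : Pat Q t t :=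
  ⟨fun _ => Or.inl rfl, fun _ _ => Iff.rfl⟩

lemma Pat.symm {M : Type} {n : ℕ} {Q : Set M} {t t' : Fin n → M} (h : Pat Q t t') :
    Pat Q t' t :=
  ⟨fun i => (h.1 i).imp Eq.symm And.symm, fun i j => (h.2 i j).symm⟩

lemma Pat.trans {M : Type} {n : ℕ} {Q : Set M} {t t' t'' : Fin n → M} (h : Pat Q t t')
    (h' : Pat Q t' t'') : Pat Q t t'' := by
  refine ⟨fun i => ?_, fun i j => (h.2 i j).trans (h'.2 i j)⟩
  rcases h.1 i with h1 | h1 <;> rcases h'.1 i with h2 | h2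
  · exact Or.inl (h1.trans h2)
  · exact Or.inr ⟨h1 ▸ h2.1, h2.2⟩
  · exact Or.inr ⟨h1.1, h2 ▸ h1.2⟩
  · exact Or.inr ⟨h1.1, h2.2⟩

lemma Pat.mono {M : Type} {n : ℕ} {Q Q' : Set M} (hQ : Q ⊆ Q') {t t' : Fin n → M}
    (h : Pat Q t t') : Pat Q' t t' :=
  ⟨fun i => (h.1 i).imp id fun h => ⟨hQ h.1, hQ h.2⟩, h.2⟩

lemma Inv.mono {M : Type} {n : ℕ} {Q Q' : Set M} (hQ : Q ⊆ Q') {Z : Set (Fin n → M)}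
    (h : Inv Q' Z) : Inv Q Z :=
  fun _ _ ht => h _ _ (ht.mono hQ)

lemma inv_smear {M : Type} {n : ℕ} (Q : Set M) (R : Set (Fin n → M)) : Inv Q (smear Q R) :=
  fun _ _ h ⟨_, hu, hut⟩ => ⟨_, hu, hut.trans h⟩

lemma subset_smear {M : Type} {n : ℕ} (Q : Set M) (R : Set (Fin n → M)) : R ⊆ smear Q R :=
  fun t ht => ⟨t, ht, Pat.refl Q t⟩

open Classical in
lemma pat_swap {M : Type} {n : ℕ} {Q : Set M} {x y : M} (hx : x ∈ Q) (hy : y ∈ Q)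
    (t : Fin n → M) : Pat Q t (Equiv.swap x y ∘ t) := by
  refine ⟨fun i => ?_, fun i j => by simp⟩
  by_cases h1 : t i = x
  · right; simp [h1, hx, hy]
  · by_cases h2 : t i = y
    · right; simp [h2, hx, hy]
    · left; simp [Equiv.swap_apply_of_ne_of_ne h1 h2]

open Classical in
/-- The product of a list of transpositions. -/
noncomputable def swaps {M : Type} (l : List (M × M)) : Equiv.Perm M :=
  (l.map fun p => Equiv.swap p.1 p.2).prod

lemma swaps_cons {M : Type} (p : M × M) (l : List (M × M)) :
    swaps (p :: l) = (by classical exact Equiv.swap p.1 p.2) * swaps l := by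
  simp [swaps]

lemma swaps_append {M : Type} (l l' : List (M × M)) :
    swaps (l ++ l') = swaps l * swaps l' := by
  simp [swaps]

lemma pat_swaps {M : Type} {n : ℕ} {Q : Set M} (l : List (M × M))
    (hl : ∀ p ∈ l, p.1 ∈ Q ∧ p.2 ∈ Q) (t : Fin n → M) : Pat Q t (swaps l ∘ t) := by
  classical
  induction l with
  | nil => simpa [swaps] using Pat.refl Q t
  | cons p l ih =>
    have h1 := ih fun q hq => hl q (List.mem_cons_of_mem _ hq)
    have h2 := hl p List.mem_cons_self
    refine h1.trans ?_
    rw [swaps_cons]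
    exact pat_swap h2.1 h2.2 (swaps l ∘ t)

lemma swaps_apply_of_notMem {M : Type} {Q : Set M} (l : List (M × M))
    (hl : ∀ p ∈ l, p.1 ∈ Q ∧ p.2 ∈ Q) {x : M} (hx : x ∉ Q) : swaps l x = x := by
  rcases (pat_swaps (n := 1) l hl fun _ => x).1 0 with h | h
  · exact h.symm
  · exact absurd h.1 hx

open Classical in
lemma Pat.exists_swaps {M : Type} {n : ℕ} {Q : Set M} {t t' : Fin n → M} (h : Pat Q t t') :
    ∃ l : List (M × M), (∀ p ∈ l, p.1 ∈ Q ∧ p.2 ∈ Q) ∧ swaps l ∘ t = t' := by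
  have key : ∀ m : ℕ, ∃ l : List (M × M), (∀ p ∈ l, p.1 ∈ Q ∧ p.2 ∈ Q) ∧
      ∀ i : Fin n, i.val < m → swaps l (t i) = t' i := by
    intro m
    induction m with
    | zero => exact ⟨[], by simp, by simp⟩
    | succ m ih =>
      obtain ⟨l, hl, hm⟩ := ih
      by_cases hmn : m < n
      swap
      · exact ⟨l, hl, fun i _ => hm i (by omega)⟩
      have hP : Pat Q (swaps l ∘ t) t' := (pat_swaps l hl t).symm.trans h
      set u := swaps l ∘ t with hu
      rcases hP.1 ⟨m, hmn⟩ with he | ⟨h1, h2⟩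
      · refine ⟨l, hl, fun i hi => ?_⟩
        rcases Nat.lt_succ_iff_lt_or_eq.1 hi with hi | hi
        · exact hm i hi
        · have : i = ⟨m, hmn⟩ := Fin.ext hi
          rw [this]; exact he
      · refine ⟨(u ⟨m, hmn⟩, t' ⟨m, hmn⟩) :: l, ?_, fun i hi => ?_⟩
        · intro p hp
          rcases List.mem_cons.1 hp with rfl | hp
          · exact ⟨h1, h2⟩
          · exact hl p hp
        · have e1 : swaps ((u ⟨m, hmn⟩, t' ⟨m, hmn⟩) :: l) (t i) =
              Equiv.swap (u ⟨m, hmn⟩) (t' ⟨m, hmn⟩) (u i) := by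
            rw [swaps_cons]; rfl
          rw [e1]
          rcases Nat.lt_succ_iff_lt_or_eq.1 hi with hi | hi
          · have e2 : u i = t' i := hm i hi
            have := hP.2 i ⟨m, hmn⟩
            by_cases e3 : u i = u ⟨m, hmn⟩
            · rw [e3, Equiv.swap_apply_left]; exact (this.1 e3).symm
            · rw [Equiv.swap_apply_of_ne_of_ne e3, e2]
              exact fun e4 => e3 (this.2 (e2 ▸ e4))
          · have : i = ⟨m, hmn⟩ := Fin.ext hi
            rw [this, Equiv.swap_apply_left]
  obtain ⟨l, hl, h⟩ := key n
  exact ⟨l, hl, funext fun i => h i i.2⟩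

/-! ### Transfer along injections and invariance of definable relations -/

open Classical in
lemma FSat_injection {M N : Type} {e : M → N} (he : Injective e) {Q : Set N}
    (hQ : (Set.range e)ᶜ ⊆ Q) (I : Interp S N) (hI : ∀ n r, Inv Q (I n r)) {V : Finset ℕ}
    (hV : ∀ s : ℕ → N, ∃ m : M, e m ∈ Q ∧ ∀ i ∈ V, s i ≠ e m) (φ : TS S ι ar)
    (hφ : avars φ ⊆ V) :
    ∀ s : ℕ → M, FSat M (comap e I) s φ ↔ FSat N I (e ∘ s) φ := by
  have upd : ∀ (s : ℕ → M) v m, e ∘ update s v m = update (e ∘ s) v (e m) :=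
    fun s v m => comp_update _ _ _ _
  have move : ∀ (φ : TS S ι ar) v, insert v (avars φ) ⊆ V → ∀ (s : ℕ → M) m, ∃ m' : M,
      (FSat N I (update (e ∘ s) v m) φ ↔ FSat N I (update (e ∘ s) v (e m')) φ) := by
    intro φ v hV' s m
    by_cases hm : m ∈ Set.range e
    · obtain ⟨m', rfl⟩ := hm
      exact ⟨m', Iff.rfl⟩
    · obtain ⟨m', h1, h2⟩ := hV (update (e ∘ s) v m)
      refine ⟨m', ?_⟩
      have hc : comap (Equiv.swap m (e m')) I = I := by
        funext n r
        ext t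
        have hp := pat_swap (hQ hm) h1 t
        exact ⟨hI n r _ _ hp.symm, hI n r _ _ hp⟩
      have := FSat_equiv (Equiv.swap m (e m')) I φ (update (e ∘ s) v m)
      rw [hc] at this
      refine this.trans (FSat_congr I φ fun w hw => ?_)
      have hw' : w ∈ avars φ := fv_subset_avars φ hw
      by_cases hwv : w = v
      · subst hwv; simp
      · have h3 := h2 w (hV' (Finset.mem_insert_of_mem hw'))
        simp only [comp_apply, update_of_ne hwv] at h3 ⊢
        exact Equiv.swap_apply_of_ne_of_ne (fun h => hm ⟨_, h⟩) h3
  induction φ with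
  | rel r v => intro s; rfl
  | nrel r v => intro s; rfl
  | dep i v => intros; simp only [FSat]
  | eq x y => intro s; simp [FSat, he.eq_iff]
  | neq x y => intro s; simp [FSat, he.eq_iff]
  | and φ ψ h1 h2 =>
    intro s
    simp only [FSat, h1 (Finset.union_subset_left hφ), h2 (Finset.union_subset_right hφ)]
  | or φ ψ h1 h2 =>
    intro s
    simp only [FSat, h1 (Finset.union_subset_left hφ), h2 (Finset.union_subset_right hφ)]
  | gdisj φ ψ h1 h2 =>
    intro s
    simp only [FSat, h1 (Finset.union_subset_left hφ), h2 (Finset.union_subset_right hφ)]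
  | cneg φ h1 => intro s; simp only [FSat, h1 hφ]
  | ex v φ h1 =>
    intro s
    simp only [FSat, h1 ((Finset.subset_insert _ _).trans hφ), upd]
    refine ⟨fun ⟨m, h⟩ => ⟨_, h⟩, fun ⟨m, h⟩ => ?_⟩
    obtain ⟨m', h'⟩ := move φ v hφ s m
    exact ⟨m', h'.1 h⟩
  | al v φ h1 =>
    intro s
    simp only [FSat, h1 ((Finset.subset_insert _ _).trans hφ), upd]
    refine ⟨fun h m => ?_, fun h m => h _⟩
    obtain ⟨m', h'⟩ := move φ v hφ s m
    exact h'.2 (h m')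

lemma exists_fresh_of_infinite {M N : Type} {e : M → N} {Q : Set N}
    (h : (Q ∩ Set.range e).Infinite) (V : Finset ℕ) (s : ℕ → N) :
    ∃ m : M, e m ∈ Q ∧ ∀ i ∈ V, s i ≠ e m := by
  classical
  obtain ⟨q, ⟨hq, m, rfl⟩, hV⟩ := h.exists_notMem_finset (V.image s)
  exact ⟨m, hq, fun i hi h => hV (Finset.mem_image.2 ⟨i, hi, h⟩)⟩

lemma exists_fresh_of_card {M N : Type} {e : M → N} (he : Injective e) {Q : Set N} {n : ℕ}
    (f : Fin n → M) (hf : Injective f) (hfQ : ∀ i, e (f i) ∈ Q) {V : Finset ℕ} (hV : V.card < n)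
    (s : ℕ → N) : ∃ m : M, e m ∈ Q ∧ ∀ i ∈ V, s i ≠ e m := by
  classical
  have hc : (V.image s).card < (Finset.univ.image fun i => e (f i)).card := by
    rw [Finset.card_image_of_injective Finset.univ (f := fun i => e (f i)) (he.comp hf),
      Finset.card_univ, Fintype.card_fin]
    exact Finset.card_image_le.trans_lt hV
  obtain ⟨q, hq, hq'⟩ := Finset.exists_mem_notMem_of_card_lt_card hc
  obtain ⟨i, -, rfl⟩ := Finset.mem_image.1 hq
  exact ⟨f i, hfQ i, fun j hj h => hq' (Finset.mem_image.2 ⟨j, hj, h⟩)⟩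

lemma FSat_EF_injection {M N : Type} [Infinite M] {e : M → N} (he : Injective e) (φ : EF)
    (s : ℕ → M) : FSat M (eI M) s φ ↔ FSat N (eI N) (e ∘ s) φ := by
  rw [← comap_eI e]
  refine FSat_injection he (Q := Set.univ) (Set.subset_univ _) _ (fun n r => r.elim)
    (exists_fresh_of_infinite ?_ _) φ subset_rfl s
  simpa using Set.infinite_range_of_injective he

lemma FSat_EF_equiv {M N : Type} (e : M ≃ N) (φ : EF) (s : ℕ → M) :
    FSat M (eI M) s φ ↔ FSat N (eI N) (e ∘ s) φ := by
  rw [← comap_eI e]; exact FSat_equiv e _ φ s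

lemma comp_overrideFin {M N : Type} {k : ℕ} (e : M → N) (f : Fin k → M) (s : ℕ → M) :
    e ∘ overrideFin k f s = overrideFin k (e ∘ f) (e ∘ s) := by
  funext v
  simp only [comp_apply, overrideFin]
  split_ifs <;> rfl

/-- The relation defined by an equality formula with parameters. -/
def Def {M : Type} (k : ℕ) (θ : EF) (s : ℕ → M) : Set (Fin k → M) :=
  {f | FSat M (eI M) (overrideFin k f s) θ}

lemma exAllSem_iff {M : Type} {k : ℕ} {R : Set (Fin k → M)} {θ : EF} :
    ExAllSem M R θ ↔ ∃ s, R ⊆ Def k θ s := Iff.rfl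

lemma mem_Def_equiv {M N : Type} {k : ℕ} (e : M ≃ N) (θ : EF) (s : ℕ → M) (f : Fin k → M) :
    e ∘ f ∈ Def k θ (e ∘ s) ↔ f ∈ Def k θ s := by
  change FSat N (eI N) _ θ ↔ _
  rw [← comp_overrideFin]
  exact (FSat_EF_equiv e θ _).symm

lemma mem_Def_injection {M N : Type} [Infinite M] {k : ℕ} {e : M → N} (he : Injective e) (θ : EF)
    (s : ℕ → M) (f : Fin k → M) : e ∘ f ∈ Def k θ (e ∘ s) ↔ f ∈ Def k θ s := by
  change FSat N (eI N) _ θ ↔ _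
  rw [← comp_overrideFin]
  exact (FSat_EF_injection he θ _).symm

lemma inv_Def {M : Type} {k : ℕ} {Q : Set M} {θ : EF} {s : ℕ → M}
    (h : ∀ i ∈ avars θ, s i ∉ Q) : Inv Q (Def k θ s) := by
  intro t t' ht hm
  obtain ⟨l, hl, rfl⟩ := ht.exists_swaps
  have := (FSat_EF_equiv (swaps l) θ (overrideFin k t s)).1 hm
  rw [comp_overrideFin] at this
  refine (FSat_congr _ θ fun v hv => ?_).1 this
  by_cases hvk : v < k
  · simp [overrideFin, hvk]
  · simp only [overrideFin, hvk, dite_false, comp_apply]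
    exact swaps_apply_of_notMem l hl (h v (fv_subset_avars θ hv))

/-! ### Finite conjunctions and disjunctions, equality types -/

/-- Conjunction of a list of formulas. -/
def bigAnd (l : List (TS S ι ar)) : TS S ι ar := l.foldr TS.and TS.top

/-- The always-false literal. -/
def botF : TS S ι ar := .neq 0 0

/-- Disjunction of a list of formulas. -/
def bigOr (l : List (TS S ι ar)) : TS S ι ar := l.foldr TS.or botF

lemma FSat_bigAnd {M : Type} {I : Interp S M} {s : ℕ → M} (l : List (TS S ι ar)) :
    FSat M I s (bigAnd l) ↔ ∀ φ ∈ l, FSat M I s φ := by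
  induction l with
  | nil => simp [bigAnd, TS.top, FSat]
  | cons a l ih => simpa [bigAnd, FSat] using fun _ => ih

lemma FSat_bigOr {M : Type} {I : Interp S M} {s : ℕ → M} (l : List (TS S ι ar)) :
    FSat M I s (bigOr l) ↔ ∃ φ ∈ l, FSat M I s φ := by
  induction l with
  | nil => simp [bigOr, botF, FSat]
  | cons a l ih => simpa [bigOr, FSat] using or_congr Iff.rfl ih

open Classical in
lemma exists_eqType_formula (n : ℕ) (E : Set (Fin n → Fin n → Prop)) :
    ∃ θ : EF, ∀ (M : Type) (s : ℕ → M),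
      FSat M (eI M) s θ ↔ (fun i j : Fin n => s i = s j) ∈ E := by
  refine ⟨bigOr ((Set.toFinite E).toFinset.toList.map fun p =>
    bigAnd ((Finset.univ : Finset (Fin n × Fin n)).toList.map fun q =>
      if p q.1 q.2 then .eq q.1 q.2 else .neq q.1 q.2)), fun M s => ?_⟩
  have h : ∀ p : Fin n → Fin n → Prop, FSat M (eI M) s
      (bigAnd (ι := Empty) (ar := noAtoms)
        ((Finset.univ : Finset (Fin n × Fin n)).toList.map fun q =>
          if p q.1 q.2 then .eq q.1 q.2 else .neq q.1 q.2)) ↔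
      (fun i j : Fin n => s i = s j) = p := by
    intro p
    rw [FSat_bigAnd]
    simp only [List.mem_map, Finset.mem_toList, Finset.mem_univ, true_and, Prod.exists,
      forall_exists_index]
    constructor
    · intro h
      funext i j
      have := h _ i j rfl
      by_cases hp : p i j <;> simp_all [FSat]
    · rintro rfl _ i j rfl
      by_cases hp : s i = s j <;> simp [hp, FSat]
  rw [FSat_bigOr]
  simp only [List.mem_map, exists_exists_and_eq_and, h, Finset.mem_toList,
    Set.Finite.mem_toFinset, exists_eq_right']

/-! ### Quantifier blocks -/

/-- Iterated universal quantification over a list of variables. -/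
def als (l : List ℕ) (φ : TS S ι ar) : TS S ι ar := l.foldr TS.al φ

lemma FSat_exs {M : Type} {I : Interp S M} (l : List ℕ) (φ : TS S ι ar) (s : ℕ → M) :
    FSat M I s (exs l φ) ↔ ∃ s' : ℕ → M, (∀ v ∉ l, s' v = s v) ∧ FSat M I s' φ := by
  induction l generalizing s with
  | nil =>
    refine ⟨fun h => ⟨s, by simp, h⟩, fun ⟨s', h, h'⟩ => ?_⟩
    rwa [(funext fun v => h v (by simp) : s' = s)] at h'
  | cons a l ih =>
    change (∃ m, FSat M I (update s a m) (exs l φ)) ↔ _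
    simp only [ih]
    constructor
    · rintro ⟨m, s', h, h'⟩
      refine ⟨s', fun v hv => ?_, h'⟩
      simp only [List.mem_cons, not_or] at hv
      rw [h v hv.2, update_of_ne hv.1]
    · rintro ⟨s', h, h'⟩
      refine ⟨s' a, s', fun v hv => ?_, h'⟩
      by_cases hva : v = a
      · simp [hva]
      · rw [update_of_ne hva, h v (by simp [hv, hva])]

lemma FSat_als {M : Type} {I : Interp S M} (l : List ℕ) (φ : TS S ι ar) (s : ℕ → M) :
    FSat M I s (als l φ) ↔ ∀ s' : ℕ → M, (∀ v ∉ l, s' v = s v) → FSat M I s' φ := by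
  induction l generalizing s with
  | nil =>
    refine ⟨fun h s' h' => ?_, fun h => h s (by simp)⟩
    rwa [(funext fun v => h' v (by simp) : s' = s)]
  | cons a l ih =>
    change (∀ m, FSat M I (update s a m) (als l φ)) ↔ _
    simp only [ih]
    constructor
    · intro h s' h'
      refine h (s' a) s' fun v hv => ?_
      by_cases hva : v = a
      · simp [hva]
      · rw [update_of_ne hva, h' v (by simp [hv, hva])]
    · intro h m s' h'
      refine h s' fun v hv => ?_
      simp only [List.mem_cons, not_or] at hv
      rw [h' v hv.2, update_of_ne hv.1]

lemma fv_exs (l : List ℕ) (φ : TS S ι ar) : fv (exs l φ) = fv φ \ {v | v ∈ l} := by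
  induction l with
  | nil => simp [exs]
  | cons a l ih =>
    change fv (exs l φ) \ {a} = _
    rw [ih]; ext v; simp; tauto

lemma fv_als (l : List ℕ) (φ : TS S ι ar) : fv (als l φ) = fv φ \ {v | v ∈ l} := by
  induction l with
  | nil => simp [als]
  | cons a l ih =>
    change fv (als l φ) \ {a} = _
    rw [ih]; ext v; simp; tauto

/-! ### Team sentences -/

lemma plain_exs {l : List ℕ} {φ : TS S ι ar} (h : Plain φ) : Plain (exs l φ) := by
  induction l with
  | nil => exact h
  | cons a l ih => exact ih

lemma plain_als {l : List ℕ} {φ : TS S ι ar} (h : Plain φ) : Plain (als l φ) := by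
  induction l with
  | nil => exact h
  | cons a l ih => exact ih

lemma TSat_exs {M : Type} {I : Interp S M} {A : ∀ i, Set (Fin (ar i) → M) → Prop} (l : List ℕ)
    (φ : TS S ι ar) (X : Set (ℕ → M)) : TSat M I A (exs l φ) X ↔
      ∃ Y : Set (ℕ → M), (∀ s ∈ X, ∃ y ∈ Y, ∀ v ∉ l, y v = s v) ∧
        (∀ y ∈ Y, ∃ s ∈ X, ∀ v ∉ l, y v = s v) ∧ TSat M I A φ Y := by
  induction l generalizing X with
  | nil =>
    constructor
    · exact fun h => ⟨X, fun s hs => ⟨s, hs, by simp⟩, fun s hs => ⟨s, hs, by simp⟩, h⟩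
    · rintro ⟨Y, h1, h2, h3⟩
      have : X = Y := by
        ext s
        constructor
        · intro hs
          obtain ⟨y, hy, h⟩ := h1 s hs
          rwa [(funext fun v => h v (by simp) : y = s)] at hy
        · intro hs
          obtain ⟨y, hy, h⟩ := h2 s hs
          rwa [(funext fun v => h v (by simp) : s = y)]
      rwa [this]
  | cons a l ih =>
    change (∃ H : (ℕ → M) → Set M, (∀ s ∈ X, (H s).Nonempty) ∧ TSat M I A (exs l φ)
      {s' | ∃ s ∈ X, ∃ m ∈ H s, s' = update s a m}) ↔ _
    simp only [ih]
    constructor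
    · rintro ⟨H, hH, Y, h1, h2, h3⟩
      refine ⟨Y, fun s hs => ?_, fun y hy => ?_, h3⟩
      · obtain ⟨m, hm⟩ := hH s hs
        obtain ⟨y, hy, hy'⟩ := h1 _ ⟨s, hs, m, hm, rfl⟩
        refine ⟨y, hy, fun v hv => ?_⟩
        simp only [List.mem_cons, not_or] at hv
        rw [hy' v hv.2, update_of_ne hv.1]
      · obtain ⟨_, ⟨s, hs, m, hm, rfl⟩, hy'⟩ := h2 y hy
        refine ⟨s, hs, fun v hv => ?_⟩
        simp only [List.mem_cons, not_or] at hv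
        rw [hy' v hv.2, update_of_ne hv.1]
    · rintro ⟨Y, h1, h2, h3⟩
      refine ⟨fun s => {m | ∃ y ∈ Y, y a = m ∧ ∀ v ∉ a :: l, y v = s v}, ?_, Y, ?_, ?_, h3⟩
      · intro s hs
        obtain ⟨y, hy, h⟩ := h1 s hs
        exact ⟨y a, y, hy, rfl, h⟩
      · rintro _ ⟨s, hs, m, ⟨y, hy, rfl, h⟩, rfl⟩
        refine ⟨y, hy, fun v hv => ?_⟩
        by_cases hva : v = a
        · simp [hva]
        · rw [update_of_ne hva, h v (by simp [hv, hva])]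
      · intro y hy
        obtain ⟨s, hs, h⟩ := h2 y hy
        refine ⟨update s a (y a), ⟨s, hs, _, ⟨y, hy, rfl, h⟩, rfl⟩, fun v hv => ?_⟩
        by_cases hva : v = a
        · simp [hva]
        · rw [update_of_ne hva, h v (by simp [hv, hva])]

lemma TSat_als {M : Type} {I : Interp S M} {A : ∀ i, Set (Fin (ar i) → M) → Prop} (l : List ℕ)
    (φ : TS S ι ar) (X : Set (ℕ → M)) : TSat M I A (als l φ) X ↔
      TSat M I A φ {y : ℕ → M | ∃ s ∈ X, ∀ v ∉ l, y v = s v} := by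
  induction l generalizing X with
  | nil =>
    have : {y : ℕ → M | ∃ s ∈ X, ∀ v ∉ ([] : List ℕ), y v = s v} = X := by
      ext y
      constructor
      · rintro ⟨s, hs, h⟩
        rwa [(funext fun v => h v (by simp) : y = s)]
      · exact fun h => ⟨y, h, by simp⟩
    rw [this]; rfl
  | cons a l ih =>
    change TSat M I A (als l φ) {s' | ∃ s ∈ X, ∃ m : M, s' = update s a m} ↔ _
    rw [ih]
    have : {y : ℕ → M | ∃ s ∈ {s' : ℕ → M | ∃ s ∈ X, ∃ m : M, s' = update s a m},
        ∀ v ∉ l, y v = s v} =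
        {y : ℕ → M | ∃ s ∈ X, ∀ v ∉ a :: l, y v = s v} := by
      ext y
      constructor
      · rintro ⟨_, ⟨s, hs, m, rfl⟩, h⟩
        refine ⟨s, hs, fun v hv => ?_⟩
        simp only [List.mem_cons, not_or] at hv
        rw [h v hv.2, update_of_ne hv.1]
      · rintro ⟨s, hs, h⟩
        refine ⟨update s a (y a), ⟨s, hs, _, rfl⟩, fun v hv => ?_⟩
        by_cases hva : v = a
        · simp [hva]
        · rw [update_of_ne hva, h v (by simp [hv, hva])]
    rw [this]

lemma TSat_als_univ {M : Type} {I : Interp S M} {A : ∀ i, Set (Fin (ar i) → M) → Prop}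
    (l : List ℕ) (φ : TS S ι ar) :
    TSat M I A (als l φ) Set.univ ↔ TSat M I A φ Set.univ := by
  rw [TSat_als]
  have : {y : ℕ → M | ∃ s ∈ (Set.univ : Set (ℕ → M)), ∀ v ∉ l, y v = s v} = Set.univ :=
    Set.eq_univ_of_forall fun y => ⟨y, trivial, fun _ _ => rfl⟩
  rw [this]

/-- The first `k` variables. -/
def vk (k : ℕ) : Fin k → ℕ := fun i => i

lemma overrideFin_vk {M : Type} {k : ℕ} (f : Fin k → M) (s : ℕ → M) :
    (fun i => overrideFin k f s (vk k i)) = f := by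
  funext i; simp [overrideFin, vk]

lemma overrideFin_of_le {M : Type} {k : ℕ} (f : Fin k → M) (s : ℕ → M) {v : ℕ} (h : k ≤ v) :
    overrideFin k f s v = s v := by
  simp [overrideFin, not_lt.2 h]

lemma eq_append {M : Type} {k j : ℕ} (s : ℕ → M) :
    (fun i => s (vk (k + j) i)) = Fin.append (fun i => s (vk k i)) fun i : Fin j => s (k + i) := by
  funext i
  refine Fin.addCases (fun i => ?_) (fun i => ?_) i <;> simp [vk]

/-- Existence of a relation in the dependency, inside `F`, with a point in each section of `B`
and covered by the sections of `B`. -/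
def transversalF {k j : ℕ} (F : S k) (B : S (k + j)) : TS S Unit fun _ => k :=
  als ((List.range j).map (k + ·)) <| exs (List.range k) <|
    .and (.rel B (vk _)) (.and (.rel F (vk _)) (.dep () (vk k)))

lemma transversalF_sat {k j : ℕ} (F : S k) (B : S (k + j)) {M : Type} [Nonempty M]
    (I : Interp S M) (A : Set (Fin k → M) → Prop) :
    TTrue M I (fun _ => A) (transversalF F B) ↔ ∃ T, A T ∧ T ⊆ I k F ∧
      (∀ w : Fin j → M, ∃ x ∈ T, Fin.append x w ∈ I _ B) ∧
      ∀ x ∈ T, ∃ w : Fin j → M, Fin.append x w ∈ I _ B := by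
  obtain ⟨c⟩ := ‹Nonempty M›
  have ext : ∀ w : Fin j → M, ∃ s : ℕ → M, (fun i : Fin j => s (k + i)) = w := fun w =>
    ⟨fun n => if h : n - k < j then w ⟨n - k, h⟩ else c, by funext i; simp⟩
  rw [TTrue, transversalF, TSat_als_univ, TSat_exs]
  constructor
  · rintro ⟨Y, h1, -, h3, h4, h5⟩
    refine ⟨teamProj (vk k) Y, h5, ?_, fun w => ?_, ?_⟩
    · rintro _ ⟨s, hs, rfl⟩
      exact h4 s hs
    · obtain ⟨s, rfl⟩ := ext w
      obtain ⟨y, hy, hys⟩ := h1 s trivial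
      refine ⟨_, ⟨y, hy, rfl⟩, ?_⟩
      have : (fun i : Fin j => s (k + i)) = fun i : Fin j => y (k + i) :=
        funext fun i => (hys _ (by simp)).symm
      rw [this, ← eq_append]
      exact h3 y hy
    · rintro _ ⟨s, hs, rfl⟩
      refine ⟨fun i => s (k + i), ?_⟩
      rw [← eq_append]
      exact h3 s hs
  · rintro ⟨T, h1, h2, h3, h4⟩
    have key : ∀ x ∈ T, ∀ s : ℕ → M, Fin.append x (fun i : Fin j => s (k + i)) ∈ I _ B →
        (fun i => overrideFin k x s (vk k i)) ∈ T ∧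
          (fun i => overrideFin k x s (vk (k + j) i)) ∈ I _ B := by
      intro x hx s h
      rw [eq_append, overrideFin_vk]
      refine ⟨hx, ?_⟩
      convert h using 3 with i
      exact overrideFin_of_le _ _ (by simp)
    refine ⟨{y | (fun i => y (vk k i)) ∈ T ∧ (fun i => y (vk (k + j) i)) ∈ I _ B},
      fun s _ => ?_, fun y _ => ⟨y, trivial, fun _ _ => rfl⟩, fun s hs => hs.2,
      fun s hs => h2 hs.1, ?_⟩
    · obtain ⟨x, hx, h⟩ := h3 fun i => s (k + i)
      exact ⟨overrideFin k x s, key x hx s h, fun v hv =>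
        overrideFin_of_le _ _ (by simpa using hv)⟩
    · change A (teamProj _ _)
      convert h1 using 1
      ext x
      constructor
      · rintro ⟨y, hy, rfl⟩
        exact hy.1
      · intro hx
        obtain ⟨w, hw⟩ := h4 x hx
        obtain ⟨s, rfl⟩ := ext w
        exact ⟨overrideFin k x s, key x hx s hw, (overrideFin_vk x s).symm⟩

/-- The dependency holds of the relation symbol `R`. -/
def holdsF {k : ℕ} (R : S k) : TS S Unit fun _ => k :=
  als (List.range k) <| .or (.nrel R (vk k)) (.and (.rel R (vk k)) (.dep () (vk k)))

lemma or_split_sat {n k : ℕ} (C : S n) {M : Type}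
    (I : Interp S M) (A : Set (Fin k → M) → Prop) (X : Set (ℕ → M)) :
    TSat M I (fun _ => A) (.or (.nrel C (vk n)) (.and (.rel C (vk n)) (.dep () (vk k))) :
      TS S Unit fun _ => k) X ↔
      A (teamProj (vk k) {s | s ∈ X ∧ (fun i => s (vk n i)) ∈ I n C}) := by
  constructor
  · rintro ⟨Y, Z, rfl, h1, h2, h3⟩
    have : {s | s ∈ Y ∪ Z ∧ (fun i => s (vk n i)) ∈ I n C} = Z := by
      ext s
      constructor
      · rintro ⟨h | h, h'⟩
        · exact absurd h' (h1 s h)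
        · exact h
      · exact fun h => ⟨Or.inr h, h2 s h⟩
    rw [this]; exact h3
  · intro h
    refine ⟨{s | s ∈ X ∧ (fun i => s (vk n i)) ∉ I n C},
      {s | s ∈ X ∧ (fun i => s (vk n i)) ∈ I n C}, ?_, fun s hs => hs.2, fun s hs => hs.2, h⟩
    ext s
    constructor
    · rintro (h | h) <;> exact h.1
    · intro hs
      by_cases hC : (fun i => s (vk n i)) ∈ I n C
      · exact Or.inr ⟨hs, hC⟩
      · exact Or.inl ⟨hs, hC⟩

lemma holdsF_sat {k : ℕ} (R : S k) {M : Type} [Nonempty M]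
    (I : Interp S M) (A : Set (Fin k → M) → Prop) :
    TTrue M I (fun _ => A) (holdsF R) ↔ A (I k R) := by
  rw [TTrue, holdsF, TSat_als_univ, or_split_sat]
  have : teamProj (vk k) {s | s ∈ Set.univ ∧ (fun i => s (vk k i)) ∈ I k R} = I k R := by
    ext x
    constructor
    · rintro ⟨s, hs, rfl⟩
      exact hs.2
    · intro hx
      refine ⟨overrideFin k x fun _ => Classical.arbitrary M, ⟨trivial, ?_⟩,
        (overrideFin_vk _ _).symm⟩
      rwa [overrideFin_vk]
  rw [this]

/-- The dependency holds of a nonempty union of sections `C` over elements of `O`. -/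
def unionF {k : ℕ} (O : S 1) (C : S (k + 1)) : TS S Unit fun _ => k :=
  exs [k] <| .and (.rel O fun _ => k) <| als (List.range k) <|
    .or (.nrel C (vk (k + 1))) (.and (.rel C (vk (k + 1))) (.dep () (vk k)))

lemma unionF_sat {k : ℕ} (O : S 1) (C : S (k + 1)) {M : Type} [Nonempty M]
    (I : Interp S M) (A : Set (Fin k → M) → Prop) :
    TTrue M I (fun _ => A) (unionF O C) ↔ ∃ Z : Set M, Z.Nonempty ∧
      (∀ z ∈ Z, (fun _ => z) ∈ I 1 O) ∧
      A {x | ∃ z ∈ Z, Fin.append x (fun _ => z) ∈ I _ C} := by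
  have key : ∀ Y : Set (ℕ → M), TSat M I (fun _ => A) (als (List.range k) <|
      .or (.nrel C (vk (k + 1))) (.and (.rel C (vk (k + 1))) (.dep () (vk k))) :
        TS S Unit fun _ => k) Y ↔
      A {x | ∃ z ∈ {m | ∃ y ∈ Y, y k = m}, Fin.append x (fun _ => z) ∈ I _ C} := by
    intro Y
    rw [TSat_als, or_split_sat]
    have : teamProj (vk k) {s | s ∈ {y : ℕ → M | ∃ s ∈ Y, ∀ v ∉ List.range k, y v = s v} ∧
        (fun i => s (vk (k + 1) i)) ∈ I (k + 1) C} =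
        {x | ∃ z ∈ {m | ∃ y ∈ Y, y k = m}, Fin.append x (fun _ => z) ∈ I _ C} := by
      ext x
      constructor
      · rintro ⟨s, ⟨⟨y, hy, hys⟩, hs⟩, rfl⟩
        refine ⟨s k, ⟨y, hy, (hys k (by simp)).symm⟩, ?_⟩
        rw [eq_append] at hs
        convert hs using 3 with i
        simp
      · rintro ⟨_, ⟨y, hy, rfl⟩, hx⟩
        refine ⟨overrideFin k x y, ⟨⟨y, hy, fun v hv => overrideFin_of_le _ _ (by simpa using hv)⟩,
          ?_⟩, (overrideFin_vk x y).symm⟩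
        rw [eq_append, overrideFin_vk]
        convert hx using 3 with i
        simp [overrideFin]
    rw [this]
  rw [TTrue, unionF, TSat_exs]
  constructor
  · rintro ⟨Y, h1, -, h2, h3⟩
    refine ⟨_, ?_, ?_, (key Y).1 h3⟩
    · obtain ⟨y, hy, -⟩ := h1 (fun _ => Classical.arbitrary M) trivial
      exact ⟨_, y, hy, rfl⟩
    · rintro _ ⟨y, hy, rfl⟩
      exact h2 y hy
  · rintro ⟨Z, ⟨z, hz⟩, h1, h2⟩
    refine ⟨{y | y k ∈ Z}, fun s _ => ⟨update s k z, by simpa using hz, fun v hv => ?_⟩,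
      fun y _ => ⟨y, trivial, fun _ _ => rfl⟩, fun y hy => h1 _ hy, ?_⟩
    · rw [update_of_ne (by simpa using hv)]
    · rw [key]
      have : {m | ∃ y ∈ {y : ℕ → M | y k ∈ Z}, y k = m} = Z := by
        ext m
        constructor
        · rintro ⟨y, hy, rfl⟩
          exact hy
        · exact fun h => ⟨fun _ => m, h, rfl⟩
      rw [this]
      exact h2

lemma transversalF_fo {k j : ℕ} {D : DepPred k} (hD : SFOd D) (F : S k) (B : S (k + j)) :
    ∃ ψ : FOF S, IsSentence ψ ∧ ∀ (M : Type), Nontrivial M → ∀ I : Interp S M,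
      (FOTrue M I ψ ↔ ∃ T, D M T ∧ T ⊆ I k F ∧
        (∀ w : Fin j → M, ∃ x ∈ T, Fin.append x w ∈ I _ B) ∧
        ∀ x ∈ T, ∃ w : Fin j → M, Fin.append x w ∈ I _ B) := by
  have hs : IsSentence (transversalF F B) := by
    rw [IsSentence, transversalF, fv_als, fv_exs]
    ext v
    simp only [fv, vk, Set.mem_sdiff, Set.mem_union, Set.mem_range, Set.mem_ofPred_eq,
      List.mem_range, List.mem_map, Set.mem_empty_iff_false, iff_false, not_and, not_not]
    rintro ⟨h, h'⟩
    refine ⟨v - k, ?_, by omega⟩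
    rcases h with ⟨i, rfl⟩ | ⟨i, rfl⟩ | ⟨i, rfl⟩ <;> omega
  have hp : Plain (transversalF F B) := by
    exact plain_als (plain_exs ⟨by simp [NoCneg], by simp [NoGdisj]⟩)
  obtain ⟨ψ, h1, h2⟩ := hD S (transversalF F B) hs hp
  exact ⟨ψ, h1, fun M _ I => (h2 M ‹_› I).symm.trans (transversalF_sat F B I (D M))⟩

lemma holdsF_fo {k : ℕ} {D : DepPred k} (hD : SFOd D) (R : S k) :
    ∃ ψ : FOF S, IsSentence ψ ∧ ∀ (M : Type), Nontrivial M → ∀ I : Interp S M,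
      (FOTrue M I ψ ↔ D M (I k R)) := by
  have hs : IsSentence (holdsF R) := by
    rw [IsSentence, holdsF, fv_als]
    ext v
    simp only [fv, vk, Set.mem_sdiff, Set.mem_union, Set.mem_range, Set.mem_ofPred_eq,
      List.mem_range, Set.mem_empty_iff_false, iff_false, not_and, not_not]
    rintro (⟨i, rfl⟩ | ⟨i, rfl⟩ | ⟨i, rfl⟩) <;> omega
  have hp : Plain (holdsF R) := by
    exact plain_als ⟨by simp [NoCneg], by simp [NoGdisj]⟩
  obtain ⟨ψ, h1, h2⟩ := hD S (holdsF R) hs hp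
  exact ⟨ψ, h1, fun M _ I => (h2 M ‹_› I).symm.trans (holdsF_sat R I (D M))⟩

lemma unionF_fo {k : ℕ} {D : DepPred k} (hD : SFOd D) (O : S 1) (C : S (k + 1)) :
    ∃ ψ : FOF S, IsSentence ψ ∧ ∀ (M : Type), Nontrivial M → ∀ I : Interp S M,
      (FOTrue M I ψ ↔ ∃ Z : Set M, Z.Nonempty ∧ (∀ z ∈ Z, (fun _ => z) ∈ I 1 O) ∧
        D M {x | ∃ z ∈ Z, Fin.append x (fun _ => z) ∈ I _ C}) := by
  have hs : IsSentence (unionF O C) := by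
    rw [IsSentence, unionF, fv_exs]
    simp only [fv, fv_als]
    ext v
    simp only [vk, Set.mem_sdiff, Set.mem_union, Set.mem_range, Set.mem_ofPred_eq,
      List.mem_range, Set.mem_empty_iff_false, iff_false, not_and, not_not, List.mem_singleton]
    rintro (⟨i, rfl⟩ | ⟨⟨i, rfl⟩ | ⟨i, rfl⟩ | ⟨i, rfl⟩, h⟩) <;> omega
  have hp : Plain (unionF O C) := by
    have : Plain (als (List.range k) <|
      .or (.nrel C (vk (k + 1))) (.and (.rel C (vk (k + 1))) (.dep () (vk k))) :
        TS S Unit fun _ => k) := plain_als ⟨by simp [NoCneg], by simp [NoGdisj]⟩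
    exact plain_exs ⟨⟨trivial, this.1⟩, trivial, this.2⟩
  obtain ⟨ψ, h1, h2⟩ := hD S (unionF O C) hs hp
  exact ⟨ψ, h1, fun M _ I => (h2 M ‹_› I).symm.trans (unionF_sat O C I (D M))⟩

/-! ### Signatures with symbols indexed by a type -/

/-- The signature with symbols `j : J` of arity `ar j`. -/
def Gsig {J : Type} (ar : J → ℕ) : Signature := fun n => {j // ar j = n}

/-- The interpretation given by a family of relations. -/
def gI {J : Type} {ar : J → ℕ} {M : Type} (P : ∀ j, Set (Fin (ar j) → M)) :
    Interp (Gsig ar) M :=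
  fun _ r => {t | (fun i => t (Fin.cast r.2 i)) ∈ P r.1}

/-- The symbol `j`. -/
def sym {J : Type} (ar : J → ℕ) (j : J) : Gsig ar (ar j) := ⟨j, rfl⟩

@[simp] lemma gI_sym {J : Type} {ar : J → ℕ} {M : Type} (P : ∀ j, Set (Fin (ar j) → M)) (j : J) :
    gI P (ar j) (sym ar j) = P j := rfl

instance {J : Type} [Countable J] (ar : J → ℕ) : Countable (Σ n, Gsig ar n) :=
  (Equiv.sigmaFiberEquiv ar).countable_iff.2 inferInstance

lemma comap_gI {J : Type} {ar : J → ℕ} {M N : Type} (P : ∀ j, Set (Fin (ar j) → N)) (e : M → N) :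
    comap e (gI P) = gI fun j => {t | e ∘ t ∈ P j} := rfl

lemma inv_gI {J : Type} {ar : J → ℕ} {M : Type} {Q : Set M} {P : ∀ j, Set (Fin (ar j) → M)}
    (h : ∀ j, Inv Q (P j)) : ∀ n r, Inv Q (gI P n r) := by
  rintro n ⟨j, rfl⟩
  exact h j

/-! ### Absorbing pattern changes -/

/-- The permutation of `A` given by a list of transpositions of elements of the sequence `ν`. -/
noncomputable def permOf {A : Type} (ν : ℕ → A) (l : List (ℕ × ℕ)) : Equiv.Perm A :=
  swaps (l.map (Prod.map ν ν))

lemma permOf_append {A : Type} (ν : ℕ → A) (l l' : List (ℕ × ℕ)) :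
    permOf ν (l ++ l') = permOf ν l * permOf ν l' := by
  simp [permOf, swaps_append]

lemma permOf_fix {A : Type} {ν : ℕ → A} {l : List (ℕ × ℕ)} {a : Finset ℕ}
    (hl : ∀ p ∈ l, p.1 ∉ a ∧ p.2 ∉ a) {y : A} (hy : ∀ j, y = ν j → j ∈ a) :
    permOf ν l y = y := by
  refine swaps_apply_of_notMem (Q := {x | ∃ j ∉ a, x = ν j}) _ ?_ ?_
  · intro p hp
    obtain ⟨q, hq, rfl⟩ := List.mem_map.1 hp
    exact ⟨⟨_, (hl q hq).1, rfl⟩, ⟨_, (hl q hq).2, rfl⟩⟩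
  · rintro ⟨j, hj, rfl⟩
    exact hj (hy j rfl)

lemma pat_permOf {A : Type} {n : ℕ} (ν : ℕ → A) (l : List (ℕ × ℕ)) (t : Fin n → A) :
    Pat (Set.range ν) t (permOf ν l ∘ t) := by
  refine pat_swaps _ ?_ t
  intro p hp
  obtain ⟨q, hq, rfl⟩ := List.mem_map.1 hp
  exact ⟨⟨_, rfl⟩, ⟨_, rfl⟩⟩

lemma map_permOf {A B : Type} {f : A → B} (hf : Injective f) (ν : ℕ → A) (l : List (ℕ × ℕ))
    (y : A) : f (permOf ν l y) = permOf (f ∘ ν) l (f y) := by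
  classical
  induction l with
  | nil => simp [permOf, swaps]
  | cons p l ih =>
    simp only [permOf, List.map_cons, swaps_cons] at ih ⊢
    rw [Equiv.Perm.mul_apply, Equiv.Perm.mul_apply, ← ih]
    exact hf.map_swap _ _ _

lemma Pat.exists_permOf {A : Type} {n : ℕ} {ν : ℕ → A} {a : Finset ℕ} {t t' : Fin n → A}
    (h : Pat {x | ∃ j ∉ a, x = ν j} t t') :
    ∃ l : List (ℕ × ℕ), (∀ p ∈ l, p.1 ∉ a ∧ p.2 ∉ a) ∧ permOf ν l ∘ t = t' := by
  obtain ⟨l, hl, rfl⟩ := h.exists_swaps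
  have : ∃ l' : List (ℕ × ℕ), (∀ p ∈ l', p.1 ∉ a ∧ p.2 ∉ a) ∧ l'.map (Prod.map ν ν) = l := by
    clear h
    induction l with
    | nil => exact ⟨[], by simp, rfl⟩
    | cons p l ih =>
      obtain ⟨l', h1, h2⟩ := ih fun q hq => hl q (List.mem_cons_of_mem _ hq)
      obtain ⟨⟨i, hi, hi'⟩, j, hj, hj'⟩ := hl p List.mem_cons_self
      refine ⟨(i, j) :: l', ?_, ?_⟩
      · intro q hq
        rcases List.mem_cons.1 hq with rfl | hq
        · exact ⟨hi, hj⟩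
        · exact h1 q hq
      · simp only [List.map_cons, h2, Prod.map, ← hi', ← hj']
  obtain ⟨l', h1, h2⟩ := this
  exact ⟨l', h1, by rw [permOf, h2]⟩

/-- Construction of a permutation of a countable set as a limit of finite products of
transpositions, meeting a requirement for each element. -/
lemma exists_perm_limit {A : Type} [Countable A] [Nonempty A] {k : ℕ} {ν : ℕ → A}
    (hν : Injective ν) (Good : A → (Fin k → A) → (Fin k → A) → Prop)
    (hstep : ∀ (a : Finset ℕ) (l : List (ℕ × ℕ)) (w : A), ∃ (t : Fin k → A) (l' : List (ℕ × ℕ)),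
      (∀ p ∈ l', p.1 ∉ a ∧ p.2 ∉ a) ∧ Good w t (permOf ν (l ++ l') ∘ t)) :
    ∃ π : Equiv.Perm A, (∀ t : Fin k → A, ∃ l, π ∘ t = permOf ν l ∘ t) ∧
      ∀ w, ∃ t, Good w t (π ∘ t) := by
  classical
  let ext : Finset ℕ × List (ℕ × ℕ) → Finset ℕ × List (ℕ × ℕ) → Prop := fun q q' =>
    q.1 ⊆ q'.1 ∧ ∃ l', q'.2 = q.2 ++ l' ∧ ∀ p ∈ l', p.1 ∉ q.1 ∧ p.2 ∉ q.1
  let fixed : Finset ℕ × List (ℕ × ℕ) → A → Prop := fun q y => ∀ j, y = ν j → j ∈ q.1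
  have fin : ∀ s : Finset A, ∃ b : Finset ℕ, ∀ y ∈ s, ∀ j, y = ν j → j ∈ b := fun s =>
    ⟨s.preimage ν hν.injOn, fun y hy j hj => by simpa [← hj] using hy⟩
  have step : ∀ q (w : A), ∃ q', ext q q' ∧ (∃ t, Good w t (permOf ν q'.2 ∘ t) ∧
      ∀ i, fixed q' (t i)) ∧ fixed q' w ∧ fixed q' ((permOf ν q'.2)⁻¹ w) := by
    rintro ⟨a, l⟩ w
    obtain ⟨t, l', h1, h2⟩ := hstep a l w
    obtain ⟨b, hb⟩ := fin (Finset.univ.image t ∪ {w, (permOf ν (l ++ l'))⁻¹ w})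
    refine ⟨(a ∪ b, l ++ l'), ⟨Finset.subset_union_left, l', rfl, h1⟩, ⟨t, h2, ?_⟩, ?_, ?_⟩
    · exact fun i j hj => Finset.mem_union_right _ (hb _ (by simp) j hj)
    · exact fun j hj => Finset.mem_union_right _ (hb _ (by simp) j hj)
    · exact fun j hj => Finset.mem_union_right _ (hb _ (by simp) j hj)
  choose nxt hnxt using step
  obtain ⟨x, hx⟩ := exists_surjective_nat A
  let q : ℕ → Finset ℕ × List (ℕ × ℕ) := fun n => Nat.rec (∅, []) (fun n q => nxt q (x n)) n
  have hq : ∀ n, q (n + 1) = nxt (q n) (x n) := fun n => rfl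
  have hext : ∀ n m, n ≤ m → ext (q n) (q m) := by
    intro n m hnm
    induction m, hnm using Nat.le_induction with
    | base => exact ⟨subset_rfl, [], by simp, by simp⟩
    | succ m hm ih =>
      obtain ⟨h1, l1, h2, h3⟩ := ih
      obtain ⟨h4, l2, h5, h6⟩ := (hnxt (q m) (x m)).1
      refine ⟨h1.trans h4, l1 ++ l2, ?_, ?_⟩
      · rw [hq, h5, h2, List.append_assoc]
      · intro p hp
        rcases List.mem_append.1 hp with hp | hp
        · exact h3 p hp
        · exact ⟨fun h => (h6 p hp).1 (h1 h), fun h => (h6 p hp).2 (h1 h)⟩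
  have hfix : ∀ n m, n ≤ m → ∀ y, fixed (q n) y → permOf ν (q m).2 y = permOf ν (q n).2 y := by
    intro n m hnm y hy
    obtain ⟨-, l', h1, h2⟩ := hext n m hnm
    rw [h1, permOf_append, Equiv.Perm.mul_apply, permOf_fix h2 hy]
  have hev : ∀ y, ∃ n, fixed (q n) y := by
    intro y
    obtain ⟨n, rfl⟩ := hx y
    exact ⟨n + 1, (hnxt (q n) (x n)).2.2.1⟩
  choose N hN using hev
  let f : A → A := fun y => permOf ν (q (N y)).2 y
  have hf : ∀ n y, fixed (q n) y → f y = permOf ν (q n).2 y := by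
    intro n y hy
    rw [← hfix n (max n (N y)) (le_max_left _ _) y hy,
      hfix (N y) (max n (N y)) (le_max_right _ _) y (hN y)]
  have hlarge : ∀ n y, N y ≤ n → f y = permOf ν (q n).2 y :=
    fun n y hn => (hfix _ _ hn y (hN y)).symm
  have hbij : Bijective f := by
    constructor
    · intro y z h
      rw [hlarge (max (N y) (N z)) y (le_max_left _ _),
        hlarge (max (N y) (N z)) z (le_max_right _ _)] at h
      exact (permOf ν _).injective h
    · intro y
      obtain ⟨n, rfl⟩ := hx y
      refine ⟨(permOf ν (q (n + 1)).2)⁻¹ (x n), ?_⟩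
      rw [hf (n + 1) _ (hnxt (q n) (x n)).2.2.2]
      exact Equiv.apply_symm_apply _ _
  refine ⟨Equiv.ofBijective f hbij, fun t => ?_, fun w => ?_⟩
  · refine ⟨(q (Finset.univ.sup fun i => N (t i))).2, funext fun i => ?_⟩
    exact hlarge _ _ (Finset.le_sup (f := fun i => N (t i)) (Finset.mem_univ i))
  · obtain ⟨n, rfl⟩ := hx w
    obtain ⟨t, h1, h2⟩ := (hnxt (q n) (x n)).2.1
    refine ⟨t, ?_⟩
    have : ⇑(Equiv.ofBijective f hbij) ∘ t = permOf ν (nxt (q n) (x n)).2 ∘ t :=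
      funext fun i => hf (n + 1) _ (h2 i)
    rwa [this]

lemma smear_absorb {k : ℕ} {D : DepPred k} (hiso : IsoClosed D) (hD : SFOd D) {M : Type}
    [Infinite M] {e : M → ℕ → Fin k → M} (he : Surjective e) {ν : ℕ → M} (hν : Injective ν)
    {R F : Set (Fin k → M)} (hR : D M R) (hRF : R ⊆ F) (hF : Inv (Set.range ν) F) :
    ∃ b : Set M, b.Finite ∧ ∃ T, D M T ∧ smear (Set.range ν \ b) R ⊆ T ∧ T ⊆ F := by
  classical
  by_contra hcon
  push Not at hcon
  let State := Finset ℕ × List (ℕ × ℕ)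
  let Qa : Finset ℕ → Set M := fun a => {x | ∃ j ∉ a, x = ν j}
  have hQa : ∀ a, Qa a = Set.range ν \ (ν '' a) := by
    intro a
    ext x
    constructor
    · rintro ⟨j, hj, rfl⟩
      exact ⟨⟨j, rfl⟩, fun ⟨i, hi, h⟩ => hj (hν h ▸ hi)⟩
    · rintro ⟨⟨j, rfl⟩, h⟩
      exact ⟨j, fun hj => h ⟨j, hj, rfl⟩, rfl⟩
  have hQν : ∀ a, Qa a ⊆ Set.range ν := by
    rintro a _ ⟨j, -, rfl⟩
    exact ⟨j, rfl⟩
  let Z : State → Set (Fin k → M) := fun q => {t | ⇑(permOf ν q.2)⁻¹ ∘ t ∈ smear (Qa q.1) R}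
  have hZ : ∀ q T, D M T → T ⊆ F → ¬ Z q ⊆ T := by
    intro q T hT hTF hZT
    refine hcon (ν '' q.1) (q.1.finite_toSet.image ν) _
      (hiso M M (permOf ν q.2)⁻¹ T hT) ?_ ?_
    · rw [← hQa]
      intro t ht
      have h1 : ⇑(permOf ν q.2)⁻¹ ∘ ⇑(permOf ν q.2) ∘ t = t := by
        funext i; simp
      exact ⟨permOf ν q.2 ∘ t, hZT (by change _ ∈ smear _ _; rwa [h1]), h1⟩
    · rintro _ ⟨t, ht, rfl⟩
      refine hF _ _ (pat_permOf ν q.2 _).symm ?_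
      have h1 : ⇑(permOf ν q.2) ∘ ⇑(permOf ν q.2)⁻¹ ∘ t = t := by
        funext i; simp
      rw [h1]
      exact hTF ht
  have hRne : R.Nonempty := by
    by_contra h
    rw [Set.not_nonempty_iff_eq_empty] at h
    refine hcon ∅ Set.finite_empty R hR ?_ hRF
    rintro _ ⟨t, ht, -⟩
    simp [h] at ht
  have hZne : ∀ q, (Z q).Nonempty := by
    intro q
    obtain ⟨t, ht⟩ := hRne
    refine ⟨permOf ν q.2 ∘ t, subset_smear _ _ ?_⟩
    convert ht
    funext i; simp
  obtain ⟨c, hc⟩ : ∃ c : M → State → Fin k → M, Surjective c :=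
    ⟨fun w q => e w (Encodable.encode q),
      (Encodable.encode_injective.surjective_comp_right).comp he⟩
  let good : M → Prop := fun w => ∀ q, c w q ∈ Z q
  let B : Set (Fin (k + 1) → M) :=
    {t | good (t (Fin.last k)) → ∃ q, (fun i : Fin k => t i.castSucc) = c (t (Fin.last k)) q}
  have hB : ∀ (x : Fin k → M) (w : Fin 1 → M), Fin.append x w ∈ B ↔
      (good (w 0) → ∃ q, x = c (w 0) q) := by
    intro x w
    have h1 : Fin.append x w (Fin.last k) = w 0 := Fin.append_right x w 0
    have h2 : (fun i : Fin k => Fin.append x w i.castSucc) = x :=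
      funext fun i => Fin.append_left x w i
    change (good (Fin.append x w (Fin.last k)) → ∃ q, (fun i : Fin k =>
      Fin.append x w i.castSucc) = c (Fin.append x w (Fin.last k)) q) ↔ _
    rw [h1, h2]
  let J := Option (Option (Option State))
  let ar : J → ℕ := fun j => match j with
    | none => k + 1
    | some _ => k
  let P : ∀ j : J, Set (Fin (ar j) → M) := fun j => match j with
    | none => B
    | some none => F
    | some (some none) => R
    | some (some (some q)) => Z q
  obtain ⟨A, hAν, hAc, hAi, hA⟩ := ls_down (gI P) (Set.range ν) (Set.countable_range ν)
  have : Infinite A := hAi.to_subtype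
  have : Countable A := hAc.to_subtype
  let IA : Interp (Gsig ar) A := comap Subtype.val (gI P)
  have hsent : ∀ ψ : FOF (Gsig ar), IsSentence ψ → (FOTrue A IA ψ ↔ FOTrue M (gI P) ψ) := by
    intro ψ hψ
    let s : ℕ → A := fun _ => Classical.arbitrary A
    rw [FOTrue_iff hψ s, FOTrue_iff hψ (Subtype.val ∘ s)]
    exact hA ψ s
  let R0 : Set (Fin k → A) := {t | Subtype.val ∘ t ∈ R}
  let F0 : Set (Fin k → A) := {t | Subtype.val ∘ t ∈ F}
  let B0 : Set (Fin (k + 1) → A) := {t | Subtype.val ∘ t ∈ B}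
  have hB0 : ∀ (x : Fin k → A) (w : Fin 1 → A), Fin.append x w ∈ B0 ↔
      Fin.append (Subtype.val ∘ x) (Subtype.val ∘ w) ∈ B := by
    intro x w
    change Subtype.val ∘ Fin.append x w ∈ B ↔ _
    have : Subtype.val ∘ Fin.append x w = Fin.append (Subtype.val ∘ x) (Subtype.val ∘ w) := by
      funext i
      refine Fin.addCases (fun i => ?_) (fun i => ?_) i <;> simp
    rw [this]
  -- no member of the dependency inside `F0` meets all sections of `B0`
  have hno : ¬ ∃ T, D A T ∧ T ⊆ F0 ∧ (∀ w : Fin 1 → A, ∃ x ∈ T, Fin.append x w ∈ B0) ∧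
      ∀ x ∈ T, ∃ w : Fin 1 → A, Fin.append x w ∈ B0 := by
    obtain ⟨ψ, h1, h2⟩ := transversalF_fo (S := Gsig ar) (k := k) (j := 1) hD
      (sym ar (some none)) (sym ar none)
    refine fun h => ?_
    have h3 := (hsent ψ h1).1 ((h2 A inferInstance IA).2 h)
    obtain ⟨T, hT, hTF, hTB, -⟩ := (h2 M inferInstance (gI P)).1 h3
    have : ∀ q, ∃ z ∈ Z q, z ∉ T := fun q => Set.not_subset.1 (hZ q T hT hTF)
    choose z hz hzT using this
    obtain ⟨w, hw⟩ := hc z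
    obtain ⟨x, hx, hxB⟩ := hTB fun _ => w
    obtain ⟨q, hq⟩ := (hB x fun _ => w).1 hxB (fun q => hw ▸ hz q)
    rw [hq, hw] at hx
    exact hzT q hx
  have hDR0 : D A R0 := by
    obtain ⟨ψ, h1, h2⟩ := holdsF_fo (S := Gsig ar) (k := k) hD (sym ar (some (some none)))
    exact (h2 A inferInstance IA).1 ((hsent ψ h1).2 ((h2 M inferInstance (gI P)).2 hR))
  have hcover : ∀ x : Fin k → A, ∃ w : Fin 1 → A, Fin.append x w ∈ B0 := by
    intro x
    have h := hA (.ex k (.rel (sym ar none) (vk (k + 1)))) (overrideFin k x fun _ =>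
      Classical.arbitrary A)
    have h1 : FSat M (gI P) (Subtype.val ∘ overrideFin k x fun _ => Classical.arbitrary A)
        (.ex k (.rel (sym ar none) (vk (k + 1))) : FOF (Gsig ar)) := by
      obtain ⟨w, hw⟩ := hc fun _ => Subtype.val ∘ x
      refine ⟨w, ?_⟩
      change (fun i => _) ∈ B
      rw [eq_append, hB]
      intro hg
      refine ⟨(∅, []), ?_⟩
      simp only [Fin.val_zero, add_zero, update_self]
      rw [hw]
      funext i
      simp [vk, overrideFin, i.2.ne]
    obtain ⟨w, hw⟩ := h.2 h1
    change (fun i => _) ∈ B0 at hw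
    rw [eq_append] at hw
    refine ⟨fun _ => w, ?_⟩
    convert hw using 2
    · funext i
      simp [vk, overrideFin, i.2.ne]
    · funext i
      simp
  have htrans : ∀ (q : State) (w : A), ∃ t : Fin k → A, Subtype.val ∘ t ∈ Z q ∧
      Fin.append t (fun _ : Fin 1 => w) ∈ B0 := by
    intro q w
    have h := hA (exs (List.range k) (.and (.rel (sym ar (some (some (some q)))) (vk k))
      (.rel (sym ar none) (vk (k + 1))))) fun _ => w
    rw [FSat_exs, FSat_exs] at h
    have h1 : ∃ x : Fin k → M, x ∈ Z q ∧ Fin.append x (fun _ : Fin 1 => (w : M)) ∈ B := by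
      by_cases hg : good w
      · exact ⟨_, hg q, (hB _ _).2 fun _ => ⟨q, rfl⟩⟩
      · obtain ⟨x, hx⟩ := hZne q
        exact ⟨x, hx, (hB _ _).2 fun h => absurd h hg⟩
    obtain ⟨x, hx, hxB⟩ := h1
    obtain ⟨s, hs, hs1, hs2⟩ := h.2 ⟨overrideFin k x fun _ => w, fun v hv =>
      overrideFin_of_le _ _ (by simpa using hv), by
        change (fun i => _) ∈ Z q
        rwa [overrideFin_vk], by
        change (fun i => _) ∈ B
        rw [eq_append, overrideFin_vk]
        convert hxB using 3 with i
        exact overrideFin_of_le _ _ (by simp)⟩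
    refine ⟨fun i => s (vk k i), hs1, ?_⟩
    change (fun i => s _) ∈ B0 at hs2
    rw [eq_append] at hs2
    convert hs2 using 2
    funext i
    exact (hs _ (by simp)).symm
  let νA : ℕ → A := fun n => ⟨ν n, hAν ⟨n, rfl⟩⟩
  have hνA : Injective νA := fun i j h => hν (congrArg Subtype.val h)
  have hperm : ∀ l (t : Fin k → A), Subtype.val ∘ permOf νA l ∘ t =
      permOf ν l ∘ Subtype.val ∘ t :=
    fun l t => funext fun i => map_permOf Subtype.val_injective νA l (t i)
  obtain ⟨π, hπ1, hπ2⟩ := exists_perm_limit (k := k) hνA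
    (fun w t t' => t ∈ R0 ∧ Fin.append t' (fun _ : Fin 1 => w) ∈ B0) (by
      intro a l w
      obtain ⟨t, ⟨u, hu, hpat⟩, htB⟩ := htrans (a, l) w
      have hinv : ∀ y : A, ((permOf νA l)⁻¹ y : M) = (permOf ν l)⁻¹ (y : M) := by
        intro y
        rw [Equiv.Perm.eq_inv_iff_eq]
        have := map_permOf Subtype.val_injective νA l ((permOf νA l)⁻¹ y)
        rw [← Equiv.Perm.mul_apply, mul_inv_cancel, Equiv.Perm.one_apply] at this
        exact this.symm
      have huA : ∀ i, u i ∈ A := by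
        intro i
        rcases hpat.1 i with h | h
        · rw [h]
          change (permOf ν l)⁻¹ ((t i : A) : M) ∈ A
          rw [← hinv]
          exact Subtype.coe_prop _
        · exact hAν (hQν a h.1)
      let t0 : Fin k → A := fun i => ⟨u i, huA i⟩
      have hpat' : Pat {x | ∃ j ∉ a, x = νA j} t0 (⇑(permOf νA l)⁻¹ ∘ t) := by
        constructor
        · intro i
          refine (hpat.1 i).imp (fun h => ?_) fun h => ?_
          · refine Subtype.ext (h.trans ?_)
            exact (hinv _).symm
          · obtain ⟨⟨j, hj, h1⟩, j', hj', h2⟩ := h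
            exact ⟨⟨j, hj, Subtype.ext h1⟩, j', hj', Subtype.ext ((hinv _).trans h2)⟩
        · intro i j
          have := hpat.2 i j
          simp only [comp_apply, EmbeddingLike.apply_eq_iff_eq] at this ⊢
          rw [Subtype.ext_iff, Subtype.ext_iff]
          exact this
      obtain ⟨l', hl', he'⟩ := hpat'.exists_permOf
      refine ⟨t0, l', hl', hu, ?_⟩
      have : permOf νA (l ++ l') ∘ t0 = t := by
        rw [permOf_append, Equiv.Perm.coe_mul, comp_assoc, he']
        funext i; simp
      rwa [this])
  refine hno ⟨_, hiso A A π R0 hDR0, ?_, fun w => ?_, fun x _ => hcover x⟩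
  · rintro _ ⟨t, ht, rfl⟩
    obtain ⟨l, hl⟩ := hπ1 t
    change Subtype.val ∘ (⇑π ∘ t) ∈ F
    rw [hl, hperm]
    exact hF _ _ (pat_permOf ν l _) (hRF ht)
  · obtain ⟨t, ht, htB⟩ := hπ2 (w 0)
    refine ⟨_, ⟨t, ht, rfl⟩, ?_⟩
    convert htB using 2
    funext i
    rw [Subsingleton.elim i 0]

/-! ### Sandwiched members of a dependency -/

/-- The relation expressing, via transversals, that a relation contains `Z`. -/
def above {M : Type} {k : ℕ} (Z : Set (Fin k → M)) : Set (Fin (k + k) → M) :=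
  {t | (fun i => t (Fin.natAdd k i)) ∈ Z →
    (fun i => t (Fin.natAdd k i)) = fun i => t (Fin.castAdd k i)}

lemma append_mem_above {M : Type} {k : ℕ} {Z : Set (Fin k → M)} {x w : Fin k → M} :
    Fin.append x w ∈ above Z ↔ (w ∈ Z → w = x) := by
  change ((fun i => Fin.append x w (Fin.natAdd k i)) ∈ Z →
    _ = fun i => Fin.append x w (Fin.castAdd k i)) ↔ _
  simp only [Fin.append_left, Fin.append_right]

lemma Pat.comp {M : Type} {n m : ℕ} {Q : Set M} {t t' : Fin n → M} (h : Pat Q t t')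
    (c : Fin m → Fin n) : Pat Q (fun i => t (c i)) fun i => t' (c i) :=
  ⟨fun i => h.1 (c i), fun i j => h.2 (c i) (c j)⟩

lemma Inv.above {M : Type} {k : ℕ} {Q : Set M} {Z : Set (Fin k → M)} (h : Inv Q Z) :
    Inv Q (above Z) := by
  intro t t' ht hm hZ
  have h1 := hm (h _ _ (ht.comp (Fin.natAdd k)).symm hZ)
  funext i
  exact (ht.2 _ _).1 (congrFun h1 i)

/-- The arities of a pair of symbols used to express sandwiching. -/
def sandAr (k : ℕ) : Bool → ℕ
  | false => k
  | true => k + k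

/-- The pair of relations used to express sandwiching between `Z` and `F`. -/
def sandRel {M : Type} {k : ℕ} (Z F : Set (Fin k → M)) : ∀ b, Set (Fin (sandAr k b) → M)
  | false => F
  | true => above Z

lemma sandwich_fo {k : ℕ} {D : DepPred k} (hD : SFOd D) (F : S k) (B : S (k + k)) :
    ∃ ψ : FOF S, IsSentence ψ ∧ ∀ (M : Type), Nontrivial M → ∀ (I : Interp S M)
      (Z : Set (Fin k → M)), Z.Nonempty → I _ B = above Z →
        (FOTrue M I ψ ↔ ∃ T, D M T ∧ Z ⊆ T ∧ T ⊆ I _ F) := by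
  obtain ⟨ψ, h1, h2⟩ := transversalF_fo hD F B
  refine ⟨ψ, h1, fun M hM I Z hZ hI => (h2 M hM I).trans ?_⟩
  rw [hI]
  constructor
  · rintro ⟨T, hT, hF, hB, -⟩
    refine ⟨T, hT, fun w hw => ?_, hF⟩
    obtain ⟨x, hx, hxw⟩ := hB w
    rwa [append_mem_above.1 hxw hw]
  · rintro ⟨T, hT, hZT, hF⟩
    refine ⟨T, hT, hF, fun w => ?_, fun x hx => ⟨x, append_mem_above.2 fun _ => rfl⟩⟩
    by_cases hw : w ∈ Z
    · exact ⟨w, hZT hw, append_mem_above.2 fun _ => rfl⟩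
    · obtain ⟨z, hz⟩ := hZ
      exact ⟨z, hZT hz, append_mem_above.2 fun h => absurd h hw⟩

lemma above_comap {M N : Type} {k : ℕ} {e : M → N} (he : Injective e) (Z : Set (Fin k → N)) :
    {t : Fin (k + k) → M | e ∘ t ∈ above Z} = above {t : Fin k → M | e ∘ t ∈ Z} := by
  ext t
  refine imp_congr Iff.rfl ?_
  rw [funext_iff, funext_iff]
  exact forall_congr' fun i => he.eq_iff

lemma comap_sandRel {M N : Type} {k : ℕ} {e : M → N} (he : Injective e) (Z F : Set (Fin k → N)) :
    comap e (gI (sandRel Z F)) = gI (sandRel {t : Fin k → M | e ∘ t ∈ Z} {t | e ∘ t ∈ F}) := by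
  rw [comap_gI]
  congr 1
  funext b
  cases b
  · rfl
  · exact above_comap he Z

lemma inv_sandRel {M : Type} {k : ℕ} {Q : Set M} {Z F : Set (Fin k → M)} (hZ : Inv Q Z)
    (hF : Inv Q F) : ∀ n r, Inv Q (gI (sandRel Z F) n r) :=
  inv_gI fun b => match b with
    | false => hF
    | true => hZ.above

/-- Transfer of sandwiched members of a dependency along injections. -/
lemma exists_sandwich_fo {k : ℕ} {D : DepPred k} (hD : SFOd D) :
    ∃ ψ : FOF (Gsig (sandAr k)), IsSentence ψ ∧ ∀ (M : Type), Nontrivial M →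
      ∀ Z F : Set (Fin k → M), Z.Nonempty →
        (FOTrue M (gI (sandRel Z F)) ψ ↔ ∃ T, D M T ∧ Z ⊆ T ∧ T ⊆ F) := by
  obtain ⟨ψ, h1, h2⟩ := sandwich_fo (S := Gsig (sandAr k)) hD (sym (sandAr k) false)
    (sym (sandAr k) true)
  exact ⟨ψ, h1, fun M hM Z F hZ => h2 M hM _ Z hZ rfl⟩

lemma FSat_embedEF {M : Type} (I : Interp S M) (φ : EF) :
    ∀ s : ℕ → M, FSat M I s (embedEF φ : TS S ι ar) ↔ FSat M (eI M) s φ := by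
  induction φ with
  | rel r v => exact r.elim
  | nrel r v => exact r.elim
  | dep i v => exact i.elim
  | eq x y => intro s; rfl
  | neq x y => intro s; rfl
  | and φ ψ h1 h2 => intro s; exact and_congr (h1 s) (h2 s)
  | or φ ψ h1 h2 => intro s; exact or_congr (h1 s) (h2 s)
  | gdisj φ ψ h1 h2 => intro s; exact or_congr (h1 s) (h2 s)
  | cneg φ h => intro s; exact not_congr (h s)
  | ex v φ h => intro s; exact exists_congr fun m => h _
  | al v φ h => intro s; exact forall_congr' fun m => h _

lemma fv_embedEF (φ : EF) : fv (embedEF φ : TS S ι ar) = fv φ := by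
  induction φ with
  | rel r v => exact r.elim
  | nrel r v => exact r.elim
  | dep i v => exact i.elim
  | eq x y => rfl
  | neq x y => rfl
  | and φ ψ h1 h2 => simp only [embedEF, fv, h1, h2]
  | or φ ψ h1 h2 => simp only [embedEF, fv, h1, h2]
  | gdisj φ ψ h1 h2 => simp only [embedEF, fv, h1, h2]
  | cneg φ h => simp only [embedEF, fv, h]
  | ex v φ h => simp only [embedEF, fv, h]
  | al v φ h => simp only [embedEF, fv, h]

/-- `ExAllSem` is expressed by a first-order sentence. -/
lemma exAll_fo {k : ℕ} (R : S k) (θ : EF) : ∃ ψ : FOF S, IsSentence ψ ∧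
    ∀ (M : Type), Nontrivial M → ∀ I : Interp S M, (FOTrue M I ψ ↔ ExAllSem M (I k R) θ) := by
  let ψ : FOF S := exs ((avars θ).filter (k ≤ ·)).toList
    (als (List.range k) (.or (.nrel R (vk k)) (embedEF θ)))
  have hs : IsSentence ψ := by
    rw [IsSentence, fv_exs, fv_als]
    ext v
    simp only [fv, fv_embedEF, vk, Set.mem_sdiff, Set.mem_union, Set.mem_range, Set.mem_ofPred_eq,
      List.mem_range, Finset.mem_toList, Finset.mem_filter, Set.mem_empty_iff_false, iff_false]
    rintro ⟨⟨⟨i, rfl⟩ | h, h1⟩, h2⟩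
    · exact h1 i.2
    · exact h2 ⟨fv_subset_avars θ h, not_lt.1 h1⟩
  refine ⟨ψ, hs, fun M hM I => ?_⟩
  have key : ∀ s : ℕ → M, FSat M I s (als (List.range k) (.or (.nrel R (vk k)) (embedEF θ)) :
      FOF S) ↔ I k R ⊆ Def k θ s := by
    intro s
    rw [FSat_als]
    constructor
    · intro h f hf
      rcases h (overrideFin k f s) fun v hv => overrideFin_of_le _ _ (by simpa using hv) with h | h
      · refine absurd ?_ h
        rwa [overrideFin_vk]
      · exact (FSat_embedEF I θ _).1 h
    · intro h s' hs'
      by_cases hR : (fun i => s' (vk k i)) ∈ I k R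
      · refine Or.inr ((FSat_embedEF I θ _).2 ?_)
        have h1 : overrideFin k (fun i => s' (vk k i)) s = s' := by
          funext v
          by_cases hv : v < k
          · simp [overrideFin, hv, vk]
          · simp [overrideFin, hv, hs' v (by simpa using hv)]
        have := h hR
        rwa [Def, Set.mem_ofPred_eq, h1] at this
      · exact Or.inl hR
  obtain ⟨c⟩ : Nonempty M := inferInstance
  rw [FOTrue_iff hs fun _ => c, FSat_exs, exAllSem_iff]
  simp only [key]
  refine ⟨fun ⟨s, _, h⟩ => ⟨s, h⟩, fun ⟨s, h⟩ => ?_⟩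
  classical
  refine ⟨fun v => if v ∈ ((avars θ).filter (k ≤ ·)).toList then s v else c,
    fun v hv => if_neg hv, ?_⟩
  intro f hf
  refine (FSat_congr _ θ fun v hv => ?_).1 (h hf)
  by_cases hvk : v < k
  · simp [overrideFin, hvk]
  · have hv' : v ∈ avars θ := fv_subset_avars θ hv
    simp [overrideFin, hvk, hv', not_lt.1 hvk]

/-! ### Defining invariant relations by equality types -/

lemma exists_eqType_Def {M : Type} {k : ℕ} (Z : Set (Fin k → M)) (s0 : ℕ → M) (n : ℕ) :
    ∃ θ : EF, ∀ (N : Type) (s : ℕ → N) (f : Fin k → N), f ∈ Def k θ s ↔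
      ∃ t ∈ Z, ∀ i j : Fin n, overrideFin k f s i = overrideFin k f s j ↔
        overrideFin k t s0 i = overrideFin k t s0 j := by
  obtain ⟨θ, hθ⟩ := exists_eqType_formula n {p | ∃ t ∈ Z, ∀ i j : Fin n, p i j ↔
        overrideFin k t s0 i = overrideFin k t s0 j}
  exact ⟨θ, fun N s f => hθ N _⟩

lemma eqType_Def_pattern {M N : Type} {k n : ℕ} {Z : Set (Fin k → M)} {s0 : ℕ → M} {s : ℕ → N}
    {θ : EF} (hθ : ∀ (N : Type) (s : ℕ → N) (f : Fin k → N), f ∈ Def k θ s ↔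
      ∃ t ∈ Z, ∀ i j : Fin n, overrideFin k f s i = overrideFin k f s j ↔
        overrideFin k t s0 i = overrideFin k t s0 j) (h : (Def k θ s).Nonempty) (i j : ℕ)
    (hi : k ≤ i) (hj : k ≤ j) (hin : i < n) (hjn : j < n) : s i = s j ↔ s0 i = s0 j := by
  obtain ⟨f, hf⟩ := h
  obtain ⟨t, -, ht⟩ := (hθ N s f).1 hf
  simpa [overrideFin_of_le _ _ hi, overrideFin_of_le _ _ hj] using ht ⟨i, hin⟩ ⟨j, hjn⟩

lemma eqType_Def_self {M : Type} {k n : ℕ} {Z : Set (Fin k → M)} {s0 : ℕ → M}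
    {θ : EF} (hθ : ∀ (N : Type) (s : ℕ → N) (f : Fin k → N), f ∈ Def k θ s ↔
      ∃ t ∈ Z, ∀ i j : Fin n, overrideFin k f s i = overrideFin k f s j ↔
        overrideFin k t s0 i = overrideFin k t s0 j) (hkn : k ≤ n) {Q : Set M} (hZ : Inv Q Z)
    (hQ : ∀ x ∉ Q, ∃ i, k ≤ i ∧ i < n ∧ s0 i = x) {s : ℕ → M}
    (hs : ∀ i, k ≤ i → i < n → s i = s0 i) : Def k θ s = Z := by
  ext f
  rw [hθ]
  have ho : ∀ (f : Fin k → M) (i : Fin n), overrideFin k f s i = overrideFin k f s0 i := by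
    intro f i
    by_cases hi : i < k
    · simp [overrideFin, hi]
    · simp [overrideFin, hi, hs i (not_lt.1 hi) i.2]
  simp only [ho]
  refine ⟨fun ⟨t, ht, h⟩ => ?_, fun h => ⟨f, h, fun _ _ => Iff.rfl⟩⟩
  have hval : ∀ (f : Fin k → M) (i : Fin k), overrideFin k f s0 i = f i := fun f i => by
    simp [overrideFin]
  refine hZ t f ⟨fun i => ?_, fun i j => ?_⟩ ht
  · by_cases h1 : t i ∈ Q
    · by_cases h2 : f i ∈ Q
      · exact Or.inr ⟨h1, h2⟩
      · obtain ⟨m, hm, hmn, hx⟩ := hQ _ h2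
        have := h ⟨i, i.2.trans_le hkn⟩ ⟨m, hmn⟩
        simp only [hval, overrideFin_of_le _ _ hm, hx, true_iff] at this
        exact Or.inl this
    · obtain ⟨m, hm, hmn, hx⟩ := hQ _ h1
      have := h ⟨i, i.2.trans_le hkn⟩ ⟨m, hmn⟩
      simp only [hval, overrideFin_of_le _ _ hm, hx, iff_true] at this
      exact Or.inl this.symm
  · have := h ⟨i, i.2.trans_le hkn⟩ ⟨j, j.2.trans_le hkn⟩
    simp only [hval] at this
    exact this.symm

/-- An assignment listing a finite set in the variables from `k` on. -/
lemma exists_enum {M : Type} [Nonempty M] {X : Set M} (hX : X.Finite) (k : ℕ) :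
    ∃ (s : ℕ → M) (n : ℕ), k ≤ n ∧ ∀ x ∈ X, ∃ i, k ≤ i ∧ i < n ∧ s i = x := by
  obtain ⟨c⟩ := ‹Nonempty M›
  obtain ⟨n, f, -, rfl⟩ := hX.fin_param
  refine ⟨fun i => if h : i - k < n then f ⟨i - k, h⟩ else c, k + n, by omega, ?_⟩
  rintro _ ⟨i, rfl⟩
  exact ⟨k + i, by omega, by omega, by simp⟩

lemma Inv.smear_of_disjoint {M : Type} {n : ℕ} {Q Q' : Set M} (hd : Disjoint Q Q')
    {Z : Set (Fin n → M)} (hZ : Inv Q Z) : Inv Q (smear Q' Z) := by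
  classical
  rintro t t' ht ⟨u, hu, hut⟩
  have hnot : ∀ x, x ∈ Q → x ∉ Q' := fun x h h' => Set.disjoint_left.1 hd h h'
  let u' : Fin n → M := fun i => if t i ∈ Q then t' i else u i
  have h1 : ∀ i, t i ∈ Q → u i = t i := fun i hi =>
    (hut.1 i).resolve_right fun h => hnot _ hi h.2
  have h2 : ∀ i, t i ∈ Q → t' i ∈ Q := fun i hi =>
    (ht.1 i).elim (fun h => h ▸ hi) fun h => h.2
  have h3 : ∀ i, t i ∉ Q → t' i = t i := fun i hi =>
    ((ht.1 i).resolve_right fun h => hi h.1).symm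
  have h4 : ∀ i, t i ∉ Q → u i ∉ Q := fun i hi =>
    (hut.1 i).elim (fun h => h ▸ hi) fun h h' => hnot _ h' h.1
  have huu : ∀ i j, u i = u j ↔ u' i = u' j := by
    intro i j
    by_cases hi : t i ∈ Q <;> by_cases hj : t j ∈ Q
    · simp only [u', hi, hj, if_true]
      exact (hut.2 i j).trans (ht.2 i j)
    · simp only [u', hi, hj, if_true, if_false]
      exact iff_of_false (fun h => h4 j hj (h ▸ h1 i hi ▸ hi)) fun h => h4 j hj (h ▸ h2 i hi)
    · simp only [u', hi, hj, if_true, if_false]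
      exact iff_of_false (fun h => h4 i hi (h ▸ h1 j hj ▸ hj)) fun h => h4 i hi (h ▸ h2 j hj)
    · simp only [u', hi, hj, if_false]
  refine ⟨u', hZ u u' ⟨fun i => ?_, huu⟩ hu, fun i => ?_, fun i j =>
    (huu i j).symm.trans ((hut.2 i j).trans (ht.2 i j))⟩
  · by_cases hi : t i ∈ Q
    · simp only [u', hi, if_true]
      exact Or.inr ⟨h1 i hi ▸ hi, h2 i hi⟩
    · simp [u', hi]
  · by_cases hi : t i ∈ Q
    · simp [u', hi]
    · simp only [u', hi, if_false, h3 i hi]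
      exact hut.1 i

lemma Inv.comap {M N : Type} {n : ℕ} {e : M → N} (he : Injective e) {Q : Set N}
    {Z : Set (Fin n → N)} (hZ : Inv Q Z) : Inv (e ⁻¹' Q) {t | e ∘ t ∈ Z} :=
  fun _ _ ht => hZ _ _ ⟨fun i => (ht.1 i).imp (congrArg e) id, fun i j => by
    simpa [he.eq_iff] using ht.2 i j⟩

/-- The cardinality of a set of size continuum allows all countable sequences of tuples. -/
lemma exists_surjective_seq {M : Type} (hM : Cardinal.mk M = Cardinal.continuum) (k : ℕ) :
    ∃ e : M → ℕ → Fin k → M, Surjective e := by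
  have hM0 : Nonempty M := by
    rw [← Cardinal.mk_ne_zero_iff, hM]; exact Cardinal.continuum_ne_zero
  have h : Cardinal.mk (ℕ → Fin k → M) ≤ Cardinal.mk M := by
    have h1 : Cardinal.mk (ℕ → Fin k → M) = Cardinal.mk (ℕ × Fin k → M) :=
      Cardinal.mk_congr (Equiv.curry _ _ _).symm
    rw [h1, ← Cardinal.power_def, hM]
    calc Cardinal.continuum ^ Cardinal.mk (ℕ × Fin k)
        ≤ Cardinal.continuum ^ Cardinal.aleph0 :=
          Cardinal.power_le_power_left Cardinal.continuum_ne_zero Cardinal.mk_le_aleph0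
      _ = Cardinal.continuum := Cardinal.continuum_power_aleph0
  obtain ⟨f⟩ := Cardinal.le_def _ _ |>.1 h
  obtain ⟨c⟩ := hM0
  have : Nonempty (ℕ → Fin k → M) := ⟨fun _ _ => c⟩
  exact ⟨invFun f, invFun_surjective f.injective⟩

lemma exists_seq_of_infinite {M : Type} {Q : Set M} (hQ : Q.Infinite) :
    ∃ ν : ℕ → M, Injective ν ∧ Set.range ν ⊆ Q := by
  have := hQ.to_subtype
  exact ⟨fun n => Infinite.natEmbedding Q n, Subtype.val_injective.comp
    (Infinite.natEmbedding Q).injective, by rintro _ ⟨n, rfl⟩; exact Subtype.coe_prop _⟩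

lemma exAllSem_botF {M : Type} [Nonempty M] {k : ℕ} {R : Set (Fin k → M)} :
    ExAllSem M R botF ↔ R = ∅ := by
  constructor
  · rintro ⟨s, hs⟩
    exact Set.eq_empty_of_forall_notMem fun t ht => hs t ht rfl
  · rintro rfl
    exact ⟨fun _ => Classical.arbitrary M, by simp⟩

lemma refine_countable {k : ℕ} {D : DepPred k} (hiso : IsoClosed D) (hD : SFOd D) {M : Type}
    [Infinite M] {R : Set (Fin k → M)} (hR : D M R) (hRne : R.Nonempty) {θ : EF}
    (hθ : ExAllSem M R θ) :
    ∃ (A : Type) (R2 Z2 : Set (Fin k → A)) (s2 : ℕ → A) (Q2 : Set A), Countable A ∧ Infinite A ∧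
      Q2.Infinite ∧ R2 ⊆ Z2 ∧ R2.Nonempty ∧ Inv Q2 Z2 ∧ (∀ i ∈ avars θ, s2 i ∉ Q2) ∧
      (∃ T, D A T ∧ Z2 ⊆ T ∧ T ⊆ Def k θ s2) ∧
      ∀ θ', ExAllSem A R2 θ' → ExAllSem M R θ' := by
  classical
  -- a model of size continuum
  let ar0 : Unit → ℕ := fun _ => k
  obtain ⟨M1, J, hM1, hJ⟩ := exists_large (gI (ar := ar0) fun _ => R)
  have : Infinite M1 := by
    rw [Cardinal.infinite_iff, hM1]; exact Cardinal.aleph0_le_continuum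
  let R1 : Set (Fin k → M1) := J (ar0 ()) (sym ar0 ())
  have hEx : ∀ θ', ExAllSem M1 R1 θ' ↔ ExAllSem M R θ' := by
    intro θ'
    obtain ⟨ψ, h1, h2⟩ := exAll_fo (sym ar0 ()) θ'
    rw [← h2 M1 inferInstance J, hJ ψ h1, h2 M inferInstance]
    rfl
  have hDR1 : D M1 R1 := by
    obtain ⟨ψ, h1, h2⟩ := holdsF_fo (S := Gsig ar0) (k := k) hD (sym ar0 ())
    rw [← h2 M1 inferInstance J, hJ ψ h1, h2 M inferInstance]
    exact hR
  obtain ⟨s1, hs1⟩ := exAllSem_iff.1 ((hEx θ).2 hθ)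
  have hR1ne : R1.Nonempty := by
    rwa [Set.nonempty_iff_ne_empty, Ne, ← exAllSem_botF, hEx, exAllSem_botF, ← Ne,
      ← Set.nonempty_iff_ne_empty]
  obtain ⟨e, he⟩ := exists_surjective_seq hM1 k
  let V1 : Finset M1 := (avars θ).image s1
  obtain ⟨ν, hν, hνV⟩ := exists_seq_of_infinite (V1.finite_toSet.infinite_compl)
  have hνθ : ∀ i ∈ avars θ, s1 i ∉ Set.range ν := fun i hi h =>
    hνV h (Finset.mem_image_of_mem _ hi)
  obtain ⟨a, ha, T1, hDT1, hT1, hT1F⟩ := smear_absorb hiso hD he hν hDR1 hs1 (inv_Def hνθ)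
  -- a countable elementary submodel
  let Z1 := smear (Set.range ν \ a) R1
  let ar1 : Option Bool → ℕ := fun j => j.elim k (sandAr k)
  let P : ∀ j, Set (Fin (ar1 j) → M1) := fun j => match j with
    | none => R1
    | some b => sandRel Z1 (Def k θ s1) b
  obtain ⟨A, hAν, hAc, hAi, hA⟩ := ls_down (gI P) (Set.range ν ∪ Set.range s1)
    ((Set.countable_range ν).union (Set.countable_range s1))
  have : Infinite A := hAi.to_subtype
  let IA : Interp (Gsig ar1) A := comap Subtype.val (gI P)
  have hsent : ∀ ψ : FOF (Gsig ar1), IsSentence ψ → (FOTrue A IA ψ ↔ FOTrue M1 (gI P) ψ) := by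
    intro ψ hψ
    let s : ℕ → A := fun _ => Classical.arbitrary A
    rw [FOTrue_iff hψ s, FOTrue_iff hψ (Subtype.val ∘ s)]
    exact hA ψ s
  let R2 : Set (Fin k → A) := {t | Subtype.val ∘ t ∈ R1}
  let Z2 : Set (Fin k → A) := {t | Subtype.val ∘ t ∈ Z1}
  let s2 : ℕ → A := fun i => ⟨s1 i, hAν (Or.inr ⟨i, rfl⟩)⟩
  have hEx2 : ∀ θ', ExAllSem A R2 θ' ↔ ExAllSem M1 R1 θ' := by
    intro θ'
    obtain ⟨ψ, h1, h2⟩ := exAll_fo (sym ar1 none) θ'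
    exact (h2 A inferInstance IA).symm.trans ((hsent ψ h1).trans (h2 M1 inferInstance (gI P)))
  have hR2ne : R2.Nonempty := by
    rwa [Set.nonempty_iff_ne_empty, Ne, ← exAllSem_botF, hEx2, exAllSem_botF, ← Ne,
      ← Set.nonempty_iff_ne_empty]
  have hRZ : R2 ⊆ Z2 := fun t ht => subset_smear _ _ ht
  refine ⟨A, R2, Z2, s2, Subtype.val ⁻¹' (Set.range ν \ a), hAc.to_subtype, inferInstance, ?_,
    hRZ, hR2ne, ?_, ?_, ?_, fun θ' h => (hEx θ').1 ((hEx2 θ').1 h)⟩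
  · refine Set.Infinite.preimage ((Set.infinite_range_of_injective hν).sdiff ha) ?_
    rintro x ⟨hx, -⟩
    rw [Subtype.range_val]
    exact hAν (Or.inl hx)
  · exact Inv.comap Subtype.val_injective (inv_smear _ _)
  · exact fun i hi h => hνθ i hi h.1
  · obtain ⟨ψ, h1, h2⟩ := sandwich_fo (S := Gsig ar1) hD (sym ar1 (some false))
      (sym ar1 (some true))
    have h3 := (h2 M1 inferInstance (gI P) Z1 (hR1ne.mono (subset_smear _ _)) rfl).2
      ⟨T1, hDT1, hT1, hT1F⟩
    obtain ⟨T, hT, hZT, hTF⟩ := (h2 A inferInstance IA Z2 (hR2ne.mono hRZ)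
      (above_comap Subtype.val_injective Z1)).1 ((hsent ψ h1).2 h3)
    exact ⟨T, hT, hZT, fun t ht => (mem_Def_injection Subtype.val_injective θ s2 t).1 (hTF ht)⟩

lemma mk_sum_seq (A : Type) [Countable A] :
    Cardinal.mk (A ⊕ (ℕ → Bool)) = Cardinal.continuum := by
  rw [← Cardinal.add_def, ← Cardinal.power_def, Cardinal.mk_bool, Cardinal.mk_nat,
    Cardinal.two_power_aleph0]
  exact Cardinal.add_eq_right Cardinal.aleph0_le_continuum
    (Cardinal.mk_le_aleph0.trans Cardinal.aleph0_le_continuum)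

lemma sandwich_transfer {k : ℕ} {D : DepPred k} {M N : Type} [Nontrivial M]
    [Nontrivial N] {e : M → N} (he : Injective e) {ψ : FOF (Gsig (sandAr k))}
    (h1 : IsSentence ψ) (h2 : ∀ (M : Type), Nontrivial M →
      ∀ Z F : Set (Fin k → M), Z.Nonempty →
        (FOTrue M (gI (sandRel Z F)) ψ ↔ ∃ T, D M T ∧ Z ⊆ T ∧ T ⊆ F))
    {Q : Set N} (hQ : (Set.range e)ᶜ ⊆ Q) {Z F : Set (Fin k → N)}
    (hV : ∀ s : ℕ → N, ∃ m : M, e m ∈ Q ∧ ∀ i ∈ avars ψ, s i ≠ e m)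
    (hZ : Inv Q Z) (hF : Inv Q F) (hne : {t : Fin k → M | e ∘ t ∈ Z}.Nonempty) :
    (∃ T, D M T ∧ {t : Fin k → M | e ∘ t ∈ Z} ⊆ T ∧ T ⊆ {t : Fin k → M | e ∘ t ∈ F}) ↔
      ∃ T, D N T ∧ Z ⊆ T ∧ T ⊆ F := by
  obtain ⟨c⟩ : Nonempty M := inferInstance
  have hne' : Z.Nonempty := hne.elim fun t ht => ⟨_, ht⟩
  rw [← h2 M inferInstance _ _ hne, ← h2 N inferInstance _ _ hne', ← comap_sandRel he,
    FOTrue_iff h1 fun _ => c, FOTrue_iff h1 (e ∘ fun _ => c)]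
  exact FSat_injection he hQ _ (inv_sandRel hZ hF) hV ψ subset_rfl _

lemma refine_wide {k : ℕ} {D : DepPred k} (hiso : IsoClosed D) (hD : SFOd D) {A : Type}
    [Countable A] [Infinite A] {Z : Set (Fin k → A)} {s : ℕ → A} {Q : Set A} {θ : EF}
    (hQ : Q.Infinite) (hZne : Z.Nonempty) (hZ : Inv Q Z) (hs : ∀ i ∈ avars θ, s i ∉ Q)
    (hT : ∃ T, D A T ∧ Z ⊆ T ∧ T ⊆ Def k θ s) :
    ∃ (Z' : Set (Fin k → A ⊕ (ℕ → Bool))) (X : Set A), X.Finite ∧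
      (∀ t ∈ Z, ∀ t', Pat (Sum.inl '' Q ∪ Set.range Sum.inr) (Sum.inl ∘ t) t' → t' ∈ Z') ∧
      Inv (Set.range Sum.inr) Z' ∧ Inv (Sum.inl '' Xᶜ) Z' ∧
      ∃ T, D _ T ∧ Z' ⊆ T ∧ T ⊆ Def k θ (Sum.inl ∘ s) := by
  classical
  obtain ⟨ψ, h1, h2⟩ := exists_sandwich_fo hD
  let Q3 : Set (A ⊕ (ℕ → Bool)) := Sum.inl '' Q ∪ Set.range Sum.inr
  let Z3 : Set (Fin k → A ⊕ (ℕ → Bool)) := smear Q3 ((fun t => Sum.inl ∘ t) '' Z)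
  have hinl : Injective (Sum.inl : A → A ⊕ (ℕ → Bool)) := Sum.inl_injective
  have hpre : (Sum.inl ⁻¹' Q3 : Set A) = Q := by
    ext x; simp [Q3]
  have hcomap : {t : Fin k → A | Sum.inl ∘ t ∈ Z3} = Z := by
    ext t
    constructor
    · rintro ⟨_, ⟨u, hu, rfl⟩, hp⟩
      refine hZ u t ⟨fun i => ?_, fun i j => ?_⟩ hu
      · refine (hp.1 i).imp (fun h => hinl h) fun h => ?_
        rw [← hpre]
        exact h
      · have := hp.2 i j
        simpa [hinl.eq_iff] using this
    · intro h
      exact subset_smear _ _ ⟨t, h, rfl⟩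
  have hDef : {t : Fin k → A | (Sum.inl ∘ t : Fin k → A ⊕ (ℕ → Bool)) ∈ Def k θ (Sum.inl ∘ s)} =
      Def k θ s := Set.ext fun t => mem_Def_injection hinl θ s t
  have hF3 : Inv Q3 (Def k θ (Sum.inl ∘ s : ℕ → A ⊕ (ℕ → Bool))) := inv_Def fun i hi h => by
    rcases h with ⟨x, hx, h⟩ | ⟨y, hy⟩
    · exact hs i hi (hinl h ▸ hx)
    · cases hy
  obtain ⟨T3, hT3, hZT3, hTF3⟩ := (sandwich_transfer (D := D) hinl h1 h2 (Q := Q3) (Z := Z3)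
    (F := Def k θ (Sum.inl ∘ s))
    (by rw [Set.compl_range_inl]; exact Set.subset_union_right)
    (exists_fresh_of_infinite (by
      refine (hQ.image hinl.injOn).mono ?_
      rintro _ ⟨x, hx, rfl⟩
      exact ⟨Or.inl ⟨x, hx, rfl⟩, x, rfl⟩) _) (inv_smear _ _) hF3 (by rwa [hcomap])).1
    (by rwa [hcomap, hDef])
  obtain ⟨e, he⟩ := exists_surjective_seq (mk_sum_seq A) k
  let V : Finset A := (avars θ).image s
  have hVi : ((V : Set A)ᶜ).Infinite := V.finite_toSet.infinite_compl
  have := hVi.to_subtype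
  obtain ⟨ν0⟩ : Nonempty (ℕ ≃ ((V : Set A)ᶜ : Set A)) := nonempty_equiv_of_countable
  let ν : ℕ → A ⊕ (ℕ → Bool) := fun n => Sum.inl (ν0 n : A)
  have hν : Injective ν := hinl.comp (Subtype.val_injective.comp ν0.injective)
  have hνr : Set.range ν = Sum.inl '' (V : Set A)ᶜ := by
    ext x
    constructor
    · rintro ⟨n, rfl⟩
      exact ⟨_, (ν0 n).2, rfl⟩
    · rintro ⟨x, hx, rfl⟩
      exact ⟨ν0.symm ⟨x, hx⟩, by simp [ν]⟩
  have hF3' : Inv (Set.range ν) (Def k θ (Sum.inl ∘ s : ℕ → A ⊕ (ℕ → Bool))) :=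
    inv_Def fun i hi h => by
      rw [hνr] at h
      obtain ⟨x, hx, h⟩ := h
      exact hx (hinl h ▸ Finset.mem_image_of_mem _ hi)
  obtain ⟨b, hb, T4, hT4, hZT4, hTF4⟩ := smear_absorb hiso hD he hν hT3 hTF3 hF3'
  refine ⟨smear (Set.range ν \ b) Z3, V ∪ Sum.inl ⁻¹' b, ?_, ?_, ?_, ?_, T4, hT4, ?_, hTF4⟩
  · exact V.finite_toSet.union (hb.preimage hinl.injOn)
  · exact fun t ht t' hp => subset_smear _ _ ⟨_, ⟨t, ht, rfl⟩, hp⟩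
  · refine Inv.smear_of_disjoint ?_ ((inv_smear Q3 _).mono Set.subset_union_right)
    rw [Set.disjoint_left]
    rintro _ ⟨y, rfl⟩ ⟨⟨n, h⟩, -⟩
    cases h
  · refine (inv_smear _ _).mono ?_
    rintro _ ⟨x, hx, rfl⟩
    rw [hνr]
    exact ⟨⟨x, fun h => hx (Or.inl h), rfl⟩, fun h => hx (Or.inr h)⟩
  · refine Set.Subset.trans ?_ hZT4
    rintro t ⟨u, hu, hp⟩
    exact ⟨u, hZT3 hu, hp⟩

/-- A finite partial isomorphism between countably infinite sets extends to a bijection. -/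
lemma exists_equiv_extending {A B : Type} [Countable A] [Infinite A] [Countable B] [Infinite B]
    {n : ℕ} (f : Fin n → A) (g : Fin n → B) (h : ∀ i j, f i = f j ↔ g i = g j) :
    ∃ e : A ≃ B, e ∘ f = g := by
  obtain ⟨e⟩ : Nonempty (A ≃ B) := nonempty_equiv_of_countable
  obtain ⟨l, -, hl⟩ := Pat.exists_swaps (Q := Set.univ) (t := e ∘ f) (t' := g)
    ⟨fun i => Or.inr ⟨trivial, trivial⟩, fun i j => by simpa using h i j⟩
  exact ⟨e.trans (swaps l), hl⟩

/-- The refinement step: sandwiching a dependency between sets defined by equality types. -/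
lemma exists_refinement {k : ℕ} {D : DepPred k} (hiso : IsoClosed D) (hD : SFOd D) {M : Type}
    [Infinite M] {R : Set (Fin k → M)} (hR : D M R) (hRne : R.Nonempty) {θ : EF}
    (hθ : ExAllSem M R θ) :
    ∃ θ' : EF, ExAllSem M R θ' ∧ ∀ s' : ℕ → ℕ, (Def k θ' s').Nonempty →
      ∃ (T : Set (Fin k → ℕ)) (s : ℕ → ℕ), D ℕ T ∧ Def k θ' s' ⊆ T ∧ T ⊆ Def k θ s := by
  classical
  obtain ⟨A, R2, Z2, s2, Q2, _, _, hQ2, hRZ, hR2ne, hZ2, hs2, hT2, hEx⟩ :=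
    refine_countable hiso hD hR hRne hθ
  obtain ⟨Z4, X, hX, hZ4, hZ4i, hZ4X, hT4⟩ := refine_wide hiso hD hQ2 (hR2ne.mono hRZ) hZ2 hs2 hT2
  obtain ⟨ψ, h1, h2⟩ := exists_sandwich_fo hD
  -- a countable model with only finitely many new elements
  let n1 := (avars ψ).card + 1
  obtain ⟨emb⟩ : Nonempty (Fin n1 ↪ (ℕ → Bool)) := ⟨(Fin.valEmbedding).trans
    (Infinite.natEmbedding _)⟩
  let g1 : A ⊕ Fin n1 → A ⊕ (ℕ → Bool) := Sum.map id emb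
  have hg1 : Injective g1 := injective_id.sumMap emb.injective
  let Z5 : Set (Fin k → A ⊕ Fin n1) := {t | g1 ∘ t ∈ Z4}
  have hDef4 : Inv (Set.range Sum.inr) (Def k θ (Sum.inl ∘ s2 : ℕ → A ⊕ (ℕ → Bool))) :=
    inv_Def fun i _ h => by
      obtain ⟨y, hy⟩ := h
      cases hy
  have hinf : Infinite (A ⊕ Fin n1) := inferInstance
  -- embedding the countable model into the new one, using fresh elements
  let em : (Fin n1 → A) → A → A ⊕ Fin n1 := fun em2 x =>
    if h : ∃ j, em2 j = x then Sum.inr h.choose else Sum.inl x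
  have hem1 : ∀ em2 : Fin n1 → A, Injective em2 → ∀ j, em em2 (em2 j) = Sum.inr j := by
    intro em2 h j
    have h' : ∃ j', em2 j' = em2 j := ⟨j, rfl⟩
    change (if h : _ then _ else _) = _
    rw [dif_pos h']
    exact congrArg Sum.inr (h h'.choose_spec)
  have hem2 : ∀ (em2 : Fin n1 → A) x, (∀ j, em2 j ≠ x) → em em2 x = Sum.inl x := by
    intro em2 x h
    exact dif_neg fun ⟨j, hj⟩ => h j hj
  have hemi : ∀ em2 : Fin n1 → A, Injective em2 → Injective (em em2) := by
    intro em2 h x y hxy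
    by_cases hx : ∃ j, em2 j = x <;> by_cases hy : ∃ j, em2 j = y
    · obtain ⟨j, rfl⟩ := hx
      obtain ⟨j', rfl⟩ := hy
      rw [hem1 _ h, hem1 _ h] at hxy
      rw [Sum.inr_injective hxy]
    · obtain ⟨j, rfl⟩ := hx
      rw [hem1 _ h, hem2 _ _ (not_exists.1 hy)] at hxy
      cases hxy
    · obtain ⟨j, rfl⟩ := hy
      rw [hem1 _ h, hem2 _ _ (not_exists.1 hx)] at hxy
      cases hxy
    · rw [hem2 _ _ (not_exists.1 hx), hem2 _ _ (not_exists.1 hy)] at hxy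
      exact Sum.inl_injective hxy
  have hemZ : ∀ em2 : Fin n1 → A, Injective em2 → (∀ j, em2 j ∈ Q2) → ∀ t ∈ Z2,
      em em2 ∘ t ∈ Z5 := by
    intro em2 h hQ t ht
    refine hZ4 t ht _ ⟨fun i => ?_, fun i j => ?_⟩
    · by_cases hx : ∃ j, em2 j = t i
      · obtain ⟨j, hj⟩ := hx
        refine Or.inr ⟨Or.inl ⟨t i, hj ▸ hQ j, rfl⟩, Or.inr ⟨emb j, ?_⟩⟩
        simp only [comp_apply]
        rw [← hj, hem1 _ h]
        rfl
      · refine Or.inl ?_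
        simp only [comp_apply]
        rw [hem2 _ _ (not_exists.1 hx)]
        rfl
    · simp only [comp_apply, hg1.eq_iff, (hemi _ h).eq_iff, Sum.inl_injective.eq_iff]
  have hfreshQ : ∀ V : Set A, V.Finite → ∃ em2 : Fin n1 → A, Injective em2 ∧
      (∀ j, em2 j ∈ Q2) ∧ ∀ j, em2 j ∉ V := by
    intro V hV
    obtain ⟨ν, hν, hνQ⟩ := exists_seq_of_infinite (hQ2.sdiff hV)
    exact ⟨fun j => ν j, hν.comp Fin.val_injective, fun j => (hνQ ⟨j, rfl⟩).1,
      fun j => (hνQ ⟨j, rfl⟩).2⟩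
  have hZ5ne : Z5.Nonempty := by
    obtain ⟨em2, h, hQ, -⟩ := hfreshQ ∅ Set.finite_empty
    obtain ⟨t, ht⟩ := hR2ne
    exact ⟨_, hemZ em2 h hQ t (hRZ ht)⟩
  obtain ⟨T5, hT5, hZT5, hTF5⟩ := (sandwich_transfer (D := D) hg1 h1 h2
    (Q := Set.range Sum.inr) (by
      rintro (x | y) h
      · exact absurd ⟨Sum.inl x, rfl⟩ h
      · exact ⟨y, rfl⟩)
    (exists_fresh_of_card hg1 (Sum.inr : Fin n1 → A ⊕ Fin n1) Sum.inr_injective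
      (fun i => show g1 (Sum.inr i) ∈ Set.range Sum.inr from ⟨emb i, rfl⟩) (Nat.lt_succ_self _))
      hZ4i hDef4 hZ5ne).2 hT4
  have hTF5' : T5 ⊆ Def k θ (Sum.inl ∘ s2 : ℕ → A ⊕ Fin n1) := fun t ht =>
    (mem_Def_injection hg1 θ (Sum.inl ∘ s2) t).1 (hTF5 ht)
  -- the formula
  have hX4 : (Sum.inl '' X ∪ Set.range Sum.inr : Set (A ⊕ Fin n1)).Finite :=
    (hX.image _).union (Set.finite_range _)
  obtain ⟨s0, n, hkn, hs0⟩ := exists_enum hX4 k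
  have hZ5 : Inv (Sum.inl '' Xᶜ) Z5 := by
    refine (Inv.comap hg1 hZ4X).mono ?_
    rintro _ ⟨x, hx, rfl⟩
    exact ⟨x, hx, rfl⟩
  have hs0' : ∀ x ∉ (Sum.inl '' Xᶜ : Set (A ⊕ Fin n1)), ∃ i, k ≤ i ∧ i < n ∧ s0 i = x := by
    intro x hx
    refine hs0 x ?_
    rcases x with x | y
    · exact Or.inl ⟨x, by_contra fun h => hx ⟨x, h, rfl⟩, rfl⟩
    · exact Or.inr ⟨y, rfl⟩
  obtain ⟨θ', hθ'⟩ := exists_eqType_Def Z5 s0 n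
  refine ⟨θ', hEx θ' ?_, fun s' hs' => ?_⟩
  · obtain ⟨em2, h, hQ, hV⟩ := hfreshQ (Sum.inl ⁻¹' (s0 '' Set.Iio n))
      (((Set.finite_Iio n).image s0).preimage Sum.inl_injective.injOn)
    refine exAllSem_iff.2 ⟨Sum.elim id em2 ∘ s0, fun t ht => ?_⟩
    refine (hθ' _ _ _).2 ⟨em em2 ∘ t, hemZ em2 h hQ t (hRZ ht), fun i j => ?_⟩
    have key : ∀ i : Fin n, overrideFin k (em em2 ∘ t) s0 i =
        em em2 (overrideFin k t (Sum.elim id em2 ∘ s0) i) := by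
      intro i
      by_cases hi : (i : ℕ) < k
      · simp [overrideFin, hi]
      · simp only [overrideFin, hi, dif_neg, not_false_eq_true, comp_apply]
        rcases hsi : s0 i with x | j
        · refine (hem2 _ _ fun j hj => hV j ⟨i, i.2, ?_⟩).symm
          rw [hsi, hj]
        · exact (hem1 _ h j).symm
    rw [key, key, (hemi _ h).eq_iff]
  · have hpat := eqType_Def_pattern hθ' hs'
    obtain ⟨h, hh⟩ := exists_equiv_extending (fun i : Fin (n - k) => s0 (k + i))
      (fun i : Fin (n - k) => s' (k + i)) fun i j =>
      (hpat _ _ (by omega) (by omega) (by omega) (by omega)).symm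
    have hh' : ∀ i, k ≤ i → i < n → h (s0 i) = s' i := by
      intro i hi hin
      have := congrFun hh ⟨i - k, by omega⟩
      simpa [Nat.add_sub_cancel' hi] using this
    have hD' : Def k θ' (h.symm ∘ s') = Z5 := eqType_Def_self hθ' hkn hZ5 hs0'
      fun i hi hin => by simp [← hh' i hi hin]
    refine ⟨_, h ∘ Sum.inl ∘ s2, hiso _ _ h T5 hT5, fun f hf => ?_, ?_⟩
    · refine ⟨h.symm ∘ f, hZT5 ?_, by funext i; simp⟩
      change _ ∈ Z5
      rw [← hD']
      exact (mem_Def_equiv h.symm θ' s' f).2 hf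
    · rintro _ ⟨t, ht, rfl⟩
      exact (mem_Def_equiv h θ _ t).2 (hTF5' ht)

lemma IsoClosed.compl {k : ℕ} {D : DepPred k} (h : IsoClosed D) : IsoClosed (complD D) := by
  intro M N e R hR hN
  refine hR ?_
  convert h N M e.symm _ hN
  ext f
  constructor
  · exact fun hf => ⟨e ∘ f, ⟨f, hf, rfl⟩, by funext i; simp⟩
  · rintro ⟨_, ⟨g, hg, rfl⟩, rfl⟩
    convert hg
    funext i
    simp

/-- A nonempty finite-type union along an increasing sequence is a member of the sequence. -/
lemma exists_biUnion_eq {A : Type} {C : ℕ → Set A} {n : ℕ} (hC : ∀ i, i + 1 < n → C i ⊆ C (i + 1))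
    {Z : Set ℕ} (hZ : Z.Nonempty) (hn : ∀ i ∈ Z, i < n) :
    ∃ i ∈ Z, {x | ∃ z ∈ Z, x ∈ C z} = C i := by
  have hmono : ∀ i j, i ≤ j → j < n → C i ⊆ C j := by
    intro i j hij
    induction j, hij using Nat.le_induction with
    | base => exact fun _ => subset_rfl
    | succ j _ ih => exact fun h => (ih (by omega)).trans (hC j h)
  obtain ⟨m, hm, hmax⟩ := Set.exists_max_image Z id
    ((Set.finite_Iio n).subset fun i hi => hn i hi) hZ
  refine ⟨m, hm, Set.Subset.antisymm ?_ fun x hx => ⟨m, hm, hx⟩⟩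
  rintro x ⟨z, hz, hx⟩
  exact hmono z m (hmax z hz) (hn m hm) hx

lemma no_alternating {k : ℕ} {D : DepPred k} (hD : SFOd D) (hD' : SFOd (complD D))
    (h : ∀ n, ∃ C : ℕ → Set (Fin k → ℕ), (∀ i, i + 1 < n → C i ⊆ C (i + 1)) ∧
      ∀ i < n, (D ℕ (C i) ↔ Even i)) : False := by
  classical
  choose C hC hDC using h
  let ar0 : Option Bool → ℕ := fun j => j.elim (k + 1) fun _ => 1
  let P : ∀ n, ∀ j, Set (Fin (ar0 j) → ℕ) := fun n j => match j with
    | none => {t : Fin (k + 1) → ℕ | (fun i : Fin k => t i.castSucc) ∈ C n (t (Fin.last k))}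
    | some true => {t : Fin 1 → ℕ | Odd (t 0) ∧ t 0 < n}
    | some false => {t : Fin 1 → ℕ | Even (t 0) ∧ t 0 < n}
  have happ : ∀ n (x : Fin k → ℕ) (z : ℕ),
      Fin.append x (fun _ : Fin 1 => z) ∈ P n none ↔ x ∈ C n z := by
    intro n x z
    have h1 : Fin.append x (fun _ : Fin 1 => z) (Fin.last k) = z :=
      Fin.append_right x (fun _ : Fin 1 => z) 0
    have h2 : (fun i : Fin k => Fin.append x (fun _ : Fin 1 => z) i.castSucc) = x :=
      funext fun i => Fin.append_left x _ i
    change (fun i : Fin k => Fin.append x (fun _ : Fin 1 => z) i.castSucc) ∈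
      C n (Fin.append x (fun _ : Fin 1 => z) (Fin.last k)) ↔ _
    rw [h1, h2]
  obtain ⟨N, J, π, hπ, hlos⟩ := los (Filter.hyperfilter ℕ) (fun _ => ℕ) fun n => gI (P n)
  have hev : ∀ {p : ℕ → Prop} (m : ℕ), (∀ n, m < n → p n) → ∀ᶠ n in Filter.hyperfilter ℕ, p n := by
    intro p m hp
    refine Filter.mem_hyperfilter_of_finite_compl ((Set.finite_Iic m).subset fun n hn => ?_)
    by_contra h
    exact hn (hp n (by simpa using h))
  have hnon : Nontrivial N := by
    refine ⟨π fun _ => 0, π fun _ => 1, fun h => ?_⟩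
    have := (hlos (.eq 0 1) fun v _ => v).1 h
    exact absurd this.exists (by simp [FSat])
  have hsent : ∀ ψ : FOF (Gsig ar0), IsSentence ψ → (∀ n, ¬ FOTrue ℕ (gI (P n)) ψ) →
      ¬ FOTrue N J ψ := by
    intro ψ hψ hn hN
    have := (hlos ψ fun v _ => v).1 (hN _)
    obtain ⟨n, hn'⟩ := this.exists
    exact hn n ((FOTrue_iff hψ _).2 hn')
  let U : Set N → Set (Fin k → N) := fun Z =>
    {x | ∃ z ∈ Z, Fin.append x (fun _ : Fin 1 => z) ∈ J (ar0 none) (sym ar0 none)}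
  have hOdd : ∀ Z : Set N, Z.Nonempty →
      (∀ z ∈ Z, (fun _ => z) ∈ J 1 (sym ar0 (some true))) → ¬ D N (U Z) := by
    intro Z hZ hZO hDZ
    obtain ⟨ψ, h1, h2⟩ := unionF_fo (S := Gsig ar0) hD (sym ar0 (some true)) (sym ar0 none)
    refine hsent ψ h1 (fun n hn => ?_) ((h2 N hnon J).2 ⟨Z, hZ, hZO, hDZ⟩)
    obtain ⟨Z, hZ, hZO, hDZ⟩ := (h2 ℕ inferInstance _).1 hn
    obtain ⟨i, hi, hUi⟩ := exists_biUnion_eq (hC n) hZ fun i hi => (hZO i hi).2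
    have hU' : {x : Fin k → ℕ | ∃ z ∈ Z, Fin.append x (fun _ : Fin 1 => z) ∈ P n none} = C n i := by
      rw [← hUi]
      ext x
      exact exists_congr fun z => and_congr Iff.rfl (happ n x z)
    replace hDZ := hU' ▸ hDZ
    exact Nat.not_even_iff_odd.2 (hZO i hi).1 ((hDC n i (hZO i hi).2).1 hDZ)
  have hEven : ∀ Z : Set N, Z.Nonempty →
      (∀ z ∈ Z, (fun _ => z) ∈ J 1 (sym ar0 (some false))) → ¬ ¬ D N (U Z) := by
    intro Z hZ hZO hDZ
    obtain ⟨ψ, h1, h2⟩ := unionF_fo (S := Gsig ar0) hD' (sym ar0 (some false)) (sym ar0 none)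
    refine hsent ψ h1 (fun n hn => ?_) ((h2 N hnon J).2 ⟨Z, hZ, hZO, hDZ⟩)
    obtain ⟨Z, hZ, hZO, hDZ⟩ := (h2 ℕ inferInstance _).1 hn
    obtain ⟨i, hi, hUi⟩ := exists_biUnion_eq (hC n) hZ fun i hi => (hZO i hi).2
    have hU' : {x : Fin k → ℕ | ∃ z ∈ Z, Fin.append x (fun _ : Fin 1 => z) ∈ P n none} = C n i := by
      rw [← hUi]
      ext x
      exact exists_congr fun z => and_congr Iff.rfl (happ n x z)
    replace hDZ := hU' ▸ hDZ
    exact hDZ ((hDC n i (hZO i hi).2).2 (hZO i hi).1)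
  have hmemO : ∀ i, Odd i → (fun _ => π fun _ => i) ∈ J 1 (sym ar0 (some true)) := by
    intro i hi
    refine (hlos (.rel (sym ar0 (some true)) fun _ => 0) fun _ _ => i).2 (hev i fun n hn => ?_)
    exact ⟨hi, hn⟩
  have hmemE : ∀ i, Even i → (fun _ => π fun _ => i) ∈ J 1 (sym ar0 (some false)) := by
    intro i hi
    refine (hlos (.rel (sym ar0 (some false)) fun _ => 0) fun _ _ => i).2 (hev i fun n hn => ?_)
    exact ⟨hi, hn⟩
  have hstep : ∀ i (x : Fin k → N),
      Fin.append x (fun _ : Fin 1 => π fun _ => i) ∈ J (ar0 none) (sym ar0 none) →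
      Fin.append x (fun _ : Fin 1 => π fun _ => i + 1) ∈ J (ar0 none) (sym ar0 none) := by
    intro i x hx
    choose x' hx' using fun j => hπ (x j)
    let y : ℕ → ℕ → ℕ → ℕ := fun c v a => if h : v < k then x' ⟨v, h⟩ a else c
    have hy : ∀ c,
        (fun j => π (y c (vk (k + 1) j))) = Fin.append x (fun _ : Fin 1 => π fun _ => c) := by
      intro c
      rw [eq_append fun v => π (y c v)]
      congr 1
      · funext j
        simp [y, vk, hx']
      · funext j
        simp [y]
    have hy' : ∀ c a, (fun j => y c (vk (k + 1) j) a) ∈ P a none ↔ (fun j => x' j a) ∈ C a c := by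
      intro c a
      rw [eq_append fun v => y c v a, ← happ]
      simp [y, vk, Function.const_def]
    rw [← hy] at hx ⊢
    have h1 := (hlos (.rel (sym ar0 none) (vk (k + 1))) (y i)).1 hx
    refine (hlos (.rel (sym ar0 none) (vk (k + 1))) (y (i + 1))).2 ?_
    filter_upwards [h1, hev (p := fun n => i + 1 < n) (i + 1) fun n hn => hn] with a ha han
    exact (hy' _ a).2 (hC a i han ((hy' i a).1 ha))
  have hU : U {z | ∃ i, Odd i ∧ z = π fun _ => i} = U {z | ∃ i, Even i ∧ z = π fun _ => i} := by
    ext x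
    constructor
    · rintro ⟨_, ⟨i, hi, rfl⟩, hx⟩
      exact ⟨_, ⟨i + 1, hi.add_one, rfl⟩, hstep i x hx⟩
    · rintro ⟨_, ⟨i, hi, rfl⟩, hx⟩
      exact ⟨_, ⟨i + 1, hi.add_one, rfl⟩, hstep i x hx⟩
  refine hEven {z | ∃ i, Even i ∧ z = π fun _ => i} ⟨π fun _ => 0, 0, Even.zero, rfl⟩ ?_ ?_
  · rintro _ ⟨i, hi, rfl⟩
    exact hmemE i hi
  · rw [← hU]
    refine hOdd {z | ∃ i, Odd i ∧ z = π fun _ => i} ⟨π fun _ => 1, 1, odd_one, rfl⟩ ?_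
    rintro _ ⟨i, hi, rfl⟩
    exact hmemO i hi

lemma exists_Def_nonempty_nat {k : ℕ} {M : Type} [Infinite M] {R : Set (Fin k → M)}
    (hR : R.Nonempty) {θ : EF} (h : ExAllSem M R θ) : ∃ s : ℕ → ℕ, (Def k θ s).Nonempty := by
  obtain ⟨s, hs⟩ := h
  obtain ⟨f, hf⟩ := hR
  let ν := Infinite.natEmbedding M
  let B : Set M := Set.range f ∪ Set.range s ∪ Set.range ν
  have hBc : Countable B := (((Set.countable_range f).union (Set.countable_range s)).union
    (Set.countable_range ν)).to_subtype
  have hBi : Infinite B := ((Set.infinite_range_of_injective ν.injective).mono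
    Set.subset_union_right).to_subtype
  obtain ⟨e⟩ : Nonempty (B ≃ ℕ) := nonempty_equiv_of_countable
  let s1 : ℕ → B := fun i => ⟨s i, Or.inl (Or.inr ⟨i, rfl⟩)⟩
  let f1 : Fin k → B := fun i => ⟨f i, Or.inl (Or.inl ⟨i, rfl⟩)⟩
  exact ⟨e ∘ s1, e ∘ f1, (mem_Def_equiv e θ s1 f1).2
    ((mem_Def_injection Subtype.val_injective θ s1 f1).1 (hs f hf))⟩

/-- Over infinite models, a dependency that is strongly first order together with its complement
cannot separate relations that agree on all conditions `ExAllSem`. -/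
lemma no_separation {k : ℕ} {D : DepPred k} (hiso : IsoClosed D) (hD : SFOd D)
    (hD' : SFOd (complD D)) {M N : Type} [Infinite M] [Infinite N] {R : Set (Fin k → M)}
    {T : Set (Fin k → N)} (hR : D M R) (hT : ¬ D N T) (hRne : R.Nonempty) (hTne : T.Nonempty)
    (h : ∀ θ, ExAllSem M R θ ↔ ExAllSem N T θ) : False := by
  have key : ∀ n : ℕ, ∃ θ, ExAllSem M R θ ∧ ∀ s : ℕ → ℕ, (Def k θ s).Nonempty →
      ∃ C : ℕ → Set (Fin k → ℕ), Def k θ s ⊆ C 0 ∧ (∀ i, i + 1 < n → C i ⊆ C (i + 1)) ∧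
        ∀ i < n, (D ℕ (C i) ↔ Even (n + i)) := by
    intro n
    induction n with
    | zero =>
      refine ⟨TS.top, ⟨fun _ => Classical.arbitrary M, fun _ _ => rfl⟩, fun s _ =>
        ⟨fun _ => Def k TS.top s, subset_rfl, by omega, by omega⟩⟩
    | succ n ih =>
      obtain ⟨θ, hθ, hC⟩ := ih
      have step : ∃ θ', ExAllSem M R θ' ∧ ∀ s' : ℕ → ℕ, (Def k θ' s').Nonempty →
          ∃ (T : Set (Fin k → ℕ)) (s : ℕ → ℕ), (D ℕ T ↔ Even (n + 1)) ∧ Def k θ' s' ⊆ T ∧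
            T ⊆ Def k θ s := by
        by_cases hn : Even (n + 1)
        · obtain ⟨θ', h1, h2⟩ := exists_refinement hiso hD hR hRne hθ
          refine ⟨θ', h1, fun s' hs' => ?_⟩
          obtain ⟨T, s, hT, h3⟩ := h2 s' hs'
          exact ⟨T, s, iff_of_true hT hn, h3⟩
        · obtain ⟨θ', h1, h2⟩ := exists_refinement hiso.compl hD' hT hTne ((h θ).1 hθ)
          refine ⟨θ', (h θ').2 h1, fun s' hs' => ?_⟩
          obtain ⟨T, s, hT, h3⟩ := h2 s' hs'
          exact ⟨T, s, iff_of_false hT hn, h3⟩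
      obtain ⟨θ', h1, h2⟩ := step
      refine ⟨θ', h1, fun s' hs' => ?_⟩
      obtain ⟨T, s, hT, hθT, hTθ⟩ := h2 s' hs'
      obtain ⟨C, hC0, hC1, hC2⟩ := hC s (hs'.mono (hθT.trans hTθ))
      refine ⟨fun i => Nat.casesOn i T C, hθT, fun i hi => ?_, fun i hi => ?_⟩
      · cases i with
        | zero => exact hTθ.trans hC0
        | succ i => exact hC1 i (by omega)
      · cases i with
        | zero => exact hT
        | succ i =>
          refine (hC2 i (by omega)).trans ?_
          rw [show n + 1 + (i + 1) = n + i + 2 by omega]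
          simp [Nat.even_add]
  refine no_alternating hD hD' fun n => ?_
  obtain ⟨θ, hθ, hC⟩ := key (2 * n)
  obtain ⟨s, hs⟩ := exists_Def_nonempty_nat hRne hθ
  obtain ⟨C, -, hC1, hC2⟩ := hC s hs
  exact ⟨C, fun i hi => hC1 i (by omega), fun i hi => (hC2 i (by omega)).trans (by
    simp [Nat.even_add])⟩

/-! ### Compactness and the first normal form -/

/-- `D` is a finite disjunction of conjunctions of sentences over the empty signature, conditions
`ExAllSem` and negated conditions `ExAllSem`. -/
def HasBasicForm {k : ℕ} (D : DepPred k) : Prop :=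
  ∃ L : List (EF × List EF × List EF), (∀ d ∈ L, IsSentence d.1) ∧
    ∀ M : Type, Nontrivial M → ∀ R : Set (Fin k → M), (D M R ↔ ∃ d ∈ L,
      FOTrue M (eI M) d.1 ∧ (∀ θ ∈ d.2.1, ExAllSem M R θ) ∧ ∀ ξ ∈ d.2.2, ¬ ExAllSem M R ξ)

lemma fv_bigAnd {l : List (TS S ι ar)} (h : ∀ φ ∈ l, IsSentence φ) :
    fv (bigAnd l) ⊆ {0} := by
  induction l with
  | nil => simp [bigAnd, TS.top, fv]
  | cons a l ih =>
    change fv a ∪ fv (bigAnd l) ⊆ _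
    rw [show fv a = ∅ from h a (by simp), Set.empty_union]
    exact ih fun φ hφ => h φ (by simp [hφ])

lemma exists_sentence_conj {l : List EF} (h : ∀ φ ∈ l, IsSentence φ) : ∃ ψ : EF, IsSentence ψ ∧
    ∀ M : Type, Nontrivial M → (FOTrue M (eI M) ψ ↔ ∀ φ ∈ l, FOTrue M (eI M) φ) := by
  have hs : IsSentence (TS.al 0 (bigAnd l)) := by
    change fv (bigAnd l) \ {0} = ∅
    exact Set.sdiff_eq_empty.2 (fv_bigAnd h)
  refine ⟨_, hs, fun M _ => ?_⟩
  have m : M := Classical.arbitrary M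
  rw [FOTrue_iff hs fun _ => m]
  change (∀ x : M, FSat M (eI M) _ (bigAnd l)) ↔ _
  simp only [FSat_bigAnd]
  constructor
  · exact fun H φ hφ => (FOTrue_iff (h φ hφ) _).2 (H m φ hφ)
  · exact fun H x φ hφ => H φ hφ _

/-- `(M, R)` and `(N, T)` agree on all sentences over the empty signature and conditions
`ExAllSem` taken from `W`. -/
def Agree {k : ℕ} (W : Set EF) {M N : Type} (R : Set (Fin k → M)) (T : Set (Fin k → N)) : Prop :=
  (∀ φ ∈ W, IsSentence φ → (FOTrue M (eI M) φ ↔ FOTrue N (eI N) φ)) ∧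
    ∀ θ ∈ W, ExAllSem M R θ ↔ ExAllSem N T θ

open Classical in
lemma hasBasicForm_of_agree {k : ℕ} {D : DepPred k} (W : Finset EF)
    (h : ∀ (M N : Type), Nontrivial M → Nontrivial N → ∀ (R : Set (Fin k → M))
      (T : Set (Fin k → N)), Agree (W : Set EF) R T → D M R → D N T) : HasBasicForm D := by
  let σ : Finset EF → List EF := fun P =>
    (P.filter fun φ => IsSentence φ).toList ++
      ((W \ P).filter fun φ => IsSentence φ).toList.map TS.cneg
  have hσ : ∀ P, ∀ φ ∈ σ P, IsSentence φ := by
    intro P φ hφ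
    simp only [σ, List.mem_append, List.mem_map, Finset.mem_toList, Finset.mem_filter] at hφ
    obtain hφ | ⟨φ, hφ, rfl⟩ := hφ
    · exact hφ.2
    · exact hφ.2
  choose ψ hψ hψ' using fun P => exists_sentence_conj (hσ P)
  have hψ'' : ∀ P ⊆ W, ∀ M : Type, Nontrivial M → (FOTrue M (eI M) (ψ P) ↔
      ∀ φ ∈ W, IsSentence φ → (φ ∈ P ↔ FOTrue M (eI M) φ)) := by
    intro P hP M _
    rw [hψ' P M inferInstance]
    have hneg : ∀ φ : EF, IsSentence φ →
        (FOTrue M (eI M) (TS.cneg φ) ↔ ¬ FOTrue M (eI M) φ) := by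
      intro φ hφ
      have s : ℕ → M := fun _ => Classical.arbitrary M
      rw [FOTrue_iff hφ s, FOTrue_iff (φ := TS.cneg φ) hφ s]
      rfl
    constructor
    · intro H φ hφ hs
      constructor
      · exact fun hφP => H φ (by simp [σ, hφP, hs])
      · intro ht
        by_contra hφP
        exact (hneg φ hs).1 (H (TS.cneg φ) (by simp [σ, hφ, hφP, hs])) ht
    · intro H φ hφ
      simp only [σ, List.mem_append, List.mem_map, Finset.mem_toList, Finset.mem_filter] at hφ
      obtain hφ | ⟨φ, hφ, rfl⟩ := hφ
      · exact (H φ (hP hφ.1) hφ.2).1 hφ.1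
      · rw [Finset.mem_sdiff] at hφ
        exact (hneg φ hφ.2).2 fun ht => hφ.1.2 ((H φ hφ.1.1 hφ.2).2 ht)
  let real : Finset EF × Finset EF → ∀ M : Type, Set (Fin k → M) → Prop := fun p M R =>
    (∀ φ ∈ W, IsSentence φ → (φ ∈ p.1 ↔ FOTrue M (eI M) φ)) ∧ ∀ θ ∈ W, θ ∈ p.2 ↔ ExAllSem M R θ
  let good := (W.powerset ×ˢ W.powerset).filter fun p =>
    ∃ M, Nontrivial M ∧ ∃ R, D M R ∧ real p M R
  refine ⟨good.toList.map fun p => (ψ p.1, p.2.toList, (W \ p.2).toList), ?_, ?_⟩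
  · intro d hd
    obtain ⟨p, -, rfl⟩ := List.mem_map.1 hd
    exact hψ _
  intro M _ R
  have hreal : ∀ p : Finset EF × Finset EF, p.1 ⊆ W → p.2 ⊆ W →
      ((FOTrue M (eI M) (ψ p.1) ∧ (∀ θ ∈ p.2.toList, ExAllSem M R θ) ∧
        ∀ ξ ∈ (W \ p.2).toList, ¬ ExAllSem M R ξ) ↔ real p M R) := by
    intro p hp1 hp2
    rw [hψ'' _ hp1 M inferInstance]
    refine and_congr Iff.rfl ⟨fun H θ hθ => ⟨fun h => H.1 θ (by simpa using h), fun h => ?_⟩,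
      fun H => ⟨fun θ hθ => ?_, fun ξ hξ => ?_⟩⟩
    · by_contra hn
      exact H.2 θ (by simp [hθ, hn]) h
    · rw [Finset.mem_toList] at hθ
      exact (H θ (hp2 hθ)).1 hθ
    · rw [Finset.mem_toList, Finset.mem_sdiff] at hξ
      exact fun h => hξ.2 ((H ξ hξ.1).2 h)
  constructor
  · intro hR
    have hr : real (W.filter fun φ => FOTrue M (eI M) φ, W.filter fun θ => ExAllSem M R θ) M R :=
      ⟨fun φ hφ _ => by simp [hφ], fun θ hθ => by simp [hθ]⟩
    refine ⟨_, List.mem_map.2 ⟨(W.filter fun φ => FOTrue M (eI M) φ,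
      W.filter fun θ => ExAllSem M R θ), ?_, rfl⟩,
      (hreal _ (Finset.filter_subset _ _) (Finset.filter_subset _ _)).2 hr⟩
    rw [Finset.mem_toList]
    refine Finset.mem_filter.2 ⟨?_, M, inferInstance, R, hR, hr⟩
    simp
  · rintro ⟨d, hd, hd'⟩
    obtain ⟨p, hp, rfl⟩ := List.mem_map.1 hd
    rw [Finset.mem_toList] at hp
    obtain ⟨hp, N, _, T, hT, hr⟩ := Finset.mem_filter.1 hp
    rw [Finset.mem_product, Finset.mem_powerset, Finset.mem_powerset] at hp
    have hr' := (hreal p hp.1 hp.2).1 hd'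
    exact h N M inferInstance inferInstance T R ⟨fun φ hφ hs => (hr.1 φ hφ hs).symm.trans
      (hr'.1 φ hφ hs), fun θ hθ => (hr.2 θ hθ).symm.trans (hr'.2 θ hθ)⟩ hT

lemma exists_limit {k : ℕ} {α : Type} (u : Ultrafilter α) (M : α → Type)
    (hM : ∀ a, Nontrivial (M a)) (R : ∀ a, Set (Fin k → M a)) :
    ∃ (N : Type) (T : Set (Fin k → N)), Nontrivial N ∧
      (∀ D : DepPred k, SFOd D → (D N T ↔ ∀ᶠ a in u, D (M a) (R a))) ∧
      (∀ φ : EF, IsSentence φ → (FOTrue N (eI N) φ ↔ ∀ᶠ a in u, FOTrue (M a) (eI (M a)) φ)) ∧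
      ∀ θ, ExAllSem N T θ ↔ ∀ᶠ a in u, ExAllSem (M a) (R a) θ := by
  let ar0 : Unit → ℕ := fun _ => k
  obtain ⟨N, J, π, hπ, hlos⟩ := los u M fun a => gI (ar := ar0) fun _ => R a
  choose c d hcd using fun a => exists_pair_ne (M a)
  have hnon : Nontrivial N := by
    refine ⟨π c, π d, fun h => ?_⟩
    have h1 := (hlos (.eq 0 1) fun v => if v = 0 then c else d).1 (by simpa [FSat] using h)
    obtain ⟨a, ha⟩ := h1.exists
    exact hcd a (by simpa [FSat] using ha)
  have hsent : ∀ ψ : FOF (Gsig ar0), IsSentence ψ → (FOTrue N J ψ ↔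
      ∀ᶠ a in u, FOTrue (M a) (gI (ar := ar0) fun _ => R a) ψ) := by
    intro ψ hψ
    rw [FOTrue_iff hψ fun _ => π c, hlos ψ fun _ => c]
    exact Filter.eventually_congr (Filter.Eventually.of_forall fun a => (FOTrue_iff hψ _).symm)
  refine ⟨N, J k (sym ar0 ()), hnon, fun D hD => ?_, fun φ hφ => ?_, fun θ => ?_⟩
  · obtain ⟨ψ, h1, h2⟩ := holdsF_fo (S := Gsig ar0) hD (sym ar0 ())
    rw [← h2 N hnon J, hsent ψ h1]
    exact Filter.eventually_congr (Filter.Eventually.of_forall fun a => by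
      rw [h2 (M a) (hM a)]; exact iff_of_eq (congrArg _ (gI_sym _ _)))
  · have h1 : IsSentence (embedEF φ : FOF (Gsig ar0)) := by
      rw [IsSentence, fv_embedEF]; exact hφ
    have h2 : ∀ (A : Type) (I : Interp (Gsig ar0) A),
        FOTrue A I (embedEF φ : FOF (Gsig ar0)) ↔ FOTrue A (eI A) φ :=
      fun A I => forall_congr' fun s => FSat_embedEF I φ s
    simpa only [h2] using hsent _ h1
  · obtain ⟨ψ, h1, h2⟩ := exAll_fo (S := Gsig ar0) (sym ar0 ()) θ
    rw [← h2 N hnon J, hsent ψ h1]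
    exact Filter.eventually_congr (Filter.Eventually.of_forall fun a => by
      rw [h2 (M a) (hM a)]; exact iff_of_eq (congrArg (ExAllSem _ · θ) (gI_sym _ _)))

lemma exists_injective_of_agree {k n : ℕ} {M N : Type} [Nontrivial M] [Nontrivial N]
    {R : Set (Fin k → M)} {T : Set (Fin k → N)} (h : Agree Set.univ R T) {f : Fin n → M}
    (hf : Injective f) : ∃ g : Fin n → N, Injective g := by
  obtain ⟨θ, hθ⟩ := exists_eqType_formula n {fun i j => i = j}
  have hs : IsSentence (exs (avars θ).toList θ) := by
    rw [IsSentence, fv_exs]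
    refine Set.sdiff_eq_empty.2 fun v hv => ?_
    simpa using fv_subset_avars θ hv
  have key : ∀ A : Type, Nonempty A → (FOTrue A (eI A) (exs (avars θ).toList θ) ↔
      ∃ s, FSat A (eI A) s θ) := by
    intro A _
    rw [FOTrue_iff hs fun _ => Classical.arbitrary A, FSat_exs]
    constructor
    · rintro ⟨s, -, h⟩
      exact ⟨s, h⟩
    · rintro ⟨s, h⟩
      refine ⟨fun v => if v ∈ (avars θ).toList then s v else Classical.arbitrary A, ?_, ?_⟩
      · intro v hv
        simp [hv]
      · refine (FSat_congr _ θ fun v hv => ?_).1 h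
        have := fv_subset_avars θ hv
        simp_all
  obtain ⟨s, hs⟩ := (key N inferInstance).1 ((h.1 _ trivial hs).1 ((key M inferInstance).2
    ⟨fun v => if hv : v < n then f ⟨v, hv⟩ else Classical.arbitrary M,
      (hθ _ _).2 (by simp [hf.eq_iff])⟩))
  have h1 := (hθ _ _).1 hs
  exact ⟨fun i => s i, fun i j hij => (congrFun (congrFun h1 i) j).mp hij⟩

lemma Agree.symm {k : ℕ} {W : Set EF} {M N : Type} {R : Set (Fin k → M)} {T : Set (Fin k → N)}
    (h : Agree W R T) : Agree W T R :=
  ⟨fun φ hφ hs => (h.1 φ hφ hs).symm, fun θ hθ => (h.2 θ hθ).symm⟩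

lemma Agree.finite {k : ℕ} {M N : Type} [Nontrivial M] [Nontrivial N]
    {R : Set (Fin k → M)} {T : Set (Fin k → N)} (h : Agree Set.univ R T) [Finite M] : Finite N := by
  by_contra hN
  rw [not_finite_iff_infinite] at hN
  obtain ⟨g, hg⟩ := exists_injective_of_agree (n := Nat.card M + 1) h.symm
    (f := fun i => Infinite.natEmbedding N i)
    ((Infinite.natEmbedding N).injective.comp Fin.val_injective)
  have := Nat.card_le_card_of_injective g hg
  simp at this

lemma Agree.card_le {k : ℕ} {M N : Type} [Nontrivial M] [Nontrivial N]
    {R : Set (Fin k → M)} {T : Set (Fin k → N)} (h : Agree Set.univ R T) [Finite M] [Finite N] :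
    Nat.card M ≤ Nat.card N := by
  obtain ⟨g, hg⟩ := exists_injective_of_agree h (Finite.equivFin M).symm.injective
  simpa using Nat.card_le_card_of_injective g hg

lemma exists_image_superset {k : ℕ} {M : Type} [Finite M] [Nonempty M] {R T : Set (Fin k → M)}
    (hT : T.Nonempty) (h : ∀ θ, ExAllSem M R θ → ExAllSem M T θ) :
    ∃ e : M ≃ M, T ⊆ (fun f => e ∘ f) '' R := by
  obtain ⟨s0, n, hkn, hs0⟩ := exists_enum (Set.finite_univ (α := M)) k
  obtain ⟨θ, hθ⟩ := exists_eqType_Def R s0 n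
  have hQ : ∀ x ∉ (∅ : Set M), ∃ i, k ≤ i ∧ i < n ∧ s0 i = x := fun x _ => hs0 x trivial
  have hInv : Inv ∅ R := by
    intro t t' htt ht
    have : t = t' := funext fun i => by simpa using htt.1 i
    rwa [← this]
  have hDef : Def k θ s0 = R := eqType_Def_self hθ hkn hInv hQ fun _ _ _ => rfl
  obtain ⟨s1, hs1⟩ := exAllSem_iff.1 (h θ (exAllSem_iff.2 ⟨s0, hDef.ge⟩))
  have hpat := eqType_Def_pattern hθ (hT.mono hs1)
  choose c hc1 hc2 hc3 using fun x => hs0 x trivial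
  have hinj : Injective fun x => s1 (c x) := by
    intro x y hxy
    rw [← hc3 x, ← hc3 y]
    exact (hpat _ _ (hc1 x) (hc1 y) (hc2 x) (hc2 y)).1 hxy
  let e : M ≃ M := Equiv.ofBijective _ (Finite.injective_iff_bijective.1 hinj)
  have he : ∀ i, k ≤ i → i < n → e (s0 i) = s1 i := fun i hi hin =>
    (hpat _ _ (hc1 _) hi (hc2 _) hin).2 (hc3 _)
  refine ⟨e, fun f hf => ⟨e.symm ∘ f, ?_, by funext i; simp⟩⟩
  rw [← hDef]
  have hf1 := hs1 hf
  rw [hθ] at hf1 ⊢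
  obtain ⟨t, ht, hp⟩ := hf1
  refine ⟨t, ht, fun i j => ?_⟩
  rw [← hp i j]
  have hov : ∀ i : Fin n, overrideFin k f s1 i = e (overrideFin k (e.symm ∘ f) s0 i) := by
    intro i
    by_cases hi : (i : ℕ) < k
    · simp [overrideFin, hi]
    · simp [overrideFin, hi, he i (by omega) i.2]
  rw [hov, hov, e.injective.eq_iff]

lemma exAllSem_equiv {k : ℕ} {M N : Type} (e : M ≃ N) {T : Set (Fin k → N)} {θ : EF} :
    ExAllSem M {f | e ∘ f ∈ T} θ ↔ ExAllSem N T θ := by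
  rw [exAllSem_iff, exAllSem_iff]
  constructor
  · rintro ⟨s, hs⟩
    refine ⟨e ∘ s, fun f hf => ?_⟩
    have : f = e ∘ (e.symm ∘ f) := by funext i; simp
    rw [this] at hf ⊢
    exact (mem_Def_equiv e θ s _).2 (hs hf)
  · rintro ⟨s, hs⟩
    refine ⟨e.symm ∘ s, fun f hf => ?_⟩
    rw [← mem_Def_equiv e]
    have : s = e ∘ (e.symm ∘ s) := by funext i; simp
    rw [← this]
    exact hs hf

lemma IsoClosed.preimage {k : ℕ} {D : DepPred k} (hiso : IsoClosed D) {M N : Type} (e : M ≃ N)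
    {T : Set (Fin k → N)} (h : D M {f | e ∘ f ∈ T}) : D N T := by
  convert hiso M N e _ h
  ext f
  constructor
  · exact fun hf => ⟨e.symm ∘ f, by simpa [← Function.comp_assoc] using hf, by funext i; simp⟩
  · rintro ⟨g, hg, rfl⟩
    exact hg

lemma not_of_agree_finite {k : ℕ} {D : DepPred k} (hiso : IsoClosed D) {M N : Type} [Nontrivial M]
    [Nontrivial N] [Finite M] {R : Set (Fin k → M)} {T : Set (Fin k → N)}
    (h : Agree Set.univ R T) (hR : D M R) : D N T := by
  have := h.finite
  obtain ⟨e⟩ : Nonempty (M ≃ N) := ⟨(Finite.equivFin M).trans ((finCongr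
    (h.card_le.antisymm h.symm.card_le)).trans (Finite.equivFin N).symm)⟩
  refine hiso.preimage e ?_
  have hθ : ∀ θ, ExAllSem M R θ ↔ ExAllSem M {f | e ∘ f ∈ T} θ := fun θ =>
    (h.2 θ trivial).trans (exAllSem_equiv e).symm
  generalize {f | e ∘ f ∈ T} = T' at hθ
  have hemp : R = ∅ ↔ T' = ∅ := by rw [← exAllSem_botF, hθ, exAllSem_botF]
  obtain rfl | hne := R.eq_empty_or_nonempty
  · rwa [hemp.1 rfl]
  have hne' : T'.Nonempty := by
    rw [Set.nonempty_iff_ne_empty, Ne, ← hemp]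
    exact hne.ne_empty
  obtain ⟨e1, h1⟩ := exists_image_superset hne' fun θ => (hθ θ).1
  obtain ⟨e2, h2⟩ := exists_image_superset hne fun θ => (hθ θ).2
  have hcard : ∀ (e : M ≃ M) (A : Set (Fin k → M)), ((fun f => e ∘ f) '' A).ncard = A.ncard :=
    fun e A => Set.ncard_image_of_injective _ fun f g hfg => e.injective.comp_left hfg
  have h3 := Set.ncard_le_ncard h2 (Set.toFinite _)
  rw [hcard] at h3
  rw [Set.eq_of_subset_of_ncard_le h1 (by rwa [hcard]) (Set.toFinite _)]
  exact hiso M M e1 R hR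

lemma SFOd.empty_iff_nat {k : ℕ} {D : DepPred k} (hiso : IsoClosed D) (hD : SFOd D) {M : Type}
    [Infinite M] : D M ∅ → D ℕ ∅ := by
  intro h
  let ar0 : Unit → ℕ := fun _ => k
  obtain ⟨ψ, h1, h2⟩ := holdsF_fo (S := Gsig ar0) hD (sym ar0 ())
  obtain ⟨B, -, hBc, hBi, hB⟩ := ls_down (S := Gsig ar0)
    (gI (ar := ar0) fun _ => (∅ : Set (Fin k → M))) ∅ Set.countable_empty
  have := hBc.to_subtype
  have := hBi.to_subtype
  have hDB : D B ∅ := by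
    have h3 := h2 B inferInstance
      (comap Subtype.val (gI (ar := ar0) fun _ => (∅ : Set (Fin k → M))))
    rw [comap_gI, gI_sym] at h3
    have h4 := h2 M inferInstance (gI (ar := ar0) fun _ => (∅ : Set (Fin k → M)))
    rw [gI_sym] at h4
    refine h3.1 ?_
    have s : ℕ → B := fun _ => Classical.arbitrary B
    rw [FOTrue_iff h1 s, ← comap_gI, hB, ← FOTrue_iff h1]
    exact h4.2 h
  obtain ⟨e⟩ : Nonempty (B ≃ ℕ) := nonempty_equiv_of_countable
  simpa using hiso B ℕ e ∅ hDB

lemma of_agree {k : ℕ} {D : DepPred k} (hiso : IsoClosed D) (hD : SFOd D)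
    (hD' : SFOd (complD D)) {M N : Type} [Nontrivial M] [Nontrivial N] {R : Set (Fin k → M)}
    {T : Set (Fin k → N)} (h : Agree Set.univ R T) (hR : D M R) : D N T := by
  cases finite_or_infinite M
  · exact not_of_agree_finite hiso h hR
  have hN : Infinite N := by
    rw [← not_finite_iff_infinite]
    exact fun hN => (not_finite_iff_infinite.2 inferInstance : ¬ Finite M) h.symm.finite
  by_contra hT
  have hemp : R = ∅ ↔ T = ∅ := by rw [← exAllSem_botF, h.2 _ trivial, exAllSem_botF]
  obtain rfl | hne := R.eq_empty_or_nonempty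
  · rw [hemp.1 rfl] at hT
    exact hD'.empty_iff_nat hiso.compl hT (hD.empty_iff_nat hiso hR)
  · refine no_separation hiso hD hD' hR hT hne ?_ fun θ => h.2 θ trivial
    rw [Set.nonempty_iff_ne_empty, Ne, ← hemp]
    exact hne.ne_empty

theorem hasBasicForm_of_sfo {k : ℕ} {D : DepPred k} (hiso : IsoClosed D) (hD : SFOd D)
    (hD' : SFOd (complD D)) : HasBasicForm D := by
  by_contra hno
  have h1 : ∀ W : Finset EF, ∃ (M N : Type) (R : Set (Fin k → M)) (T : Set (Fin k → N)),
      Nontrivial M ∧ Nontrivial N ∧ Agree (W : Set EF) R T ∧ D M R ∧ ¬ D N T := by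
    intro W
    by_contra hW
    push Not at hW
    exact hno (hasBasicForm_of_agree W fun M N hM hN R T h hR => hW M N R T hM hN h hR)
  choose M N R T hM hN hA hR hT using h1
  let u := Ultrafilter.of (Filter.atTop : Filter (Finset EF))
  have hu : ∀ φ : EF, ∀ᶠ W : Finset EF in u, φ ∈ W := fun φ =>
    Ultrafilter.of_le _ ((Filter.eventually_ge_atTop {φ}).mono fun W hW =>
      Finset.singleton_subset_iff.1 hW)
  obtain ⟨M', R', hM', a1, a2, a3⟩ := exists_limit u M hM R
  obtain ⟨N', T', hN', b1, b2, b3⟩ := exists_limit u N hN T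
  have hag : Agree Set.univ R' T' := by
    refine ⟨fun φ _ hφ => ?_, fun θ _ => ?_⟩
    · rw [a2 φ hφ, b2 φ hφ]
      exact Filter.eventually_congr ((hu φ).mono fun W hW => (hA W).1 φ hW hφ)
    · rw [a3, b3]
      exact Filter.eventually_congr ((hu θ).mono fun W hW => (hA W).2 θ hW)
  have hRD : D M' R' := (a1 D hD).2 (Filter.Eventually.of_forall hR)
  obtain ⟨W, hW⟩ := ((b1 D hD).1 (of_agree hiso hD hD' hag hRD)).exists
  exact hT W hW

/-! ### First-order definable predicates -/

/-- Renaming of all variables, free and bound. -/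
def TS.rename (ρ : ℕ → ℕ) : TS S ι ar → TS S ι ar
  | .rel r v => .rel r (ρ ∘ v)
  | .nrel r v => .nrel r (ρ ∘ v)
  | .eq x y => .eq (ρ x) (ρ y)
  | .neq x y => .neq (ρ x) (ρ y)
  | .dep i v => .dep i (ρ ∘ v)
  | .and φ ψ => .and (φ.rename ρ) (ψ.rename ρ)
  | .or φ ψ => .or (φ.rename ρ) (ψ.rename ρ)
  | .gdisj φ ψ => .gdisj (φ.rename ρ) (ψ.rename ρ)
  | .cneg φ => .cneg (φ.rename ρ)
  | .ex v φ => .ex (ρ v) (φ.rename ρ)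
  | .al v φ => .al (ρ v) (φ.rename ρ)

lemma FSat_rename {M : Type} {I : Interp S M} {ρ : ℕ → ℕ} (hρ : Injective ρ) (φ : TS S ι ar) :
    ∀ s : ℕ → M, FSat M I s (φ.rename ρ) ↔ FSat M I (s ∘ ρ) φ := by
  have hu : ∀ (s : ℕ → M) v m, update s (ρ v) m ∘ ρ = update (s ∘ ρ) v m := fun s v m =>
    update_comp_eq_of_injective s hρ v m
  induction φ with
  | and φ ψ h1 h2 => exact fun s => and_congr (h1 s) (h2 s)
  | or φ ψ h1 h2 => exact fun s => or_congr (h1 s) (h2 s)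
  | gdisj φ ψ h1 h2 => exact fun s => or_congr (h1 s) (h2 s)
  | cneg φ h => exact fun s => not_congr (h s)
  | ex v φ h => exact fun s => exists_congr fun m => by rw [h, hu]
  | al v φ h => exact fun s => forall_congr' fun m => by rw [h, hu]
  | _ => exact fun s => Iff.rfl

/-- Predicates of assignments `τ → M` that are uniformly first-order definable over all models
with at least two elements. -/
def FD {τ : Type} (P : ∀ M : Type, Interp S M → (τ → M) → Prop) : Prop :=
  ∃ (φ : FOF S) (c : ℕ → τ), ∀ M : Type, Nontrivial M → ∀ I a, P M I a ↔ FSat M I (a ∘ c) φ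

section FD

variable {τ σ : Type} {P Q : ∀ M : Type, Interp S M → (τ → M) → Prop}

lemma FD.comap (h : FD P) (g : τ → σ) : FD fun M I (a : σ → M) => P M I (a ∘ g) := by
  obtain ⟨φ, c, h⟩ := h
  exact ⟨φ, g ∘ c, fun M _ I a => h M inferInstance I _⟩

lemma FD.not (h : FD P) : FD fun M I a => ¬ P M I a := by
  obtain ⟨φ, c, h⟩ := h
  exact ⟨.cneg φ, c, fun M _ I a => not_congr (h M inferInstance I _)⟩

lemma FD.congr (h : FD P) (hPQ : ∀ M : Type, Nontrivial M → ∀ I a, P M I a ↔ Q M I a) : FD Q := by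
  obtain ⟨φ, c, h⟩ := h
  exact ⟨φ, c, fun M hM I a => (hPQ M hM I a).symm.trans (h M hM I a)⟩

lemma FD.and (hP : FD P) (hQ : FD Q) : FD fun M I a => P M I a ∧ Q M I a := by
  obtain ⟨φ, c, hP⟩ := hP
  obtain ⟨ψ, d, hQ⟩ := hQ
  refine ⟨.and (φ.rename fun n => 2 * n) (ψ.rename fun n => 2 * n + 1),
    fun n => if n % 2 = 0 then c (n / 2) else d (n / 2), fun M _ I a => ?_⟩
  refine and_congr ((hP M inferInstance I a).trans ?_) ((hQ M inferInstance I a).trans ?_)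
  · rw [FSat_rename fun m n h => by simpa using h]
    refine iff_of_eq (congrArg (FSat M I · φ) (funext fun n => ?_))
    simp
  · rw [FSat_rename fun m n h => by simpa using h]
    refine iff_of_eq (congrArg (FSat M I · ψ) (funext fun n => ?_))
    have h1 : (2 * n + 1) % 2 = 1 := by omega
    have h2 : (2 * n + 1) / 2 = n := by omega
    simp [h1, h2]

lemma FD.or (hP : FD P) (hQ : FD Q) : FD fun M I a => P M I a ∨ Q M I a :=
  (hP.not.and hQ.not).not.congr fun M _ I a => by tauto

lemma FD.imp (hP : FD P) (hQ : FD Q) : FD fun M I a => P M I a → Q M I a :=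
  (hP.not.or hQ).congr fun M _ I a => by tauto

lemma FD.eq (i j : τ) : FD fun M (_ : Interp S M) a => a i = a j :=
  ⟨.eq 0 1, fun n => if n = 0 then i else j, fun M _ I a => by simp [FSat]⟩

lemma FD.sentence [Nonempty τ] {φ : FOF S} (hφ : IsSentence φ) :
    FD fun M I (_ : τ → M) => FOTrue M I φ :=
  ⟨φ, fun _ => Classical.arbitrary τ, fun _ _ _ _ => FOTrue_iff hφ _⟩

lemma FD.true [Nonempty τ] : FD fun M (_ : Interp S M) (_ : τ → M) => True :=
  ⟨.eq 0 0, fun _ => Classical.arbitrary τ, fun _ _ _ _ => by simp [FSat]⟩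

lemma FD.false [Nonempty τ] : FD fun M (_ : Interp S M) (_ : τ → M) => False :=
  FD.true.not.congr fun _ _ _ _ => by simp

lemma FD.forall_fin [Nonempty τ] {k : ℕ} {P : Fin k → ∀ M : Type, Interp S M → (τ → M) → Prop}
    (h : ∀ i, FD (P i)) : FD fun M I a => ∀ i, P i M I a := by
  induction k with
  | zero => exact FD.true.congr fun _ _ _ _ => by simp
  | succ k ih =>
    exact ((h 0).and (ih fun i => h i.succ)).congr fun M _ I a =>
      (Fin.forall_fin_succ (P := fun i => P i M I a)).symm

lemma FD.embedEF {φ : EF} {c : ℕ → τ} : FD fun M (_ : Interp S M) a => FSat M (eI M) (a ∘ c) φ :=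
  ⟨DSFO.embedEF φ, c, fun _ _ I _ => (FSat_embedEF I φ _).symm⟩

lemma FD.of_empty_signature {P : ∀ M : Type, Interp Sig0 M → (τ → M) → Prop} (h : FD P) :
    FD fun M (_ : Interp S M) a => P M (eI M) a := by
  obtain ⟨φ, c, h⟩ := h
  exact FD.embedEF.congr fun M _ I a => (h M inferInstance (eI M) a).symm

/-- Conjunction of a formula with a list of equations. -/
def andEqs (l : List (ℕ × ℕ)) (φ : TS S ι ar) : TS S ι ar :=
  l.foldr (fun p ψ => .and (.eq p.1 p.2) ψ) φ

lemma FSat_andEqs {M : Type} {I : Interp S M} {s : ℕ → M} (l : List (ℕ × ℕ)) (φ : TS S ι ar) :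
    FSat M I s (andEqs l φ) ↔ (∀ p ∈ l, s p.1 = s p.2) ∧ FSat M I s φ := by
  induction l with
  | nil => simp [andEqs]
  | cons p l ih =>
    change s p.1 = s p.2 ∧ FSat M I s (andEqs l φ) ↔ _
    rw [ih, List.forall_mem_cons, and_assoc]

lemma fv_andEqs (l : List (ℕ × ℕ)) (φ : TS S ι ar) {V : Set ℕ} (hl : ∀ p ∈ l, p.1 ∈ V ∧ p.2 ∈ V)
    (hφ : fv φ ⊆ V) : fv (andEqs l φ) ⊆ V := by
  induction l with
  | nil => exact hφ
  | cons p l ih =>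
    rw [List.forall_mem_cons] at hl
    refine Set.union_subset ?_ (ih hl.2)
    rintro v (rfl | rfl)
    exacts [hl.1.1, hl.1.2]

open Classical in
lemma exists_block (φ : FOF S) (c : ℕ → τ ⊕ σ) : ∃ χ : FOF S,
    (∀ v ∈ fv χ, ∃ t, c v = .inl t) ∧ ∀ (M : Type), Nontrivial M → ∀ I (s : ℕ → M) (a : τ → M),
      (∀ v t, c v = .inl t → s v = a t) →
        (FSat M I s χ ↔ ∃ b : σ → M, FSat M I (Sum.elim a b ∘ c) φ) := by
  let l := ((avars φ).filter fun v => ∃ t, c v = .inr t).toList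
  let E := (l ×ˢ l).filter fun p => c p.1 = c p.2
  have hl : ∀ v, v ∈ l ↔ v ∈ avars φ ∧ ∃ t, c v = .inr t := by simp [l]
  have hE : ∀ p, p ∈ E ↔ (p.1 ∈ l ∧ p.2 ∈ l) ∧ c p.1 = c p.2 := by
    intro p
    rw [List.mem_filter, decide_eq_true_eq]
    exact and_congr List.pair_mem_product Iff.rfl
  refine ⟨exs l (andEqs E φ), fun v hv => ?_, fun M _ I s a hs => ?_⟩
  · rw [fv_exs] at hv
    have h1 := fv_andEqs E φ (V := (avars φ : Set ℕ)) (fun p hp => ⟨((hl _).1 ((hE p).1 hp).1.1).1,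
      ((hl _).1 ((hE p).1 hp).1.2).1⟩) (fv_subset_avars φ) hv.1
    have h2 := hv.2
    rw [Set.mem_ofPred_eq, hl] at h2
    cases h : c v with
    | inl t => exact ⟨t, rfl⟩
    | inr t => exact absurd ⟨h1, t, h⟩ h2
  · rw [FSat_exs]
    constructor
    · rintro ⟨s', h1, h2⟩
      rw [FSat_andEqs] at h2
      refine ⟨fun t => if h : ∃ v ∈ l, c v = .inr t then s' h.choose else Classical.arbitrary M,
        (FSat_congr I φ fun v hv => ?_).1 h2.2⟩
      have hv := fv_subset_avars φ hv
      cases h : c v with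
      | inl t =>
        have hvl : v ∉ l := by simp [hl, h]
        simp [h, h1 v hvl, hs v t h]
      | inr t =>
        have hvl : v ∈ l := (hl v).2 ⟨hv, t, h⟩
        have ht : ∃ v ∈ l, c v = .inr t := ⟨v, hvl, h⟩
        simp only [comp_apply, h, Sum.elim_inr, dif_pos ht]
        exact h2.1 (v, ht.choose) ((hE _).2 ⟨⟨hvl, ht.choose_spec.1⟩,
          h.trans ht.choose_spec.2.symm⟩)
    · rintro ⟨b, hb⟩
      refine ⟨fun v => if v ∈ l then Sum.elim a b (c v) else s v, fun v hv => by simp [hv], ?_⟩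
      rw [FSat_andEqs]
      refine ⟨fun p hp => ?_, (FSat_congr I φ fun v hv => ?_).1 hb⟩
      · obtain ⟨⟨h1, h2⟩, h3⟩ := (hE p).1 hp
        simp [h1, h2, h3]
      · by_cases hvl : v ∈ l
        · simp [hvl]
        · have hv := fv_subset_avars φ hv
          cases h : c v with
          | inl t => simp [hvl, h, hs v t h]
          | inr t => exact absurd ((hl v).2 ⟨hv, t, h⟩) hvl

lemma FD.exists [Nonempty τ] {P : ∀ M : Type, Interp S M → (τ ⊕ σ → M) → Prop} (h : FD P) :
    FD fun M I (a : τ → M) => ∃ b : σ → M, P M I (Sum.elim a b) := by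
  obtain ⟨φ, c, h⟩ := h
  obtain ⟨χ, -, hχ⟩ := exists_block φ c
  refine ⟨χ, fun v => Sum.elim id (fun _ => Classical.arbitrary τ) (c v), fun M _ I a => ?_⟩
  rw [hχ M inferInstance I _ a fun v t hv => by simp [hv]]
  exact exists_congr fun b => h M inferInstance I _

lemma FD.exists_update {P : ∀ M : Type, Interp S M → (ℕ → M) → (τ → M) → Prop}
    (h : FD fun M I (a : ℕ ⊕ τ → M) => P M I (a ∘ .inl) (a ∘ .inr)) (v : ℕ) :
    FD fun M I (a : ℕ ⊕ τ → M) => ∃ m, P M I (update (a ∘ .inl) v m) (a ∘ .inr) := by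
  refine (h.comap (Sum.elim (fun n => if n = v then .inr () else .inl (.inl n))
    fun t => (.inl (.inr t) : (ℕ ⊕ τ) ⊕ Unit))).exists.congr fun M _ I a => ?_
  have key : ∀ b : Unit → M, (fun n => Sum.elim a b
      (if n = v then .inr () else .inl (.inl n))) = update (a ∘ .inl) v (b ()) := by
    intro b
    funext n
    by_cases hn : n = v
    · subst hn
      simp
    · simp [hn]
  have key' : ∀ b : Unit → M, P M I (fun n => Sum.elim a b
      (if n = v then .inr () else .inl (.inl n))) (a ∘ .inr) ↔
      P M I (update (a ∘ .inl) v (b ())) (a ∘ .inr) := fun b => by rw [key]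
  exact (exists_congr key').trans ⟨fun ⟨b, hb⟩ => ⟨b (), hb⟩, fun ⟨m, hm⟩ => ⟨fun _ => m, hm⟩⟩

lemma FD.exists_sentence (h : FD P) : ∃ ψ : FOF S, IsSentence ψ ∧
    ∀ M : Type, Nontrivial M → ∀ I, FOTrue M I ψ ↔ ∃ a, P M I a := by
  obtain ⟨φ, c, h⟩ := h
  obtain ⟨χ, h1, hχ⟩ := exists_block (τ := Empty) φ fun v => .inr (c v)
  have hs : IsSentence χ := Set.eq_empty_iff_forall_notMem.2 fun v hv => by
    obtain ⟨t, -⟩ := h1 v hv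
    exact t.elim
  refine ⟨χ, hs, fun M _ I => ?_⟩
  rw [FOTrue_iff hs fun _ => Classical.arbitrary M, hχ M inferInstance I _ Empty.elim (by simp)]
  exact exists_congr fun b => (h M inferInstance I b).symm

end FD

/-! ### A normal form for team properties -/

/-- Team properties of the form `∃ p, (∀ s ∈ X, θ(s, p)) ∧ ∀ q, ω(p, q) ∨ ∃ s ∈ X, χ(s, p, q)` for
first-order definable `θ`, `ω`, `χ`. -/
def NF (P : ∀ M : Type, Interp S M → Set (ℕ → M) → Prop) : Prop :=
  ∃ (A K : Type) (θ : ∀ M : Type, Interp S M → (ℕ → M) → (A → M) → Prop)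
    (ω : ∀ M : Type, Interp S M → (A → M) → (K → M) → Prop)
    (χ : ∀ M : Type, Interp S M → (ℕ → M) → (A → M) → (K → M) → Prop),
    Nonempty A ∧
    FD (fun M I (a : ℕ ⊕ A → M) => θ M I (a ∘ Sum.inl) (a ∘ Sum.inr)) ∧
    FD (fun M I (a : A ⊕ K → M) => ω M I (a ∘ Sum.inl) (a ∘ Sum.inr)) ∧
    FD (fun M I (a : ℕ ⊕ A ⊕ K → M) =>
      χ M I (a ∘ Sum.inl) (a ∘ Sum.inr ∘ Sum.inl) (a ∘ Sum.inr ∘ Sum.inr)) ∧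
    ∀ M : Type, Nontrivial M → ∀ I X, P M I X ↔
      ∃ p, (∀ s ∈ X, θ M I s p) ∧ ∀ q, ω M I p q ∨ ∃ s ∈ X, χ M I s p q

section NF

open Sum (inl inr)

variable {P Q : ∀ M : Type, Interp S M → Set (ℕ → M) → Prop}

lemma NF.congr (h : NF P) (hPQ : ∀ M : Type, Nontrivial M → ∀ I X, P M I X ↔ Q M I X) : NF Q := by
  obtain ⟨A, K, θ, ω, χ, hA, h1, h2, h3, h4⟩ := h
  exact ⟨A, K, θ, ω, χ, hA, h1, h2, h3, fun M hM I X => (hPQ M hM I X).symm.trans (h4 M hM I X)⟩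

lemma exists_selector {M : Type} [Nontrivial M] (c : Prop) :
    ∃ b : Bool → M, b true = b false ↔ c := by
  obtain ⟨x, y, h⟩ := exists_pair_ne M
  by_cases hc : c
  · exact ⟨fun _ => x, by simp [hc]⟩
  · exact ⟨fun b => if b then x else y, by simp [hc, h]⟩

/-- A team property obtained from two normal forms by combining their universal parts pointwise and
restricting their existential parts to subteams. -/
lemma NF.combine {A B K L : Type} [Nonempty A]
    {θ : ∀ M : Type, Interp S M → (ℕ → M) → (A → M) → (B → M) → Prop}
    {ω : ∀ M : Type, Interp S M → (A → M) → (K → M) → Prop}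
    {χ : ∀ M : Type, Interp S M → (ℕ → M) → (A → M) → (K → M) → Prop}
    {ω' : ∀ M : Type, Interp S M → (B → M) → (L → M) → Prop}
    {χ' : ∀ M : Type, Interp S M → (ℕ → M) → (B → M) → (L → M) → Prop}
    (h1 : FD fun M I (a : ℕ ⊕ A ⊕ B → M) => θ M I (a ∘ inl) (a ∘ inr ∘ inl) (a ∘ inr ∘ inr))
    (h2 : FD fun M I (a : A ⊕ K → M) => ω M I (a ∘ inl) (a ∘ inr))
    (h3 : FD fun M I (a : ℕ ⊕ A ⊕ K → M) => χ M I (a ∘ inl) (a ∘ inr ∘ inl) (a ∘ inr ∘ inr))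
    (h4 : FD fun M I (a : B ⊕ L → M) => ω' M I (a ∘ inl) (a ∘ inr))
    (h5 : FD fun M I (a : ℕ ⊕ B ⊕ L → M) => χ' M I (a ∘ inl) (a ∘ inr ∘ inl) (a ∘ inr ∘ inr)) :
    NF fun M I X => ∃ p p', (∀ s ∈ X, θ M I s p p') ∧ (∀ q, ω M I p q ∨ ∃ s ∈ X, χ M I s p q) ∧
      ∀ q, ω' M I p' q ∨ ∃ s ∈ X, χ' M I s p' q := by
  refine ⟨A ⊕ B, (K ⊕ L) ⊕ Bool, fun M I s p => θ M I s (p ∘ inl) (p ∘ inr),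
    fun M I p q => (q (inr true) = q (inr false) ∧ ω M I (p ∘ inl) (q ∘ inl ∘ inl)) ∨
      (¬ q (inr true) = q (inr false) ∧ ω' M I (p ∘ inr) (q ∘ inl ∘ inr)),
    fun M I s p q => (q (inr true) = q (inr false) ∧ χ M I s (p ∘ inl) (q ∘ inl ∘ inl)) ∨
      (¬ q (inr true) = q (inr false) ∧ χ' M I s (p ∘ inr) (q ∘ inl ∘ inr)),
    inferInstance, h1, ?_, ?_, fun M _ I X => ?_⟩
  · exact ((FD.eq (inr (inr true)) (inr (inr false))).and
      (h2.comap (Sum.map inl (inl ∘ inl)))).or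
      ((FD.eq (inr (inr true)) (inr (inr false))).not.and
      (h4.comap (Sum.map inr (inl ∘ inr))))
  · exact ((FD.eq (inr (inr (inr true))) (inr (inr (inr false)))).and
      (h3.comap (Sum.map id (Sum.map inl (inl ∘ inl))))).or
      ((FD.eq (inr (inr (inr true))) (inr (inr (inr false)))).not.and
      (h5.comap (Sum.map id (Sum.map inr (inl ∘ inr)))))
  · constructor
    · rintro ⟨p, p', g1, g2, g3⟩
      refine ⟨Sum.elim p p', g1, fun q => ?_⟩
      by_cases hq : q (inr true) = q (inr false)
      · simpa [hq] using g2 (q ∘ inl ∘ inl)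
      · simpa [hq] using g3 (q ∘ inl ∘ inr)
    · rintro ⟨p, g1, g2⟩
      obtain ⟨x⟩ : Nonempty M := inferInstance
      refine ⟨p ∘ inl, p ∘ inr, g1, fun q => ?_, fun q => ?_⟩
      · obtain ⟨b, hb⟩ := exists_selector (M := M) True
        simpa [hb, ← Function.comp_assoc] using g2 (Sum.elim (Sum.elim q fun _ => x) b)
      · obtain ⟨b, hb⟩ := exists_selector (M := M) False
        simpa [hb, ← Function.comp_assoc] using g2 (Sum.elim (Sum.elim (fun _ => x) q) b)

lemma NF.and (hP : NF P) (hQ : NF Q) : NF fun M I X => P M I X ∧ Q M I X := by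
  obtain ⟨A, K, θ, ω, χ, hA, h1, h2, h3, h4⟩ := hP
  obtain ⟨B, L, θ', ω', χ', hB, h1', h2', h3', h4'⟩ := hQ
  refine (NF.combine (θ := fun M I s p p' => θ M I s p ∧ θ' M I s p')
    ((h1.comap (Sum.map id inl)).and (h1'.comap (Sum.map id inr))) h2 h3 h2' h3').congr
    fun M hM I X => ?_
  rw [h4 M hM, h4' M hM]
  constructor
  · rintro ⟨p, p', g1, g2, g3⟩
    exact ⟨⟨p, fun s hs => (g1 s hs).1, g2⟩, p', fun s hs => (g1 s hs).2, g3⟩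
  · rintro ⟨⟨p, g1, g2⟩, p', g1', g3⟩
    exact ⟨p, p', fun s hs => ⟨g1 s hs, g1' s hs⟩, g2, g3⟩

lemma NF.split (hP : NF P) (hQ : NF Q) :
    NF fun M I X => ∃ Y Z, Y ∪ Z = X ∧ P M I Y ∧ Q M I Z := by
  obtain ⟨A, K, θ, ω, χ, hA, h1, h2, h3, h4⟩ := hP
  obtain ⟨B, L, θ', ω', χ', hB, h1', h2', h3', h4'⟩ := hQ
  refine (NF.combine (θ := fun M I s p p' => θ M I s p ∨ θ' M I s p')
    (χ := fun M I s p q => θ M I s p ∧ χ M I s p q)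
    (χ' := fun M I s p q => θ' M I s p ∧ χ' M I s p q)
    ((h1.comap (Sum.map id inl)).or (h1'.comap (Sum.map id inr)))
    h2 ((h1.comap (Sum.map id inl)).and h3) h2' ((h1'.comap (Sum.map id inl)).and h3')).congr
    fun M hM I X => ?_
  simp only [h4 M hM, h4' M hM]
  constructor
  · rintro ⟨p, p', g1, g2, g3⟩
    refine ⟨{s | s ∈ X ∧ θ M I s p}, {s | s ∈ X ∧ θ' M I s p'}, ?_, ⟨p, fun s hs => hs.2, ?_⟩,
      p', fun s hs => hs.2, ?_⟩
    · ext s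
      exact ⟨fun h => h.elim And.left And.left, fun h => (g1 s h).imp (⟨h, ·⟩) (⟨h, ·⟩)⟩
    · exact fun q => (g2 q).imp_right fun ⟨s, hs, ht, hc⟩ => ⟨s, ⟨hs, ht⟩, hc⟩
    · exact fun q => (g3 q).imp_right fun ⟨s, hs, ht, hc⟩ => ⟨s, ⟨hs, ht⟩, hc⟩
  · rintro ⟨Y, Z, rfl, ⟨p, g1, g2⟩, p', g1', g3⟩
    exact ⟨p, p', fun s hs => hs.imp (g1 s) (g1' s),
      fun q => (g2 q).imp_right fun ⟨s, hs, hc⟩ => ⟨s, .inl hs, g1 s hs, hc⟩,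
      fun q => (g3 q).imp_right fun ⟨s, hs, hc⟩ => ⟨s, .inr hs, g1' s hs, hc⟩⟩

lemma NF.gdisj (hP : NF P) (hQ : NF Q) : NF fun M I X => P M I X ∨ Q M I X := by
  obtain ⟨A, K, θ, ω, χ, hA, h1, h2, h3, h4⟩ := hP
  obtain ⟨B, L, θ', ω', χ', hB, h1', h2', h3', h4'⟩ := hQ
  let i : Bool → (A ⊕ B) ⊕ Bool := inr
  refine ⟨(A ⊕ B) ⊕ Bool, K ⊕ L,
    fun M I s p => (p (i true) = p (i false) → θ M I s (p ∘ inl ∘ inl)) ∧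
      (¬ p (i true) = p (i false) → θ' M I s (p ∘ inl ∘ inr)),
    fun M I p q => (p (i true) = p (i false) ∧ ω M I (p ∘ inl ∘ inl) (q ∘ inl)) ∨
      (¬ p (i true) = p (i false) ∧ ω' M I (p ∘ inl ∘ inr) (q ∘ inr)),
    fun M I s p q => (p (i true) = p (i false) ∧ χ M I s (p ∘ inl ∘ inl) (q ∘ inl)) ∨
      (¬ p (i true) = p (i false) ∧ χ' M I s (p ∘ inl ∘ inr) (q ∘ inr)),
    inferInstance, ?_, ?_, ?_, fun M hM I X => ?_⟩
  · exact ((FD.eq (inr (i true)) (inr (i false))).imp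
      (h1.comap (Sum.map id (inl ∘ inl)))).and
      ((FD.eq (inr (i true)) (inr (i false))).not.imp (h1'.comap (Sum.map id (inl ∘ inr))))
  · exact ((FD.eq (inl (i true)) (inl (i false))).and
      (h2.comap (Sum.map (inl ∘ inl) inl))).or
      ((FD.eq (inl (i true)) (inl (i false))).not.and (h2'.comap (Sum.map (inl ∘ inr) inr)))
  · exact ((FD.eq (inr (inl (i true))) (inr (inl (i false)))).and
      (h3.comap (Sum.map id (Sum.map (inl ∘ inl) inl)))).or
      ((FD.eq (inr (inl (i true))) (inr (inl (i false)))).not.and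
      (h3'.comap (Sum.map id (Sum.map (inl ∘ inr) inr))))
  · obtain ⟨x⟩ : Nonempty M := inferInstance
    beta_reduce
    rw [h4 M hM, h4' M hM]
    constructor
    · rintro (⟨p, g1, g2⟩ | ⟨p, g1, g2⟩)
      · obtain ⟨b, hb⟩ := exists_selector (M := M) True
        refine ⟨Sum.elim (Sum.elim p fun _ => x) b, fun s hs => ?_, fun q => ?_⟩
        · simpa [hb, i, ← Function.comp_assoc] using g1 s hs
        · simpa [hb, i, ← Function.comp_assoc] using g2 (q ∘ inl)
      · obtain ⟨b, hb⟩ := exists_selector (M := M) False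
        refine ⟨Sum.elim (Sum.elim (fun _ => x) p) b, fun s hs => ?_, fun q => ?_⟩
        · simpa [hb, i, ← Function.comp_assoc] using g1 s hs
        · simpa [hb, i, ← Function.comp_assoc] using g2 (q ∘ inr)
    · rintro ⟨p, g1, g2⟩
      by_cases hp : p (i true) = p (i false)
      · refine .inl ⟨p ∘ inl ∘ inl, fun s hs => (g1 s hs).1 hp, fun q => ?_⟩
        simpa [hp] using g2 (Sum.elim q fun _ => x)
      · refine .inr ⟨p ∘ inl ∘ inr, fun s hs => (g1 s hs).2 hp, fun q => ?_⟩
        simpa [hp] using g2 (Sum.elim (fun _ => x) q)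

lemma NF.ex (hP : NF P) (v : ℕ) : NF fun M I X => ∃ H : (ℕ → M) → Set M,
    (∀ s ∈ X, (H s).Nonempty) ∧ P M I {s' | ∃ s ∈ X, ∃ m ∈ H s, s' = update s v m} := by
  obtain ⟨A, K, θ, ω, χ, hA, h1, h2, h3, h4⟩ := hP
  refine ⟨A, K, fun M I s p => ∃ m, θ M I (update s v m) p, ω,
    fun M I s p q => ∃ m, θ M I (update s v m) p ∧ χ M I (update s v m) p q, hA,
    h1.exists_update v, h2, FD.exists_update (P := fun M I s a => θ M I s (a ∘ inl) ∧
      χ M I s (a ∘ inl) (a ∘ inr)) ((h1.comap (Sum.map id inl)).and h3) v, fun M hM I X => ?_⟩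
  simp only [h4 M hM]
  constructor
  · rintro ⟨H, hH, p, g1, g2⟩
    refine ⟨p, fun s hs => ?_, fun q => (g2 q).imp_right ?_⟩
    · obtain ⟨m, hm⟩ := hH s hs
      exact ⟨m, g1 _ ⟨s, hs, m, hm, rfl⟩⟩
    · rintro ⟨_, ⟨s, hs, m, hm, rfl⟩, hc⟩
      exact ⟨s, hs, m, g1 _ ⟨s, hs, m, hm, rfl⟩, hc⟩
  · rintro ⟨p, g1, g2⟩
    refine ⟨fun s => {m | θ M I (update s v m) p}, g1, p, ?_, fun q => (g2 q).imp_right ?_⟩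
    · rintro _ ⟨s, hs, m, hm, rfl⟩
      exact hm
    · rintro ⟨s, hs, m, hm, hc⟩
      exact ⟨_, ⟨s, hs, m, hm, rfl⟩, hc⟩

lemma NF.al (hP : NF P) (v : ℕ) :
    NF fun M I X => P M I {s' | ∃ s ∈ X, ∃ m : M, s' = update s v m} := by
  obtain ⟨A, K, θ, ω, χ, hA, h1, h2, h3, h4⟩ := hP
  refine ⟨A, K, fun M I s p => ¬ ∃ m, ¬ θ M I (update s v m) p, ω,
    fun M I s p q => ∃ m, χ M I (update s v m) p q, hA,
    (FD.exists_update (P := fun M I s a => ¬ θ M I s a) h1.not v).not, h2,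
    FD.exists_update (P := fun M I s a => χ M I s (a ∘ inl) (a ∘ inr)) h3 v, fun M hM I X => ?_⟩
  simp only [h4 M hM, not_exists, not_not]
  refine exists_congr fun p => and_congr ⟨fun h s hs m => h _ ⟨s, hs, m, rfl⟩, ?_⟩
    (forall_congr' fun q => or_congr Iff.rfl ⟨?_, ?_⟩)
  · rintro h _ ⟨s, hs, m, rfl⟩
    exact h s hs m
  · rintro ⟨_, ⟨s, hs, m, rfl⟩, hc⟩
    exact ⟨s, hs, m, hc⟩
  · rintro ⟨s, hs, m, hc⟩
    exact ⟨_, ⟨s, hs, m, rfl⟩, hc⟩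

lemma NF.forall_mem {A : Type} [Nonempty A]
    {θ : ∀ M : Type, Interp S M → (ℕ → M) → (A → M) → Prop}
    (h : FD fun M I (a : ℕ ⊕ A → M) => θ M I (a ∘ inl) (a ∘ inr)) :
    NF fun M I X => ∃ p, ∀ s ∈ X, θ M I s p :=
  ⟨A, Unit, θ, fun _ _ _ _ => True, fun _ _ _ _ _ => True, inferInstance, h, FD.true, FD.true,
    fun M _ I X => by simp⟩

lemma NF.exists_mem {K : Type} {χ : ∀ M : Type, Interp S M → (ℕ → M) → (K → M) → Prop}
    (h : FD fun M I (a : ℕ ⊕ K → M) => χ M I (a ∘ inl) (a ∘ inr)) :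
    NF fun M I X => ∀ q, ∃ s ∈ X, χ M I s q :=
  ⟨Unit, K, fun _ _ _ _ => True, fun _ _ _ _ => False, fun M I s _ q => χ M I s q, inferInstance,
    FD.true, FD.false, h.comap (Sum.map id inr), fun M _ I X => by simp⟩

lemma NF.flat {θ : ∀ M : Type, Interp S M → (ℕ → M) → Prop} (h : FD θ) :
    NF fun M I X => ∀ s ∈ X, θ M I s :=
  (NF.forall_mem (A := Unit) (θ := fun M I s _ => θ M I s) (h.comap inl)).congr
    fun M _ I X => by simp

lemma NF.sentence {ψ : FOF S} (h : IsSentence ψ) : NF fun M I _ => FOTrue M I ψ :=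
  ⟨Unit, Unit, fun _ _ _ _ => True, fun M I _ _ => FOTrue M I ψ, fun _ _ _ _ _ => False,
    inferInstance, FD.true, FD.sentence h, FD.false, fun M _ I X => by simp⟩

lemma NF.false : NF fun M (_ : Interp S M) _ => False :=
  ⟨Unit, Unit, fun _ _ _ _ => True, fun M I _ _ => False, fun _ _ _ _ _ => False,
    inferInstance, FD.true, FD.false, FD.false, fun M _ I X => by simp⟩

lemma NF.true : NF fun M (_ : Interp S M) _ => True :=
  (NF.flat FD.true).congr fun _ _ _ _ => by simp

lemma NF.of_empty_signature {P : ∀ M : Type, Interp Sig0 M → Set (ℕ → M) → Prop} (h : NF P)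
    (g : ℕ → ℕ) : NF fun M (_ : Interp S M) X => P M (eI M) ((fun s => s ∘ g) '' X) := by
  obtain ⟨A, K, θ, ω, χ, hA, h1, h2, h3, h4⟩ := h
  refine ⟨A, K, fun M _ s p => θ M (eI M) (s ∘ g) p, fun M _ p q => ω M (eI M) p q,
    fun M _ s p q => χ M (eI M) (s ∘ g) p q, hA, (h1.comap (Sum.map g id)).of_empty_signature,
    h2.of_empty_signature, (h3.comap (Sum.map g id)).of_empty_signature, fun M hM I X => ?_⟩
  beta_reduce
  rw [h4 M hM]
  simp only [Set.forall_mem_image, Set.exists_mem_image]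

/-- Truth of a property in normal form in the full team is first-order. -/
lemma NF.exists_sentence (h : NF P) : ∃ ψ : FOF S, IsSentence ψ ∧
    ∀ M : Type, Nontrivial M → ∀ I, P M I Set.univ ↔ FOTrue M I ψ := by
  obtain ⟨A, K, θ, ω, χ, hA, h1, h2, h3, h4⟩ := h
  have g1 : FD fun M I (p : A → M) => ∃ s, ¬ θ M I s p :=
    (h1.not.comap (Sum.elim inr inl)).exists
  have g2 : FD fun M I (a : A ⊕ K → M) => ∃ s, χ M I s (a ∘ inl) (a ∘ inr) :=
    (h3.comap (Sum.elim inr inl)).exists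
  have g3 : FD fun M I (p : A → M) => ∃ q, ¬ (ω M I p q ∨ ∃ s, χ M I s p q) :=
    (h2.or g2).not.exists
  obtain ⟨ψ, hψ, H⟩ := (g1.not.and g3.not).exists_sentence
  refine ⟨ψ, hψ, fun M hM I => ?_⟩
  rw [h4 M hM, H M hM]
  simp only [Set.mem_univ, true_and, true_imp_iff, not_exists, not_not]

lemma nf_TSat {A : ∀ M : Type, ∀ i, Set (Fin (ar i) → M) → Prop}
    (hA : ∀ i v, NF fun M (_ : Interp S M) X => A M i (teamProj v X)) :
    ∀ φ : TS S ι ar, NoCneg φ → NF fun M I X => TSat M I (A M) φ X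
  | .rel r v, _ => NF.flat ⟨.rel r v, id, fun _ _ _ _ => Iff.rfl⟩
  | .nrel r v, _ => NF.flat ⟨.nrel r v, id, fun _ _ _ _ => Iff.rfl⟩
  | .eq x y, _ => NF.flat ⟨.eq x y, id, fun _ _ _ _ => Iff.rfl⟩
  | .neq x y, _ => NF.flat ⟨.neq x y, id, fun _ _ _ _ => Iff.rfl⟩
  | .dep i v, _ => hA i v
  | .and φ ψ, h => (nf_TSat hA φ h.1).and (nf_TSat hA ψ h.2)
  | .or φ ψ, h => (nf_TSat hA φ h.1).split (nf_TSat hA ψ h.2)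
  | .gdisj φ ψ, h => (nf_TSat hA φ h.1).gdisj (nf_TSat hA ψ h.2)
  | .cneg _, h => h.elim
  | .ex v φ, h => (nf_TSat hA φ h).ex v
  | .al v φ, h => (nf_TSat hA φ h).al v

lemma nf_cSem (i : CIdx) (v : Fin (cAr i) → ℕ) :
    NF fun M (_ : Interp S M) X => cSem M i (teamProj v X) := by
  match i, v with
  | .d0 ψ hψ, v =>
    have h : IsSentence (embedEF ψ : FOF S) := by rw [IsSentence, fv_embedEF]; exact hψ
    exact (NF.sentence h).congr fun M _ I X => forall_congr' fun s => FSat_embedEF I ψ s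
  | .const k, v =>
    refine (NF.forall_mem (A := ℕ) (θ := fun M I s p => ∀ i : Fin k, s (v i) = p i)
      (FD.forall_fin fun i => FD.eq _ _)).congr fun M _ I X => ?_
    constructor
    · rintro ⟨p, hp⟩ _ ⟨s, hs, rfl⟩ _ ⟨s', hs', rfl⟩
      exact funext fun i => (hp s hs i).trans (hp s' hs' i).symm
    · intro h
      obtain rfl | ⟨s0, hs0⟩ := X.eq_empty_or_nonempty
      · exact ⟨fun _ => Classical.arbitrary M, by simp⟩
      · refine ⟨fun n => if hn : n < k then s0 (v ⟨n, hn⟩) else Classical.arbitrary M,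
          fun s hs i => ?_⟩
        beta_reduce
        rw [dif_pos i.2]
        exact congrFun (h _ ⟨s, hs, rfl⟩ _ ⟨s0, hs0, rfl⟩) i
  | .total k, v =>
    refine (NF.exists_mem (K := ℕ) (χ := fun M I s p => ∀ i : Fin k, s (v i) = p i)
      (FD.forall_fin fun i => FD.eq _ _)).congr fun M _ I X => ?_
    constructor
    · intro h
      refine Set.eq_univ_of_forall fun t => ?_
      obtain ⟨s, hs, hst⟩ := h fun n => if hn : n < k then t ⟨n, hn⟩ else Classical.arbitrary M
      exact ⟨s, hs, funext fun i => ((hst i).trans (dif_pos i.2)).symm⟩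
    · intro h q
      obtain ⟨s, hs, hst⟩ := h.ge (Set.mem_univ fun i : Fin k => q i)
      exact ⟨s, hs, fun i => (congrFun hst i).symm⟩

end NF

/-- All team properties `D M X(v)` are in normal form, over every signature. -/
def HasNF {k : ℕ} (D : DepPred k) : Prop :=
  ∀ (S : Signature) (v : Fin k → ℕ), NF fun M (_ : Interp S M) X => D M (teamProj v X)

lemma hasNF_of_definable {k : ℕ} {D : DepPred k} {φ : TS Sig0 CIdx cAr} (hφ : NoCneg φ)
    (h : ∀ M : Type, Nontrivial M → ∀ X : Set (ℕ → M),
      (TSat M (eI M) (cSem M) φ X ↔ D M (teamProj (fun j : Fin k => (j : ℕ)) X))) : HasNF D := by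
  intro S v
  refine ((nf_TSat nf_cSem φ hφ).of_empty_signature
    fun n => if hn : n < k then v ⟨n, hn⟩ else 0).congr fun M hM I X => ?_
  rw [h M hM]
  refine iff_of_eq (congrArg (D M) (Set.ext fun t => ?_))
  simp [teamProj]

theorem dsfo_of_hasNF {k : ℕ} {D : DepPred k} (hD : HasNF D) (hD' : HasNF (complD D)) :
    DSFOd D := by
  intro S φ _ hφ
  refine (nf_TSat (A := fun M i => (match i with | true => D | false => complD D : DepPred k) M)
    (fun i v => ?_) φ hφ.1).exists_sentence
  cases i
  · exact hD' S v
  · exact hD S v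

lemma hasNF_exAll {k : ℕ} (θ : EF) : HasNF (k := k) fun M R => ExAllSem M R θ := by
  intro S v
  refine (NF.forall_mem (A := ℕ)
    (θ := fun M _ s p => FSat M (eI M) (overrideFin k (fun i => s (v i)) p) θ) ?_).congr
    fun M _ I X => exists_congr fun p => ⟨?_, fun h s hs => h _ ⟨s, hs, rfl⟩⟩
  · refine (FD.embedEF (φ := θ)
      (c := fun n => if hn : n < k then Sum.inl (v ⟨n, hn⟩) else Sum.inr n)).congr fun M _ I a => ?_
    refine iff_of_eq (congrArg (FSat M (eI M) · θ) (funext fun n => ?_))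
    by_cases hn : n < k <;> simp [overrideFin, hn]
  · rintro h _ ⟨s, hs, rfl⟩
    exact h s hs

lemma hasNF_not_exAll {k : ℕ} (θ : EF) : HasNF (k := k) fun M R => ¬ ExAllSem M R θ := by
  intro S v
  refine (NF.exists_mem (K := ℕ)
    (χ := fun M _ s p => ¬ FSat M (eI M) (overrideFin k (fun i => s (v i)) p) θ) ?_).congr
    fun M _ I X => ?_
  · refine (FD.embedEF (φ := θ)
      (c := fun n => if hn : n < k then Sum.inl (v ⟨n, hn⟩) else Sum.inr n)).not.congr
      fun M _ I a => ?_
    refine not_congr (iff_of_eq (congrArg (FSat M (eI M) · θ) (funext fun n => ?_)))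
    by_cases hn : n < k <;> simp [overrideFin, hn]
  · simp only [ExAllSem, not_exists, not_forall]
    refine forall_congr' fun p => ⟨fun ⟨s, hs, h⟩ => ⟨_, ⟨s, hs, rfl⟩, h⟩, ?_⟩
    rintro ⟨_, ⟨s, hs, rfl⟩, h⟩
    exact ⟨s, hs, h⟩

lemma hasNF_sentence {k : ℕ} {ψ : EF} (hψ : IsSentence ψ) :
    HasNF (k := k) fun M _ => FOTrue M (eI M) ψ := by
  intro S v
  have h : IsSentence (embedEF ψ : FOF S) := by rw [IsSentence, fv_embedEF]; exact hψ
  exact (NF.sentence h).congr fun M _ I X => forall_congr' fun s => FSat_embedEF I ψ s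

lemma hasNF_not_sentence {k : ℕ} {ψ : EF} (hψ : IsSentence ψ) :
    HasNF (k := k) fun M _ => ¬ FOTrue M (eI M) ψ := by
  have h : IsSentence (TS.cneg ψ) := hψ
  refine fun S v => (hasNF_sentence h S v).congr fun M _ I X => ?_
  have s : ℕ → M := fun _ => Classical.arbitrary M
  beta_reduce
  rw [FOTrue_iff h s, FOTrue_iff hψ s]
  rfl

/-- Closure of the class of dependencies defined by a pair of complementary normal forms. -/
lemma hasNF_list {k : ℕ} {α : Type} {E : α → DepPred k} {L : List α}
    (h : ∀ a ∈ L, HasNF (E a) ∧ HasNF (complD (E a))) :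
    (HasNF (fun M R => ∀ a ∈ L, E a M R) ∧ HasNF (fun M R => ∃ a ∈ L, ¬ E a M R)) ∧
      HasNF (fun M R => ∃ a ∈ L, E a M R) ∧ HasNF (fun M R => ∀ a ∈ L, ¬ E a M R) := by
  induction L with
  | nil =>
    refine ⟨⟨?_, ?_⟩, ?_, ?_⟩ <;> intro S v
    · exact NF.true.congr fun _ _ _ _ => by simp
    · exact NF.false.congr fun _ _ _ _ => by simp
    · exact NF.false.congr fun _ _ _ _ => by simp
    · exact NF.true.congr fun _ _ _ _ => by simp
  | cons a L ih =>
    rw [List.forall_mem_cons] at h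
    obtain ⟨⟨h1, h2⟩, h3, h4⟩ := ih h.2
    refine ⟨⟨?_, ?_⟩, ?_, ?_⟩ <;> intro S v
    · exact ((h.1.1 S v).and (h1 S v)).congr fun _ _ _ _ => by simp
    · exact ((h.1.2 S v).gdisj (h2 S v)).congr fun _ _ _ _ => by simp [complD]
    · exact ((h.1.1 S v).gdisj (h3 S v)).congr fun _ _ _ _ => by simp
    · exact ((h.1.2 S v).and (h4 S v)).congr fun _ _ _ _ => by simp [complD]

lemma HasNF.congr {k : ℕ} {D E : DepPred k} (h : HasNF D)
    (hDE : ∀ M : Type, Nontrivial M → ∀ R, D M R ↔ E M R) : HasNF E :=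
  fun S v => (h S v).congr fun M hM _ _ => hDE M hM _

theorem HasBasicForm.dsfo {k : ℕ} {D : DepPred k} (h : HasBasicForm D) : DSFOd D := by
  obtain ⟨L, hL, h⟩ := h
  have h0 := hasNF_list (k := k) (E := fun (d : EF × List EF × List EF) M R =>
    FOTrue M (eI M) d.1 ∧ (∀ θ ∈ d.2.1, ExAllSem M R θ) ∧ ∀ ξ ∈ d.2.2, ¬ ExAllSem M R ξ)
    (L := L) fun d hd => by
      obtain ⟨⟨h1, h2⟩, -⟩ := hasNF_list (k := k) (E := fun θ M R => ExAllSem M R θ) (L := d.2.1)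
        fun θ _ => ⟨hasNF_exAll θ, hasNF_not_exAll θ⟩
      obtain ⟨-, h3, h4⟩ := hasNF_list (k := k) (E := fun θ M R => ExAllSem M R θ) (L := d.2.2)
        fun θ _ => ⟨hasNF_exAll θ, hasNF_not_exAll θ⟩
      refine ⟨fun S v => (hasNF_sentence (hL d hd) S v).and ((h1 S v).and (h4 S v)), fun S v =>
        ((hasNF_not_sentence (hL d hd) S v).gdisj ((h2 S v).gdisj (h3 S v))).congr
          fun M _ I X => ?_⟩
      simp only [complD]
      grind
  refine dsfo_of_hasNF (h0.2.1.congr fun M hM R => (h M hM R).symm)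
    (h0.2.2.congr fun M hM R => ?_)
  simp only [complD, h M hM R, not_exists, not_and]

/-! ### Definability in the logic with constancy and totality atoms -/

/-- The negation normal form of `φ` (for `true`) or of its negation (for `false`). -/
def nnf : Bool → EF → TS Sig0 ι ar
  | _, .rel r _ => Empty.elim r
  | _, .nrel r _ => Empty.elim r
  | true, .eq x y => .eq x y
  | false, .eq x y => .neq x y
  | true, .neq x y => .neq x y
  | false, .neq x y => .eq x y
  | _, .dep i _ => Empty.elim i
  | true, .and φ ψ => .and (nnf true φ) (nnf true ψ)
  | false, .and φ ψ => .or (nnf false φ) (nnf false ψ)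
  | true, .or φ ψ => .or (nnf true φ) (nnf true ψ)
  | false, .or φ ψ => .and (nnf false φ) (nnf false ψ)
  | true, .gdisj φ ψ => .or (nnf true φ) (nnf true ψ)
  | false, .gdisj φ ψ => .and (nnf false φ) (nnf false ψ)
  | b, .cneg φ => nnf (!b) φ
  | true, .ex v φ => .ex v (nnf true φ)
  | false, .ex v φ => .al v (nnf false φ)
  | true, .al v φ => .al v (nnf true φ)
  | false, .al v φ => .ex v (nnf false φ)

lemma noCneg_nnf (b : Bool) (φ : EF) : NoCneg (nnf b φ : TS Sig0 ι ar) := by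
  induction φ generalizing b with
  | rel r _ => exact Empty.elim r
  | nrel r _ => exact Empty.elim r
  | dep i _ => exact Empty.elim i
  | cneg φ ih => exact ih _
  | _ => cases b <;> simp_all [nnf, NoCneg]

lemma noCneg_exs {l : List ℕ} {φ : TS S ι ar} (h : NoCneg φ) : NoCneg (exs l φ) := by
  induction l with
  | nil => exact h
  | cons v l ih => exact ih

lemma noCneg_als {l : List ℕ} {φ : TS S ι ar} (h : NoCneg φ) : NoCneg (als l φ) := by
  induction l with
  | nil => exact h
  | cons v l ih => exact ih

lemma split_flat {α : Type} {X : Set α} {P Q : α → Prop} :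
    (∃ Y Z, Y ∪ Z = X ∧ (∀ s ∈ Y, P s) ∧ ∀ s ∈ Z, Q s) ↔ ∀ s ∈ X, P s ∨ Q s := by
  constructor
  · rintro ⟨Y, Z, rfl, h1, h2⟩ s hs
    exact hs.imp (h1 s) (h2 s)
  · intro h
    refine ⟨{s | s ∈ X ∧ P s}, {s | s ∈ X ∧ Q s}, Set.ext fun s => ?_, fun s hs => hs.2,
      fun s hs => hs.2⟩
    exact ⟨fun hs => hs.elim And.left And.left, fun hs => (h s hs).imp (⟨hs, ·⟩) (⟨hs, ·⟩)⟩

lemma ex_flat {M : Type} {X : Set (ℕ → M)} {v : ℕ} {P : (ℕ → M) → Prop} :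
    (∃ H : (ℕ → M) → Set M, (∀ s ∈ X, (H s).Nonempty) ∧
      ∀ s' ∈ {s' | ∃ s ∈ X, ∃ m ∈ H s, s' = update s v m}, P s') ↔
    ∀ s ∈ X, ∃ m, P (update s v m) := by
  constructor
  · rintro ⟨H, hH, h⟩ s hs
    obtain ⟨m, hm⟩ := hH s hs
    exact ⟨m, h _ ⟨s, hs, m, hm, rfl⟩⟩
  · intro h
    refine ⟨fun s => {m | P (update s v m)}, h, ?_⟩
    rintro _ ⟨s, hs, m, hm, rfl⟩
    exact hm

lemma al_flat {M : Type} {X : Set (ℕ → M)} {v : ℕ} {P : (ℕ → M) → Prop} :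
    (∀ s' ∈ {s' | ∃ s ∈ X, ∃ m : M, s' = update s v m}, P s') ↔
    ∀ s ∈ X, ∀ m, P (update s v m) := by
  constructor
  · exact fun h s hs m => h _ ⟨s, hs, m, rfl⟩
  · rintro h _ ⟨s, hs, m, rfl⟩
    exact h s hs m

lemma TSat_nnf {M : Type} {A : ∀ i, Set (Fin (ar i) → M) → Prop} (φ : EF) (b : Bool)
    (X : Set (ℕ → M)) :
    TSat M (eI M) A (nnf b φ) X ↔ ∀ s ∈ X, (FSat M (eI M) s φ ↔ b = true) := by
  induction φ generalizing b X with
  | rel r _ => exact Empty.elim r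
  | nrel r _ => exact Empty.elim r
  | dep i _ => exact Empty.elim i
  | eq x y => cases b <;> simp [nnf, TSat, FSat]
  | neq x y => cases b <;> simp [nnf, TSat, FSat]
  | and φ ψ ih1 ih2 =>
    cases b
    · simp only [nnf, TSat, ih1, ih2, split_flat, FSat]
      exact forall₂_congr fun s _ => by tauto
    · simp only [nnf, TSat, ih1, ih2, FSat, ← forall₂_and]
      exact forall₂_congr fun s _ => by tauto
  | or φ ψ ih1 ih2 | gdisj φ ψ ih1 ih2 =>
    cases b
    · simp only [nnf, TSat, ih1, ih2, FSat, ← forall₂_and]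
      exact forall₂_congr fun s _ => by tauto
    · simp only [nnf, TSat, ih1, ih2, split_flat, FSat]
      exact forall₂_congr fun s _ => by tauto
  | cneg φ ih =>
    rw [nnf, ih]
    refine forall₂_congr fun s _ => ?_
    cases b <;> simp [FSat]
  | ex v φ ih =>
    cases b
    · simp only [nnf, TSat, ih, al_flat]
      simp [FSat]
    · simp only [nnf, TSat, ih, ex_flat]
      simp [FSat]
  | al v φ ih =>
    cases b
    · simp only [nnf, TSat, ih, ex_flat]
      simp [FSat]
    · simp only [nnf, TSat, ih, al_flat]
      simp [FSat]

/-- Definability in the logic with constancy, totality and `0`-ary first-order atoms. -/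
def CDef {k : ℕ} (D : DepPred k) : Prop :=
  ∃ φ : TS Sig0 CIdx cAr, NoCneg φ ∧ ∀ M : Type, Nontrivial M → ∀ X : Set (ℕ → M),
    (TSat M (eI M) (cSem M) φ X ↔ D M (teamProj (fun j : Fin k => (j : ℕ)) X))

lemma CDef.congr {k : ℕ} {D E : DepPred k} (h : CDef D)
    (hDE : ∀ M : Type, Nontrivial M → ∀ R, D M R ↔ E M R) : CDef E := by
  obtain ⟨φ, h1, h2⟩ := h
  exact ⟨φ, h1, fun M hM X => (h2 M hM X).trans (hDE M hM _)⟩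

lemma CDef.and {k : ℕ} {D E : DepPred k} (hD : CDef D) (hE : CDef E) :
    CDef (k := k) fun M R => D M R ∧ E M R := by
  obtain ⟨φ, h1, h2⟩ := hD
  obtain ⟨ψ, h1', h2'⟩ := hE
  exact ⟨.and φ ψ, ⟨h1, h1'⟩, fun M hM X => and_congr (h2 M hM X) (h2' M hM X)⟩

lemma CDef.or {k : ℕ} {D E : DepPred k} (hD : CDef D) (hE : CDef E) :
    CDef (k := k) fun M R => D M R ∨ E M R := by
  obtain ⟨φ, h1, h2⟩ := hD
  obtain ⟨ψ, h1', h2'⟩ := hE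
  exact ⟨.gdisj φ ψ, ⟨h1, h1'⟩, fun M hM X => or_congr (h2 M hM X) (h2' M hM X)⟩

lemma CDef.sentence {k : ℕ} {ψ : EF} (hψ : IsSentence ψ) :
    CDef (k := k) fun M _ => FOTrue M (eI M) ψ :=
  ⟨.dep (.d0 ψ hψ) Fin.elim0, trivial, fun _ _ _ => Iff.rfl⟩

lemma CDef.top {k : ℕ} : CDef (k := k) fun _ _ => True :=
  ⟨.top, trivial, fun _ _ _ => by simp [TS.top, TSat]⟩

lemma CDef.bot {k : ℕ} : CDef (k := k) fun _ _ => False := by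
  have h : IsSentence (.al 0 (.neq 0 0) : EF) := by simp [IsSentence, fv]
  refine (CDef.sentence h).congr fun M _ R => ?_
  rw [FOTrue_iff h fun _ => Classical.arbitrary M]
  simp [FSat]

lemma CDef.forall_mem {k : ℕ} {α : Type} {E : α → DepPred k} {L : List α}
    (h : ∀ a ∈ L, CDef (E a)) : CDef fun M R => ∀ a ∈ L, E a M R := by
  induction L with
  | nil => exact CDef.top.congr fun _ _ _ => by simp
  | cons a L ih =>
    rw [List.forall_mem_cons] at h
    exact (h.1.and (ih h.2)).congr fun _ _ _ => by simp

lemma CDef.exists_mem {k : ℕ} {α : Type} {E : α → DepPred k} {L : List α}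
    (h : ∀ a ∈ L, CDef (E a)) : CDef fun M R => ∃ a ∈ L, E a M R := by
  induction L with
  | nil => exact CDef.bot.congr fun _ _ _ => by simp
  | cons a L ih =>
    rw [List.forall_mem_cons] at h
    exact (h.1.or (ih h.2)).congr fun _ _ _ => by simp

/-- The parameters of `θ`, i.e. its variables other than `0, …, k - 1`. -/
noncomputable def params (k : ℕ) (θ : EF) : List ℕ := ((avars θ).filter (k ≤ ·)).toList

lemma le_of_mem_params {k : ℕ} {θ : EF} {v : ℕ} (h : v ∈ params k θ) : k ≤ v := by
  simp_all [params]

lemma mem_params {k : ℕ} {θ : EF} {v : ℕ} (hv : v ∈ fv θ) (h : k ≤ v) : v ∈ params k θ := by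
  simpa [params, h] using fv_subset_avars θ hv

/-- Replacing the values of the parameters. -/
lemma FSat_iff_overrideFin {M : Type} {k : ℕ} {θ : EF} {s y p : ℕ → M}
    (h1 : ∀ v ∉ params k θ, y v = s v) (h2 : ∀ i, y ((params k θ).get i) = p ((params k θ).get i)) :
    FSat M (eI M) y θ ↔ FSat M (eI M) (overrideFin k (fun j => s j) p) θ := by
  refine FSat_congr _ _ fun v hv => ?_
  by_cases hk : v < k
  · rw [h1 v fun h => (le_of_mem_params h).not_gt hk]
    simp [overrideFin, hk]
  · rw [overrideFin_of_le _ _ (not_lt.1 hk)]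
    obtain ⟨i, rfl⟩ := List.get_of_mem (mem_params hv (not_lt.1 hk))
    exact h2 i

open Classical in
lemma CDef.exAll {k : ℕ} (θ : EF) : CDef (k := k) fun M R => ExAllSem M R θ := by
  set l := params k θ with hl
  refine ⟨exs l (.and (.dep (.const l.length) l.get) (nnf true θ)),
    noCneg_exs ⟨trivial, noCneg_nnf _ _⟩, fun M _ X => ?_⟩
  simp only [TSat_exs, TSat, TSat_nnf, iff_true]
  constructor
  · rintro ⟨Y, h1, -, h3, h4⟩
    obtain rfl | ⟨x, hx⟩ := X.eq_empty_or_nonempty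
    · exact ⟨fun _ => Classical.arbitrary M, by rintro _ ⟨s, hs, -⟩; exact hs.elim⟩
    · obtain ⟨p, hp, -⟩ := h1 x hx
      refine ⟨p, ?_⟩
      rintro _ ⟨s, hs, rfl⟩
      obtain ⟨y, hy, hys⟩ := h1 s hs
      exact (FSat_iff_overrideFin hys
        fun i => congrFun (h3 _ ⟨y, hy, rfl⟩ _ ⟨p, hp, rfl⟩) i).1 (h4 y hy)
  · rintro ⟨p, hp⟩
    refine ⟨(fun s v => if v ∈ l then p v else s v) '' X, ?_, ?_, ?_, ?_⟩
    · exact fun s hs => ⟨_, ⟨s, hs, rfl⟩, fun v hv => if_neg hv⟩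
    · rintro _ ⟨s, hs, rfl⟩
      exact ⟨s, hs, fun v hv => if_neg hv⟩
    · rintro _ ⟨_, ⟨s, hs, rfl⟩, rfl⟩ _ ⟨_, ⟨s', hs', rfl⟩, rfl⟩
      exact funext fun i => (if_pos (List.get_mem _ _)).trans (if_pos (List.get_mem _ _)).symm
    · rintro _ ⟨s, hs, rfl⟩
      exact (FSat_iff_overrideFin (s := s) (p := p) (fun v hv => if_neg hv)
        fun i => if_pos (List.get_mem _ _)).2 (hp _ ⟨s, hs, rfl⟩)

open Classical in
lemma CDef.not_exAll {k : ℕ} (θ : EF) : CDef (k := k) fun M R => ¬ ExAllSem M R θ := by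
  set l := params k θ with hl
  have hinj : Injective l.get := List.nodup_iff_injective_get.1 (Finset.nodup_toList _)
  refine ⟨als l (.or .top (.and (nnf false θ) (.dep (.total l.length) l.get))),
    noCneg_als ⟨trivial, noCneg_nnf _ _, trivial⟩,
    fun M _ X => ?_⟩
  simp only [TSat_als, TSat, TS.top, TSat_nnf]
  constructor
  · rintro ⟨Y, Z, h1, -, h2, h3⟩ ⟨p, hp⟩
    obtain ⟨z, hz, hzp⟩ := h3.ge (Set.mem_univ fun i => p (l.get i))
    obtain ⟨s, hs, hzs⟩ := h1.le (Or.inr hz)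
    have := (FSat_iff_overrideFin hzs fun i => (congrFun hzp i).symm).2 (hp _ ⟨s, hs, rfl⟩)
    simpa using (h2 z hz).1 this
  · intro h
    refine ⟨_, {y | (∃ s ∈ X, ∀ v ∉ l, y v = s v) ∧ ¬ FSat M (eI M) y θ},
      Set.union_eq_self_of_subset_right fun y hy => hy.1, fun _ _ => trivial,
      fun y hy => by simpa using hy.2, Set.eq_univ_of_forall fun t => ?_⟩
    simp only [ExAllSem, not_exists, not_forall] at h
    obtain ⟨_, ⟨s, hs, rfl⟩, hst⟩ := h (extend l.get t fun _ => Classical.arbitrary M)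
    refine ⟨fun v => if v ∈ l then extend l.get t (fun _ => Classical.arbitrary M) v else s v,
      ⟨⟨s, hs, fun v hv => if_neg hv⟩, fun H => hst ?_⟩, funext fun i => ?_⟩
    · exact (FSat_iff_overrideFin (fun v hv => if_neg hv)
        fun i => if_pos (List.get_mem _ _)).1 H
    · exact ((if_pos (List.get_mem _ _)).trans (hinj.extend_apply _ _ _)).symm

theorem HasBasicForm.cdef {k : ℕ} {D : DepPred k} (h : HasBasicForm D) : CDef D := by
  obtain ⟨L, hL, h⟩ := h
  exact (CDef.exists_mem fun d hd => (CDef.sentence (hL d hd)).and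
    ((CDef.forall_mem (L := d.2.1) fun θ _ => CDef.exAll θ).and
      (CDef.forall_mem (L := d.2.2) fun θ _ => CDef.not_exAll θ))).congr
    fun M hM R => (h M hM R).symm

/-- Constant relabelling of dependency atoms. -/
def relabel {k : ℕ} (b : Bool) : TS S Unit (fun _ => k) → TS S Bool fun _ => k
  | .rel r v => .rel r v
  | .nrel r v => .nrel r v
  | .eq x y => .eq x y
  | .neq x y => .neq x y
  | .dep _ v => .dep b v
  | .and φ ψ => .and (relabel b φ) (relabel b ψ)
  | .or φ ψ => .or (relabel b φ) (relabel b ψ)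
  | .gdisj φ ψ => .gdisj (relabel b φ) (relabel b ψ)
  | .cneg φ => .cneg (relabel b φ)
  | .ex v φ => .ex v (relabel b φ)
  | .al v φ => .al v (relabel b φ)

lemma fv_relabel {k : ℕ} (b : Bool) (φ : TS S Unit fun _ => k) : fv (relabel b φ) = fv φ := by
  induction φ <;> simp_all [relabel, fv]

lemma plain_relabel {k : ℕ} (b : Bool) {φ : TS S Unit fun _ => k} (h : Plain φ) :
    Plain (relabel b φ) := by
  induction φ <;> simp_all [relabel, Plain, NoCneg, NoGdisj]

lemma TSat_relabel {k : ℕ} {M : Type} {I : Interp S M} (b : Bool)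
    (A : Bool → Set (Fin k → M) → Prop) (φ : TS S Unit fun _ => k) (X : Set (ℕ → M)) :
    TSat M I A (relabel b φ) X ↔ TSat M I (fun _ => A b) φ X := by
  induction φ generalizing X <;> simp_all [relabel, TSat]

lemma SFOFam.of_bool {k : ℕ} {D : Bool → DepPred k} (h : SFOFam (ar := fun _ => k) D) (b : Bool) :
    SFOd (D b) := by
  intro S φ h1 h2
  obtain ⟨ψ, h3, h4⟩ := h S (relabel b φ) (by rwa [IsSentence, fv_relabel]) (plain_relabel b h2)
  exact ⟨ψ, h3, fun M hM I => (TSat_relabel b (fun i => D i M) φ _).symm.trans (h4 M hM I)⟩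

lemma hasBasicForm_iff {k : ℕ} {D : DepPred k} : HasBasicForm D ↔
    ∃ (l : ℕ) (ψ : Fin l → EF) (_ : ∀ a, IsSentence (ψ a))
      (n n' : Fin l → ℕ) (θ : ∀ a, Fin (n a) → EF) (ξ : ∀ a, Fin (n' a) → EF),
      ∀ (M : Type), Nontrivial M → ∀ R : Set (Fin k → M),
        (D M R ↔ ∃ a, FOTrue M (eI M) (ψ a) ∧
          (∀ i, ExAllSem M R (θ a i)) ∧ (∀ j, ¬ ExAllSem M R (ξ a j))) := by
  constructor
  · rintro ⟨L, hL, h⟩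
    refine ⟨L.length, fun a => (L.get a).1, fun a => hL _ (List.get_mem _ _),
      fun a => (L.get a).2.1.length, fun a => (L.get a).2.2.length,
      fun a => (L.get a).2.1.get, fun a => (L.get a).2.2.get, fun M hM R => (h M hM R).trans ?_⟩
    simp only [List.forall_mem_iff_get, List.exists_mem_iff_get]
  · rintro ⟨l, ψ, hψ, n, n', θ, ξ, h⟩
    refine ⟨List.ofFn fun a => (ψ a, List.ofFn (θ a), List.ofFn (ξ a)), ?_,
      fun M hM R => (h M hM R).trans ?_⟩
    · simpa [List.forall_mem_ofFn_iff] using hψ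
    · simp

lemma complD_complD {k : ℕ} (D : DepPred k) : complD (complD D) = D :=
  funext fun _ => funext fun _ => propext not_not

end

/-- For a relativizable first-order dependency `D`, the following
are equivalent: (i) `D` is definable by a disjunction of sentences of the form
`ψ ∧ ⋀ᵢ ∃ȳᵢ ∀x̄ (R x̄ → θᵢ) ∧ ⋀ⱼ ¬∃z̄ⱼ ∀x̄ (R x̄ → ξⱼ)` over the empty signature;
(ii) both `D` and `∼D` are definable in `FO(𝒟₀, ⊔, const, All)`;
(iii) `D` is doubly strongly first order;
(iv) both `D` and `∼D` are strongly first order. -/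
theorem doubly_sfo_characterization {k : ℕ} (D : DepPred k)
    (hiso : IsoClosed D) (hfo : FirstOrderDep D) (hrel : Relativizable1 D) :
    ((∃ (l : ℕ) (ψ : Fin l → EF) (_ : ∀ a, IsSentence (ψ a))
        (n n' : Fin l → ℕ) (θ : ∀ a, Fin (n a) → EF) (ξ : ∀ a, Fin (n' a) → EF),
        ∀ (M : Type), Nontrivial M → ∀ R : Set (Fin k → M),
          (D M R ↔ ∃ a, FOTrue M (eI M) (ψ a) ∧
            (∀ i, ExAllSem M R (θ a i)) ∧ (∀ j, ¬ ExAllSem M R (ξ a j))))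
      ↔ DSFOd D) ∧
    (((∃ φ : TS Sig0 CIdx cAr, NoCneg φ ∧
        ∀ (M : Type), Nontrivial M → ∀ X : Set (ℕ → M),
          (TSat M (eI M) (cSem M) φ X ↔ D M (teamProj (fun j : Fin k => (j : ℕ)) X))) ∧
      (∃ φ : TS Sig0 CIdx cAr, NoCneg φ ∧
        ∀ (M : Type), Nontrivial M → ∀ X : Set (ℕ → M),
          (TSat M (eI M) (cSem M) φ X ↔
            complD D M (teamProj (fun j : Fin k => (j : ℕ)) X))))
      ↔ DSFOd D) ∧
    ((SFOd D ∧ SFOd (complD D)) ↔ DSFOd D) := by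
  have h1 (h : DSFOd D) : SFOd D ∧ SFOd (complD D) := ⟨h.of_bool true, h.of_bool false⟩
  refine ⟨?_, ⟨?_, fun h => ?_⟩, fun h => (hasBasicForm_of_sfo hiso h.1 h.2).dsfo, h1⟩
  · rw [← hasBasicForm_iff]
    exact ⟨HasBasicForm.dsfo, fun h => hasBasicForm_of_sfo hiso (h1 h).1 (h1 h).2⟩
  · rintro ⟨⟨φ, hφ, h⟩, φ', hφ', h'⟩
    exact dsfo_of_hasNF (hasNF_of_definable hφ h) (hasNF_of_definable hφ' h')
  · obtain ⟨h, h'⟩ := h1 h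
    refine ⟨(hasBasicForm_of_sfo hiso h h').cdef, (hasBasicForm_of_sfo hiso.compl h' ?_).cdef⟩
    rwa [complD_complD]

end DSFO
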